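/- Let T : ℝ² → ℝ² be the translation T(x,y) = (x+1,y) and let π : ℝ² → A := (ℝ/ℤ) × ℝ be the quotient map, so that A is an open annulus whose two ends 0 and ∞ correspond to the second coordinate tending to −∞ and +∞ respectively. Let g̃ be a C¹ diffeomorphism of ℝ² whose Jacobian determinant is positive at every point, such that g̃ ∘ T = T ∘ g̃ and such that the second coordinate of g̃(x,y) tends to +∞ as y → +∞ and to −∞ as y → −∞; let g : A → A be the induced C¹ diffeomorphism determined by π ∘ g̃ = g ∘ π. Let μ be a g-invariant ergodic Borel probability measure on A whose topological support K₀ is compact, and let φ : A → ℝ be the continuous function determined by φ(π(p)) = p₁(g̃(p)) − p₁(p), where p₁ denotes the first coordinate (φ is well defined since g̃ commutes with T). Assume that the rotation number ρ_μ(g̃) := ∫_A φ dμ equals 0 and that Fix(g̃) ∩ π⁻¹(K₀) = ∅. Then there exists a point z ∈ π(Fix(g̃)) such that z peripherally contains neither the end 0 nor the end ∞ of A rel K₀. -/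

import Mathlib

open Filter MeasureTheory

/-- The covering projection `ℝ² → A = (ℝ/ℤ) × ℝ` of the open annulus. -/
noncomputable def annulusProj : ℝ × ℝ → AddCircle (1 : ℝ) × ℝ :=
  fun p => ((p.1 : AddCircle (1 : ℝ)), p.2)

/-- A fixed point `z` of `g : A → A` *peripherally contains the end of `A`
described by the filter `l`* (`l = atTop` for the end `∞`, `l = atBot` for the
end `0`) rel `K₀`, if there are a continuous path `γ : [0,1) → A ∖ K₀` with
`γ 0 = z` whose second coordinate tends to `l`, and a proper homotopy
`Ht : [0,1) × [0,1] → A ∖ K₀` from `γ` to `g ∘ γ` relative to `0`. -/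
def PeriphContainsEnd (K₀ : Set (AddCircle (1 : ℝ) × ℝ))
    (g : AddCircle (1 : ℝ) × ℝ → AddCircle (1 : ℝ) × ℝ)
    (z : AddCircle (1 : ℝ) × ℝ) (l : Filter ℝ) : Prop :=
  ∃ γ : ℝ → AddCircle (1 : ℝ) × ℝ, ∃ Ht : ℝ × ℝ → AddCircle (1 : ℝ) × ℝ,
    ContinuousOn γ (Set.Ico 0 1) ∧ γ 0 = z ∧
    (∀ t ∈ Set.Ico (0:ℝ) 1, γ t ∉ K₀) ∧
    Tendsto (fun t => (γ t).2) (nhdsWithin 1 (Set.Ico (0:ℝ) 1)) l ∧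
    ContinuousOn Ht (Set.Ico (0:ℝ) 1 ×ˢ Set.Icc (0:ℝ) 1) ∧
    (∀ p ∈ Set.Ico (0:ℝ) 1 ×ˢ Set.Icc (0:ℝ) 1, Ht p ∉ K₀) ∧
    (∀ t ∈ Set.Ico (0:ℝ) 1, Ht (t, 0) = γ t ∧ Ht (t, 1) = g (γ t)) ∧
    (∀ s ∈ Set.Icc (0:ℝ) 1, Ht (0, s) = z) ∧
    (∀ C : Set (AddCircle (1 : ℝ) × ℝ), IsCompact C → C ⊆ K₀ᶜ →
      IsCompact {p ∈ Set.Ico (0:ℝ) 1 ×ˢ Set.Icc (0:ℝ) 1 | Ht p ∈ C})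

/-! ### Combinatorial lemma (Scarf / Petri–Voorneveld) -/

/-- dominant sets -/
def ScDom {Z I : Type} (u : I → Z → ℝ) (D : Finset Z) : Prop :=
  ∀ z, ∃ i, ∀ d ∈ D, u i z ≤ u i d

lemma ScDom.mono {Z I : Type} {u : I → Z → ℝ} {D D' : Finset Z} (h : ScDom u D) (hs : D' ⊆ D) :
    ScDom u D' := by
  intro z
  obtain ⟨i, hi⟩ := h z
  exact ⟨i, fun d hd => hi d (hs hd)⟩

lemma scDom_door {Z I : Type} [Fintype Z] [DecidableEq Z] [Fintype I] [DecidableEq I]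
    (u : I → Z → ℝ) (hu : ∀ i, Function.Injective (u i)) (D : Finset Z) (hD : ScDom u D)
    (hne : D.Nonempty) (hcard : D.card + 1 = Fintype.card I)
    (hM : ∀ k, ∃ x, ∀ l, l ≠ k → ∃ d ∈ D, u l d < u l x) :
    ∃ p q : Z, p ≠ q ∧ ∀ x, (x ∉ D ∧ ScDom u (insert x D)) ↔ (x = p ∨ x = q) := by
  classical
  have hex : ∀ i : I, ∃ a ∈ D, ∀ d ∈ D, u i a ≤ u i d := fun i =>
    Finset.exists_min_image D (u i) hne
  choose a haD hamin using hex
  have hsurj : ∀ d ∈ D, ∃ i, a i = d := by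
    intro d hd
    obtain ⟨i, hi⟩ := hD d
    exact ⟨i, hu i (le_antisymm (hamin i d hd) (hi _ (haD i)))⟩
  obtain ⟨i, -, j, -, hij, haij⟩ : ∃ x ∈ (Finset.univ : Finset I), ∃ y ∈ (Finset.univ : Finset I),
      x ≠ y ∧ a x = a y := by
    apply Finset.exists_ne_map_eq_of_card_lt_of_maps_to (t := D)
    · rw [Finset.card_univ]; omega
    · intro i _; exact haD i
  -- properties of good indices
  have hgoodsurj : ∀ k, (k = i ∨ k = j) → ∀ d ∈ D, ∃ l, l ≠ k ∧ a l = d := by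
    intro k hk d hd
    obtain ⟨l, hl⟩ := hsurj d hd
    by_cases hlk : l = k
    · subst hlk
      rcases hk with rfl | rfl
      · exact ⟨j, hij.symm, by rw [← haij, hl]⟩
      · exact ⟨i, hij, by rw [haij, hl]⟩
    · exact ⟨l, hlk, hl⟩
  have hinj : ∀ k, (∀ d ∈ D, ∃ l, l ≠ k ∧ a l = d) → ∀ l m, l ≠ k → m ≠ k → a l = a m → l = m := by
    intro k hk l m hl hm hlm
    have him : (Finset.univ.erase k).image a = D := by
      ext d
      simp only [Finset.mem_image, Finset.mem_erase, Finset.mem_univ, and_true]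
      constructor
      · rintro ⟨l, _, rfl⟩; exact haD l
      · intro hd; exact hk d hd
    have hc : ((Finset.univ.erase k).image a).card = (Finset.univ.erase k).card := by
      rw [him, Finset.card_erase_of_mem (Finset.mem_univ k), Finset.card_univ]; omega
    have := Finset.card_image_iff.mp hc
    exact this (by simp [hl]) (by simp [hm]) hlm
  have hmax : ∀ k, ∃ x, (∀ l, l ≠ k → u l (a l) < u l x) ∧
      ∀ z, (∀ l, l ≠ k → u l (a l) < u l z) → u k z ≤ u k x := by
    intro k
    obtain ⟨x0, hx0⟩ := hM k
    have : ((Finset.univ : Finset Z).filter (fun x => ∀ l, l ≠ k → u l (a l) < u l x)).Nonempty := by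
      refine ⟨x0, ?_⟩
      simp only [Finset.mem_filter, Finset.mem_univ, true_and]
      intro l hl
      obtain ⟨d, hd, hlt⟩ := hx0 l hl
      exact lt_of_le_of_lt (hamin l d hd) hlt
    obtain ⟨x, hx, hxm⟩ := Finset.exists_max_image _ (u k) this
    simp only [Finset.mem_filter, Finset.mem_univ, true_and] at hx hxm
    exact ⟨x, hx, hxm⟩
  choose X hX hXmax using hmax
  have hXnot : ∀ k, (k = i ∨ k = j) → X k ∉ D := by
    intro k hk hmem
    obtain ⟨l, hl, hal⟩ := hgoodsurj k hk _ hmem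
    have := hX k l hl
    rw [hal] at this
    exact lt_irrefl _ this
  have hXdom : ∀ k, (k = i ∨ k = j) → ScDom u (insert (X k) D) := by
    intro k hk z
    by_cases hz : ∀ l, l ≠ k → u l (a l) < u l z
    · refine ⟨k, ?_⟩
      obtain ⟨l, hl⟩ := hD z
      have hlk : l = k := by
        by_contra h
        exact absurd (hl _ (haD l)) (not_le.mpr (hz l h))
      subst hlk
      intro d hd
      rcases Finset.mem_insert.mp hd with rfl | hd
      · exact hXmax l z hz
      · exact hl d hd
    · push Not at hz
      obtain ⟨l, hlk, hl⟩ := hz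
      refine ⟨l, ?_⟩
      intro d hd
      rcases Finset.mem_insert.mp hd with rfl | hd
      · exact hl.trans (hX k l hlk).le
      · exact hl.trans (hamin l d hd)
  refine ⟨X i, X j, ?_, ?_⟩
  · intro h
    obtain ⟨l, hl⟩ := hD (X i)
    have := hl _ (haD l)
    by_cases hli : l = i
    · have h2 := hX j l (by rw [hli]; exact hij)
      rw [← h] at h2
      linarith
    · have h2 := hX i l hli
      linarith
  · intro x
    constructor
    · rintro ⟨hx, hdom⟩
      obtain ⟨k, hk⟩ := hdom x
      have hl : ∀ d ∈ D, ∃ l, l ≠ k ∧ a l = d ∧ u l d ≤ u l x := by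
        intro d hd
        obtain ⟨l, hl⟩ := hdom d
        have hld : a l = d :=
          hu l (le_antisymm (hamin l d hd) (hl _ (Finset.mem_insert_of_mem (haD l))))
        refine ⟨l, ?_, hld, hl x (Finset.mem_insert_self _ _)⟩
        rintro rfl
        have : x = d := hu l (le_antisymm (hk d (Finset.mem_insert_of_mem hd))
          (hl x (Finset.mem_insert_self _ _)))
        exact hx (this ▸ hd)
      have hk' : ∀ d ∈ D, ∃ l, l ≠ k ∧ a l = d := fun d hd =>
        let ⟨l, h1, h2, _⟩ := hl d hd; ⟨l, h1, h2⟩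
      have hkij : k = i ∨ k = j := by
        by_contra h
        push Not at h
        exact hij (hinj k hk' i j (Ne.symm h.1) (Ne.symm h.2) haij)
      have hxM : ∀ l, l ≠ k → u l (a l) < u l x := by
        intro l hlk
        obtain ⟨m, hmk, ham, hle⟩ := hl (a l) (haD l)
        have : l = m := hinj k hk' l m hlk hmk ham.symm
        subst this
        refine lt_of_le_of_ne hle ?_
        intro h
        exact hx (hu l h ▸ haD l)
      have hxX : x = X k := by
        apply hu k
        apply le_antisymm (hXmax k x hxM)
        obtain ⟨l, hl⟩ := hdom (X k)
        have hlk : l = k := by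
          by_contra h
          exact absurd (hl _ (Finset.mem_insert_of_mem (haD l))) (not_le.mpr (hX k l h))
        subst hlk
        exact hl x (Finset.mem_insert_self _ _)
      rcases hkij with rfl | rfl
      · exact Or.inl hxX
      · exact Or.inr hxX
    · rintro (rfl | rfl)
      · exact ⟨hXnot i (Or.inl rfl), hXdom i (Or.inl rfl)⟩
      · exact ⟨hXnot j (Or.inr rfl), hXdom j (Or.inr rfl)⟩

lemma sc_parity {Z I : Type} [Fintype Z] [DecidableEq Z] [Fintype I] [DecidableEq I]
    (u : I → Z → ℝ) (hu : ∀ i, Function.Injective (u i)) (c : Z → I) (i0 : I)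
    (D0 : Finset Z) (hD0 : ScDom u D0) (hD0card : D0.card + 1 = Fintype.card I)
    (hD0c : D0.image c = Finset.univ.erase i0)
    (hD0u : ∃ p, ∀ x, (x ∉ D0 ∧ ScDom u (insert x D0)) ↔ x = p)
    (hdoors : ∀ D : Finset Z, ScDom u D → D.card + 1 = Fintype.card I →
      D.image c = Finset.univ.erase i0 → D ≠ D0 →
      D.Nonempty ∧ ∀ k, ∃ x, ∀ l, l ≠ k → ∃ d ∈ D, u l d < u l x) :
    ∃ D : Finset Z, ScDom u D ∧ D.card = Fintype.card I ∧ D.image c = Finset.univ := by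
  classical
  by_contra hcon
  push Not at hcon
  set s : Finset (Finset Z) := Finset.univ.filter (fun D => ScDom u D ∧
    D.card + 1 = Fintype.card I ∧ D.image c = Finset.univ.erase i0) with hs
  set t : Finset (Finset Z) := Finset.univ.filter (fun D => ScDom u D ∧
    D.card = Fintype.card I) with ht
  set r : Finset Z → Finset Z → Prop := fun D R => ∃ x, x ∉ D ∧ R = insert x D with hr
  have hsum := Finset.sum_card_bipartiteAbove_eq_sum_card_bipartiteBelow (s := s) (t := t) r
  have hins : ∀ (D : Finset Z) (p q : Z), p ∉ D → q ∉ D → insert p D = insert q D → p = q := by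
    intro D p q hp hq h
    have : p ∈ insert q D := h ▸ Finset.mem_insert_self p D
    rcases Finset.mem_insert.mp this with h | h
    · exact h
    · exact absurd h hp
  have habove : ∀ D ∈ s, D ≠ D0 → (t.bipartiteAbove r D).card = 2 := by
    intro D hD hne
    simp only [hs, Finset.mem_filter, Finset.mem_univ, true_and] at hD
    obtain ⟨hd, hc, hcol⟩ := hD
    obtain ⟨h1, h2⟩ := hdoors D hd hc hcol hne
    obtain ⟨p, q, hpq, hiff⟩ := scDom_door u hu D hd h1 hc h2
    have hp := (hiff p).mpr (Or.inl rfl)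
    have hq := (hiff q).mpr (Or.inr rfl)
    have : t.bipartiteAbove r D = {insert p D, insert q D} := by
      ext R
      simp only [Finset.bipartiteAbove, ht, hr, Finset.mem_filter, Finset.mem_univ, true_and,
        Finset.mem_insert, Finset.mem_singleton]
      constructor
      · rintro ⟨⟨hdR, _⟩, x, hx, rfl⟩
        rcases (hiff x).mp ⟨hx, hdR⟩ with rfl | rfl
        · exact Or.inl rfl
        · exact Or.inr rfl
      · rintro (rfl | rfl)
        · exact ⟨⟨hp.2, by rw [Finset.card_insert_of_notMem hp.1, hc]⟩, p, hp.1, rfl⟩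
        · exact ⟨⟨hq.2, by rw [Finset.card_insert_of_notMem hq.1, hc]⟩, q, hq.1, rfl⟩
    rw [this, Finset.card_pair]
    intro h
    exact hpq (hins D p q hp.1 hq.1 h)
  have habove0 : (t.bipartiteAbove r D0).card = 1 := by
    obtain ⟨p, hp⟩ := hD0u
    have hp' := (hp p).mpr rfl
    have : t.bipartiteAbove r D0 = {insert p D0} := by
      ext R
      simp only [Finset.bipartiteAbove, ht, hr, Finset.mem_filter, Finset.mem_univ, true_and,
        Finset.mem_singleton]
      constructor
      · rintro ⟨⟨hdR, _⟩, x, hx, rfl⟩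
        rw [(hp x).mp ⟨hx, hdR⟩]
      · rintro rfl
        exact ⟨⟨hp'.2, by rw [Finset.card_insert_of_notMem hp'.1, hD0card]⟩, p, hp'.1, rfl⟩
    rw [this, Finset.card_singleton]
  have hbelow : ∀ R ∈ t, Even (s.bipartiteBelow r R).card := by
    intro R hR
    simp only [ht, Finset.mem_filter, Finset.mem_univ, true_and] at hR
    obtain ⟨hRd, hRc⟩ := hR
    have hnot := hcon R hRd hRc
    by_cases hemp : s.bipartiteBelow r R = ∅
    · rw [hemp]; simp
    · obtain ⟨D, hD⟩ := Finset.nonempty_iff_ne_empty.mpr hemp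
      simp only [Finset.bipartiteBelow, hs, hr, Finset.mem_filter, Finset.mem_univ, true_and] at hD
      obtain ⟨⟨hd, hc, hcol⟩, x, hx, rfl⟩ := hD
      have hinj : Set.InjOn c D := by
        apply Finset.card_image_iff.mp
        rw [hcol, Finset.card_erase_of_mem (Finset.mem_univ _), Finset.card_univ]; omega
      have hcx : c x ≠ i0 := by
        intro h
        apply hnot
        rw [Finset.image_insert, hcol, h, Finset.insert_erase (Finset.mem_univ _)]
      have : c x ∈ D.image c := by rw [hcol]; simp [hcx]
      obtain ⟨y, hy, hyx⟩ := Finset.mem_image.mp this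
      have hxy : x ≠ y := by rintro rfl; exact hx hy
      have hset : s.bipartiteBelow r (insert x D) = {D, (insert x D).erase y} := by
        ext D'
        simp only [Finset.bipartiteBelow, hs, hr, Finset.mem_filter, Finset.mem_univ, true_and,
          Finset.mem_insert, Finset.mem_singleton]
        constructor
        · rintro ⟨⟨hd', hc', hcol'⟩, z, hz, heq⟩
          have hD' : D' = (insert x D).erase z := by rw [heq, Finset.erase_insert hz]
          have hzm : z ∈ insert x D := by rw [heq]; exact Finset.mem_insert_self _ _
          rcases Finset.mem_insert.mp hzm with rfl | hzD
          · left; rw [hD', Finset.erase_insert hx]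
          · right
            by_cases hzy : z = y
            · rw [hD', hzy]
            · exfalso
              have hinj' : Set.InjOn c D' := by
                apply Finset.card_image_iff.mp
                rw [hcol', Finset.card_erase_of_mem (Finset.mem_univ _), Finset.card_univ]; omega
              have hxD' : x ∈ D' := by
                rw [hD']
                refine Finset.mem_erase.mpr ⟨?_, Finset.mem_insert_self _ _⟩
                rintro rfl; exact hx hzD
              have hyD' : y ∈ D' := by
                rw [hD']
                exact Finset.mem_erase.mpr ⟨Ne.symm hzy, Finset.mem_insert_of_mem hy⟩
              exact hxy (hinj' hxD' hyD' hyx.symm)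
        · rintro (rfl | rfl)
          · exact ⟨⟨hd, hc, hcol⟩, x, hx, rfl⟩
          · have hym : y ∈ insert x D := Finset.mem_insert_of_mem hy
            refine ⟨⟨hRd.mono (Finset.erase_subset _ _), ?_, ?_⟩, y, by simp,
              (Finset.insert_erase hym).symm⟩
            · rw [Finset.card_erase_of_mem hym, Finset.card_insert_of_notMem hx]; omega
            · rw [← hcol]
              ext i
              simp only [Finset.mem_image, Finset.mem_erase, Finset.mem_insert]
              constructor
              · rintro ⟨w, ⟨hw, rfl | hw'⟩, rfl⟩
                · exact ⟨y, hy, hyx⟩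
                · exact ⟨w, hw', rfl⟩
              · rintro ⟨w, hw, rfl⟩
                by_cases hwy : w = y
                · exact ⟨x, ⟨hxy, Or.inl rfl⟩, by rw [hwy, hyx]⟩
                · exact ⟨w, ⟨hwy, Or.inr hw⟩, rfl⟩
      rw [hset, Finset.card_pair]
      · exact even_two
      · intro h
        have : x ∈ D := by
          rw [h]; exact Finset.mem_erase.mpr ⟨hxy, Finset.mem_insert_self _ _⟩
        exact hx this
  have hD0s : D0 ∈ s := by
    simp only [hs, Finset.mem_filter, Finset.mem_univ, true_and]
    exact ⟨hD0, hD0card, hD0c⟩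
  have heven : Even (∑ b ∈ t, (s.bipartiteBelow r b).card) := Finset.even_sum _ hbelow
  rw [← hsum, ← Finset.add_sum_erase _ _ hD0s, habove0] at heven
  have h2 : Even (∑ x ∈ s.erase D0, (t.bipartiteAbove r x).card) := by
    apply Finset.even_sum
    intro D hD
    rw [habove D (Finset.mem_of_mem_erase hD) (Finset.ne_of_mem_erase hD)]
    exact even_two
  rw [Nat.even_add] at heven
  exact Nat.not_even_one (heven.mpr h2)

lemma sc_main {X I : Type} [Fintype X] [DecidableEq X] [Fintype I] [DecidableEq I]
    [Nonempty X] (i0 : I) (u : I → X → ℝ) (hu : ∀ i, Function.Injective (u i)) (B : ℝ)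
    (hu0 : ∀ i x, 0 ≤ u i x) (huB : ∀ i x, u i x < B) (c : X → I) :
    ∃ (D : Finset X) (C : Finset I), D.Nonempty ∧ D.image c = C ∧
      ∀ x, ∃ i ∈ C, ∀ d ∈ D, u i x ≤ u i d := by
  classical
  let e : I ≃ Fin (Fintype.card I) := Fintype.equivFin I
  let U : I → X ⊕ I → ℝ := fun i z => Sum.elim (u i)
    (fun j => if j = i then -1 else B + ((e j : ℕ) : ℝ)) z
  have Uinl : ∀ i x, U i (Sum.inl x) = u i x := fun _ _ => rfl
  have Uself : ∀ i, U i (Sum.inr i) = -1 := fun i => by simp [U]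
  have Une : ∀ i j, j ≠ i → U i (Sum.inr j) = B + ((e j : ℕ) : ℝ) := fun i j h => by simp [U, h]
  have hB : 0 ≤ B := by
    obtain ⟨x⟩ := ‹Nonempty X›
    exact (hu0 i0 x).trans (huB i0 x).le
  have UneB : ∀ i j, j ≠ i → B ≤ U i (Sum.inr j) := fun i j h => by
    rw [Une i j h]; have : (0:ℝ) ≤ ((e j : ℕ) : ℝ) := Nat.cast_nonneg _
    linarith
  have Umin : ∀ i z, U i (Sum.inr i) ≤ U i z := by
    intro i z
    rw [Uself]
    rcases z with x | j
    · rw [Uinl]; linarith [hu0 i x]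
    · by_cases h : j = i
      · subst h; rw [Uself]
      · linarith [UneB i j h]
  have hUinj : ∀ i, Function.Injective (U i) := by
    intro i z w hzw
    rcases z with x | j <;> rcases w with y | k
    · rw [Uinl, Uinl] at hzw; rw [hu i hzw]
    · exfalso
      rw [Uinl] at hzw
      by_cases h : k = i
      · subst h; rw [Uself] at hzw; linarith [hu0 k x]
      · linarith [UneB i k h, huB i x]
    · exfalso
      rw [Uinl] at hzw
      by_cases h : j = i
      · subst h; rw [Uself] at hzw; linarith [hu0 j y]
      · linarith [UneB i j h, huB i y]
    · by_cases h : j = i <;> by_cases h' : k = i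
      · rw [h, h']
      · exfalso; subst h; rw [Uself] at hzw; linarith [UneB j k h']
      · exfalso; subst h'; rw [Uself] at hzw; linarith [UneB k j h]
      · rw [Une i j h, Une i k h'] at hzw
        have : ((e j : ℕ) : ℝ) = ((e k : ℕ) : ℝ) := by linarith
        have := e.injective (Fin.ext (Nat.cast_injective this))
        rw [this]
  let c' : X ⊕ I → I := Sum.elim c id
  let D0 : Finset (X ⊕ I) := (Finset.univ.erase i0).image Sum.inr
  have memD0 : ∀ j, Sum.inr j ∈ D0 ↔ j ≠ i0 := by
    intro j; simp [D0]
  have hsub : ∀ (D : Finset (X ⊕ I)), (∀ x, Sum.inl x ∉ D) → D.image c' = Finset.univ.erase i0 →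
      D = D0 := by
    intro D hD hDc
    ext z
    rcases z with x | j
    · simp [D0, hD x]
    · rw [memD0]
      constructor
      · intro h
        have : c' (Sum.inr j) ∈ D.image c' := Finset.mem_image_of_mem _ h
        rw [hDc] at this
        simpa [c'] using this
      · intro h
        have : j ∈ D.image c' := by rw [hDc]; simp [h]
        obtain ⟨w, hw, hwj⟩ := Finset.mem_image.mp this
        rcases w with x | k
        · exact absurd hw (hD x)
        · simp only [c', Sum.elim_inr, id] at hwj
          rwa [hwj] at hw
  obtain ⟨D, hD, hDc, hDcol⟩ := sc_parity U hUinj c' i0 D0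
    (by
      intro z
      rcases z with x | j
      · refine ⟨i0, fun d hd => ?_⟩
        simp only [D0, Finset.mem_image, Finset.mem_erase, Finset.mem_univ, and_true] at hd
        obtain ⟨j, hj, rfl⟩ := hd
        exact ((huB i0 x).le).trans (UneB i0 j hj)
      · exact ⟨j, fun d _ => Umin j d⟩)
    (by
      rw [Finset.card_image_of_injective _ Sum.inr_injective,
        Finset.card_erase_of_mem (Finset.mem_univ _), Finset.card_univ]
      have : 0 < Fintype.card I := Fintype.card_pos_iff.mpr ⟨i0⟩
      omega)
    (by
      rw [Finset.image_image]
      ext j; simp [c'])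
    (by
      obtain ⟨p, -, hp⟩ := Finset.exists_max_image (Finset.univ : Finset X) (u i0)
        Finset.univ_nonempty
      refine ⟨Sum.inl p, fun x => ⟨?_, ?_⟩⟩
      · rintro ⟨hx, hdom⟩
        have key : ∀ z, ∀ d ∈ insert x D0, U i0 (Sum.inl z) ≤ U i0 d := by
          intro z
          obtain ⟨i, hi⟩ := hdom (Sum.inl z)
          by_cases h : i = i0
          · rw [← h]; exact hi
          · exfalso
            have := hi (Sum.inr i) (Finset.mem_insert_of_mem ((memD0 i).mpr h))
            rw [Uself, Uinl] at this
            linarith [hu0 i z]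
        rcases x with x | j
        · have h1 := key p _ (Finset.mem_insert_self _ _)
          have h2 := hp x (Finset.mem_univ _)
          rw [Uinl, Uinl] at h1
          rw [hu i0 (le_antisymm h2 h1)]
        · exfalso
          have hj : j = i0 := by
            by_contra h; exact hx ((memD0 j).mpr h)
          subst hj
          have := key p _ (Finset.mem_insert_self _ _)
          rw [Uself, Uinl] at this
          linarith [hu0 j p]
      · rintro rfl
        refine ⟨by simp [D0], fun z => ?_⟩
        rcases z with x | j
        · refine ⟨i0, fun d hd => ?_⟩
          rcases Finset.mem_insert.mp hd with rfl | hd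
          · exact hp x (Finset.mem_univ _)
          · simp only [D0, Finset.mem_image, Finset.mem_erase, Finset.mem_univ, and_true] at hd
            obtain ⟨j, hj, rfl⟩ := hd
            exact ((huB i0 x).le).trans (UneB i0 j hj)
        · exact ⟨j, fun d _ => Umin j d⟩)
    (by
      intro D hD hDc hDcol hne
      have : ∃ x, Sum.inl x ∈ D := by
        by_contra h
        push Not at h
        exact hne (hsub D h hDcol)
      obtain ⟨x0, hx0⟩ := this
      refine ⟨⟨_, hx0⟩, fun k => ⟨Sum.inr k, fun l hl => ⟨_, hx0, ?_⟩⟩⟩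
      exact lt_of_lt_of_le (huB l x0) (UneB l k (Ne.symm hl)))
  have hinj : Set.InjOn c' D := by
    apply Finset.card_image_iff.mp
    rw [hDcol, Finset.card_univ, hDc]
  set E : Finset X := Finset.univ.filter (fun x => Sum.inl x ∈ D) with hE
  set C : Finset I := Finset.univ.filter (fun i => Sum.inr i ∉ D) with hC
  have hEC : E.image c = C := by
    ext i
    simp only [hE, hC, Finset.mem_image, Finset.mem_filter, Finset.mem_univ, true_and]
    constructor
    · rintro ⟨x, hx, rfl⟩ h
      have := hinj hx h rfl
      simp at this
    · intro h
      have : i ∈ D.image c' := by rw [hDcol]; simp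
      obtain ⟨w, hw, hwi⟩ := Finset.mem_image.mp this
      rcases w with x | k
      · exact ⟨x, hw, hwi⟩
      · simp only [c', Sum.elim_inr, id] at hwi
        rw [hwi] at hw; exact absurd hw h
  have hdom : ∀ x, ∃ i ∈ C, ∀ d ∈ E, u i x ≤ u i d := by
    intro x
    obtain ⟨i, hi⟩ := hD (Sum.inl x)
    refine ⟨i, ?_, fun d hd => ?_⟩
    · simp only [hC, Finset.mem_filter, Finset.mem_univ, true_and]
      intro h
      have := hi _ h
      rw [Uself, Uinl] at this
      linarith [hu0 i x]
    · simp only [hE, Finset.mem_filter, Finset.mem_univ, true_and] at hd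
      exact hi _ hd
  refine ⟨E, C, ?_, hEC, hdom⟩
  by_contra hemp
  rw [Finset.not_nonempty_iff_eq_empty] at hemp
  obtain ⟨x⟩ := ‹Nonempty X›
  obtain ⟨i, hi, _⟩ := hdom x
  rw [← hEC, hemp] at hi
  simp at hi

lemma brouwer_approx {I : Type} [Fintype I] [DecidableEq I] [Nonempty I]
    (f : (I → ℝ) → (I → ℝ)) (hmaps : ∀ x ∈ stdSimplex ℝ I, f x ∈ stdSimplex ℝ I)
    (m : ℕ) (hm : 0 < m) :
    ∃ d ∈ stdSimplex ℝ I, ∀ i, ∃ y ∈ stdSimplex ℝ I,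
      (∀ j, |y j - d j| ≤ Fintype.card I / m) ∧ y i - Fintype.card I / m ≤ f y i := by
  classical
  let X := {k : I → Fin (m+1) // ∑ i, (k i : ℕ) = m}
  obtain ⟨i0⟩ := ‹Nonempty I›
  have : Nonempty X := by
    refine ⟨⟨fun i => if i = i0 then Fin.last m else 0, ?_⟩⟩
    rw [Finset.sum_eq_single i0]
    · simp
    · intro b _ hb; simp [hb]
    · simp
  have hm' : (0:ℝ) < m := by exact_mod_cast hm
  let P : X → I → ℝ := fun x i => ((x.1 i : ℕ) : ℝ) / m
  have hP : ∀ x, P x ∈ stdSimplex ℝ I := by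
    intro x
    refine ⟨fun i => by positivity, ?_⟩
    simp only [P]
    rw [← Finset.sum_div, ← Nat.cast_sum, x.2]
    field_simp
  have hcol : ∀ x, ∃ i, P x i ≤ f (P x) i := by
    intro x
    have h1 := (hP x).2
    have h2 := (hmaps _ (hP x)).2
    have : ∃ i ∈ (Finset.univ : Finset I), P x i ≤ f (P x) i := by
      apply Finset.exists_le_of_sum_le
      · exact ⟨i0, Finset.mem_univ _⟩
      · rw [h1, h2]
    obtain ⟨i, _, hi⟩ := this
    exact ⟨i, hi⟩
  choose c hc using hcol
  let e : X ≃ Fin (Fintype.card X) := Fintype.equivFin X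
  let N : ℝ := (Fintype.card X : ℝ) + 1
  have hN : 0 < N := by positivity
  let u : I → X → ℝ := fun i x => ((x.1 i : ℕ) : ℝ) + ((e x : ℕ) : ℝ) / N
  have hfrac : ∀ x : X, ((e x : ℕ) : ℝ) / N < 1 := by
    intro x
    rw [div_lt_one hN]
    have : ((e x : ℕ) : ℝ) < (Fintype.card X : ℝ) := by exact_mod_cast (e x).2
    simp only [N]; linarith
  have hfrac0 : ∀ x : X, 0 ≤ ((e x : ℕ) : ℝ) / N := fun x => by positivity
  have hule : ∀ i x y, u i x ≤ u i y → (x.1 i : ℕ) ≤ (y.1 i : ℕ) := by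
    intro i x y h
    simp only [u] at h
    have : ((x.1 i : ℕ) : ℝ) < ((y.1 i : ℕ) : ℝ) + 1 := by
      linarith [hfrac y, hfrac0 x]
    have : (x.1 i : ℕ) < (y.1 i : ℕ) + 1 := by exact_mod_cast this
    omega
  obtain ⟨D, C, hDne, hDC, hdom⟩ := sc_main i0 u
    (by
      intro i x y h
      have h1 := hule i x y h.le
      have h2 := hule i y x h.ge
      have h3 : (x.1 i : ℕ) = (y.1 i : ℕ) := le_antisymm h1 h2
      simp only [u, h3] at h
      have h4 : ((e x : ℕ) : ℝ) / N = ((e y : ℕ) : ℝ) / N := by linarith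
      have h5 : ((e x : ℕ) : ℝ) = ((e y : ℕ) : ℝ) := by
        field_simp at h4; exact h4
      exact e.injective (Fin.ext (Nat.cast_injective h5)))
    ((m:ℝ) + 1)
    (by intro i x; simp only [u]; have := hfrac0 x; positivity)
    (by
      intro i x
      simp only [u]
      have h1 : ((x.1 i : ℕ) : ℝ) ≤ m := by exact_mod_cast Nat.lt_succ_iff.mp (x.1 i).2
      linarith [hfrac x])
    c
  have hCne : C.Nonempty := by rw [← hDC]; exact hDne.image c
  have hex : ∀ i, ∃ d ∈ D, ∀ d' ∈ D, (d.1 i : ℕ) ≤ (d'.1 i : ℕ) := fun i =>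
    Finset.exists_min_image D (fun d => (d.1 i : ℕ)) hDne
  choose a haD hamin using hex
  set mm : I → ℕ := fun i => ((a i).1 i : ℕ) with hmm
  have hsumC : m < ∑ i ∈ C, (mm i + 1) := by
    by_contra hle
    push Not at hle
    obtain ⟨i1, hi1⟩ := hCne
    let k : I → ℕ := fun i => if i = i1 then m - ∑ j ∈ C.erase i1, (mm j + 1) else
      if i ∈ C then mm i + 1 else 0
    have hsplit := Finset.add_sum_erase C (fun i => mm i + 1) hi1
    have hk1 : mm i1 + 1 ≤ k i1 := by simp only [k, if_true]; omega
    have hk : ∀ i ∈ C, mm i + 1 ≤ k i := by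
      intro i hi
      by_cases h : i = i1
      · rw [h]; exact hk1
      · simp [k, h, hi]
    have hksum : ∑ i, k i = m := by
      rw [← Finset.add_sum_erase Finset.univ k (Finset.mem_univ i1)]
      have : ∑ x ∈ Finset.univ.erase i1, k x = ∑ j ∈ C.erase i1, (mm j + 1) := by
        symm
        rw [← Finset.sum_subset (Finset.erase_subset_erase i1 (Finset.subset_univ C))]
        · apply Finset.sum_congr rfl
          intro j hj
          simp [k, Finset.ne_of_mem_erase hj, Finset.mem_of_mem_erase hj]
        · intro x hx hx'
          have h1 : x ≠ i1 := Finset.ne_of_mem_erase hx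
          have h2 : x ∉ C := fun h => hx' (Finset.mem_erase.mpr ⟨h1, h⟩)
          simp [k, h1, h2]
      rw [this]
      simp only [k, if_true]; omega
    have hkle : ∀ i, k i < m + 1 := by
      intro i
      have := Finset.single_le_sum (f := k) (fun _ _ => Nat.zero_le _) (Finset.mem_univ i)
      omega
    obtain ⟨i, hi, hid⟩ := hdom ⟨fun i => ⟨k i, hkle i⟩, hksum⟩
    have h1 := hule _ _ _ (hid (a i) (haD i))
    have h2 := hk i hi
    simp only [hmm] at h2
    simp only at h1
    omega
  rw [Finset.sum_add_distrib, Finset.sum_const, smul_eq_mul, mul_one] at hsumC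
  have hCcard : C.card ≤ Fintype.card I := Finset.card_le_univ C
  have hsumD : ∀ d ∈ D, ∑ i ∈ C, (d.1 i : ℕ) ≤ m := by
    intro d _
    calc ∑ i ∈ C, (d.1 i : ℕ) ≤ ∑ i, (d.1 i : ℕ) :=
          Finset.sum_le_sum_of_subset (Finset.subset_univ C)
      _ = m := d.2
  have hupper : ∀ d ∈ D, ∀ i ∈ C, (d.1 i : ℕ) ≤ mm i + Fintype.card I := by
    intro d hd i hi
    have h1 := hsumD d hd
    rw [← Finset.add_sum_erase C _ hi] at h1 hsumC
    have h2 : ∑ j ∈ C.erase i, mm j ≤ ∑ j ∈ C.erase i, (d.1 j : ℕ) :=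
      Finset.sum_le_sum fun j _ => hamin j d hd
    omega
  have hout : ∀ d ∈ D, ∀ i, i ∉ C → (d.1 i : ℕ) ≤ Fintype.card I := by
    intro d hd i hi
    have h1 : ∑ j ∈ insert i C, (d.1 j : ℕ) ≤ m := by
      calc ∑ j ∈ insert i C, (d.1 j : ℕ) ≤ ∑ j, (d.1 j : ℕ) :=
            Finset.sum_le_sum_of_subset (Finset.subset_univ _)
        _ = m := d.2
    rw [Finset.sum_insert hi] at h1
    have h2 : ∑ j ∈ C, mm j ≤ ∑ j ∈ C, (d.1 j : ℕ) :=
      Finset.sum_le_sum fun j _ => hamin j d hd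
    omega
  have hclose : ∀ d ∈ D, ∀ d' ∈ D, ∀ j, |P d j - P d' j| ≤ Fintype.card I / m := by
    intro d hd d' hd' j
    have hnat : (d.1 j : ℕ) ≤ (d'.1 j : ℕ) + Fintype.card I ∧
        (d'.1 j : ℕ) ≤ (d.1 j : ℕ) + Fintype.card I := by
      by_cases hj : j ∈ C
      · have h1 := hupper d hd j hj
        have h2 := hupper d' hd' j hj
        have h3 := hamin j d hd
        have h4 := hamin j d' hd'
        simp only [hmm] at h1 h2
        omega
      · have h1 := hout d hd j hj
        have h2 := hout d' hd' j hj
        omega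
    have h1 : ((d.1 j : ℕ) : ℝ) ≤ ((d'.1 j : ℕ) : ℝ) + Fintype.card I := by exact_mod_cast hnat.1
    have h2 : ((d'.1 j : ℕ) : ℝ) ≤ ((d.1 j : ℕ) : ℝ) + Fintype.card I := by exact_mod_cast hnat.2
    simp only [P]
    rw [← sub_div, abs_div, abs_of_pos hm', div_le_div_iff_of_pos_right hm', abs_le]
    constructor <;> linarith
  obtain ⟨d0, hd0⟩ := hDne
  refine ⟨P d0, hP d0, fun i => ?_⟩
  by_cases hi : i ∈ C
  · rw [← hDC] at hi
    obtain ⟨d, hd, hdi⟩ := Finset.mem_image.mp hi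
    refine ⟨P d, hP d, hclose d hd d0 hd0, ?_⟩
    have := hc d
    rw [hdi] at this
    have h0 : (0:ℝ) ≤ Fintype.card I / m := by positivity
    linarith
  · refine ⟨P d0, hP d0, hclose d0 hd0 d0 hd0, ?_⟩
    have h1 := (hmaps _ (hP d0)).1 i
    have h2 : ((d0.1 i : ℕ) : ℝ) ≤ Fintype.card I := by exact_mod_cast hout d0 hd0 i hi
    have h3 : P d0 i ≤ Fintype.card I / m := by
      simp only [P]; gcongr
    linarith

theorem brouwer_simplex {I : Type} [Fintype I] [Nonempty I]
    (f : (I → ℝ) → (I → ℝ)) (hmaps : ∀ x ∈ stdSimplex ℝ I, f x ∈ stdSimplex ℝ I)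
    (hf : ContinuousOn f (stdSimplex ℝ I)) : ∃ x ∈ stdSimplex ℝ I, f x = x := by
  classical
  have hcomp : IsCompact (stdSimplex ℝ I) := isCompact_stdSimplex ℝ I
  have hunif := hcomp.uniformContinuousOn_of_continuous hf
  -- approximate
  have happ : ∀ ε > 0, ∃ x ∈ stdSimplex ℝ I, ∀ i, x i - f x i ≤ ε := by
    intro ε hε
    obtain ⟨δ, hδ, hδf⟩ := Metric.uniformContinuousOn_iff.mp hunif (ε/3) (by positivity)
    obtain ⟨m, hm⟩ := exists_nat_gt ((Fintype.card I : ℝ) / (min δ (ε/3)))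
    have hmin : 0 < min δ (ε/3) := lt_min hδ (by positivity)
    have hmpos : (0:ℝ) < m := lt_of_le_of_lt (by positivity) hm
    have hsmall : (Fintype.card I : ℝ) / m < min δ (ε/3) := by
      rw [div_lt_iff₀ hmin] at hm
      rw [div_lt_iff₀ hmpos]; linarith
    obtain ⟨d, hd, hdy⟩ := brouwer_approx f hmaps m (by exact_mod_cast hmpos)
    refine ⟨d, hd, fun i => ?_⟩
    obtain ⟨y, hy, hyd, hyi⟩ := hdy i
    have hdist : dist y d < δ := by
      refine lt_of_le_of_lt ?_ (hsmall.trans_le (min_le_left _ _))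
      rw [dist_pi_le_iff (by positivity)]
      intro j; rw [Real.dist_eq]; exact hyd j
    have h1 := hδf y hy d hd hdist
    have h2 : |f y i - f d i| ≤ dist (f y) (f d) := by
      rw [← Real.dist_eq]; exact dist_le_pi_dist _ _ i
    have h3 := abs_le.mp (h2.trans h1.le)
    have h4 := abs_le.mp (hyd i)
    have h5 := hsmall.trans_le (min_le_right _ _)
    linarith [h3.1, h3.2, h4.1, h4.2]
  have hne : (stdSimplex ℝ I).Nonempty := by
    obtain ⟨x, hx, _⟩ := happ 1 one_pos
    exact ⟨x, hx⟩
  -- minimise the sup of x i - f x i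
  have hcont : ContinuousOn (fun x => Finset.univ.sup' Finset.univ_nonempty
      (fun i => x i - f x i)) (stdSimplex ℝ I) := by
    apply ContinuousOn.finset_sup'_apply
    intro i _
    exact (continuous_apply i).continuousOn.sub
      ((continuous_apply i).comp_continuousOn hf)
  obtain ⟨x, hx, hxmin⟩ := hcomp.exists_isMinOn hne hcont
  have hle : ∀ i, x i ≤ f x i := by
    intro i
    by_contra hlt
    push Not at hlt
    obtain ⟨y, hy, hyi⟩ := happ ((x i - f x i)/2) (by linarith)
    have h1 : Finset.univ.sup' Finset.univ_nonempty (fun i => x i - f x i) ≤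
        Finset.univ.sup' Finset.univ_nonempty (fun i => y i - f y i) := hxmin hy
    have h2 : x i - f x i ≤ Finset.univ.sup' Finset.univ_nonempty (fun i => x i - f x i) :=
      Finset.le_sup' (fun i => x i - f x i) (Finset.mem_univ i)
    have h3 : Finset.univ.sup' Finset.univ_nonempty (fun i => y i - f y i) ≤ (x i - f x i)/2 :=
      Finset.sup'_le _ _ (fun j _ => hyi j)
    linarith
  refine ⟨x, hx, ?_⟩
  have hsum : ∑ i, x i = ∑ i, f x i := by rw [hx.2, (hmaps x hx).2]
  have := (Finset.sum_eq_sum_iff_of_le (fun i _ => hle i)).mp hsum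
  funext i
  exact (this i (Finset.mem_univ i)).symm

open Topology

/-- Brouwer for finite cubes. -/
theorem brouwer_cube {S : Type} [Fintype S] (G : (S → ℝ) → (S → ℝ)) (hG : Continuous G)
    (hmaps : ∀ x s, G x s ∈ Set.Icc (0:ℝ) 1) : ∃ x, G x = x := by
  classical
  by_cases hS : IsEmpty S
  · exact ⟨0, Subsingleton.elim _ _⟩
  rw [not_isEmpty_iff] at hS
  have hn : (0:ℝ) < Fintype.card S := by exact_mod_cast Fintype.card_pos
  let r : (Option S → ℝ) → (S → ℝ) := fun x s => min 1 (Fintype.card S * x (some s))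
  let q : (S → ℝ) → (Option S → ℝ) := fun c o =>
    Option.elim o (1 - ∑ s, c s / Fintype.card S) (fun s => c s / Fintype.card S)
  have hr : Continuous r := by
    apply continuous_pi; intro s; simp only [r]; fun_prop
  have hq : Continuous q := by
    apply continuous_pi
    intro o
    rcases o with _ | s
    · simp only [q, Option.elim]; fun_prop
    · simp only [q, Option.elim]; fun_prop
  have hqm : ∀ c : S → ℝ, (∀ s, c s ∈ Set.Icc (0:ℝ) 1) → q c ∈ stdSimplex ℝ (Option S) := by
    intro c hc
    refine ⟨?_, ?_⟩
    · intro o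
      rcases o with _ | s
      · simp only [q, Option.elim]
        have : ∑ s, c s / Fintype.card S ≤ ∑ s : S, 1 / (Fintype.card S : ℝ) := by
          apply Finset.sum_le_sum
          intro s _
          have := (hc s).2
          gcongr
        rw [Finset.sum_const, Finset.card_univ, nsmul_eq_mul] at this
        field_simp at this
        rw [← Finset.sum_div] at *
        linarith
      · simp only [q, Option.elim]
        exact div_nonneg (hc s).1 hn.le
    · rw [Fintype.sum_option]
      simp only [q, Option.elim]
      ring
  obtain ⟨x, hx, hfx⟩ := brouwer_simplex (fun x => q (G (r x))) (fun x _ => hqm _ (hmaps _))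
    ((hq.comp (hG.comp hr)).continuousOn)
  refine ⟨r x, ?_⟩
  funext s
  have h := congrFun hfx (some s)
  simp only [q, Option.elim] at h
  have h2 : (Fintype.card S : ℝ) * x (some s) = G (r x) s := by
    rw [← h]; field_simp
  have : r x s = min 1 (G (r x) s) := by simp only [r]; rw [h2]
  rw [this, min_eq_right (hmaps (r x) s).2]

/-- fixed points in Tychonoff cubes -/
theorem brouwer_tychonoff {J : Type} (G : (J → unitInterval) → (J → unitInterval))
    (hG : Continuous G) : ∃ x, G x = x := by
  classical
  have hclosed : ∀ j, IsClosed {x : J → unitInterval | G x j = x j} := fun j =>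
    isClosed_eq ((continuous_apply j).comp hG) (continuous_apply j)
  have hfin : ∀ u : Finset J, (⋂ j ∈ u, {x : J → unitInterval | G x j = x j}).Nonempty := by
    intro u
    let emb : (u → ℝ) → (J → unitInterval) := fun c j =>
      if h : j ∈ u then Set.projIcc 0 1 zero_le_one (c ⟨j, h⟩) else 0
    have hemb : Continuous emb := by
      apply continuous_pi
      intro j
      by_cases h : j ∈ u
      · simp only [emb, h, dif_pos]
        exact continuous_projIcc.comp (continuous_apply _)
      · simp only [emb, h, dif_neg, not_false_eq_true]
        exact continuous_const
    obtain ⟨c, hc⟩ := brouwer_cube (S := u) (fun c s => ((G (emb c) s.1 : unitInterval) : ℝ))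
      (by
        apply continuous_pi
        intro s
        exact continuous_subtype_val.comp ((continuous_apply _).comp (hG.comp hemb)))
      (fun c s => (G (emb c) s.1).2)
    refine ⟨emb c, ?_⟩
    simp only [Set.mem_iInter]
    intro j hj
    have h := congrFun hc ⟨j, hj⟩
    simp only at h
    show G (emb c) j = emb c j
    have : emb c j = Set.projIcc 0 1 zero_le_one (c ⟨j, hj⟩) := by simp [emb, hj]
    rw [this, ← h, Set.projIcc_val]
  obtain ⟨x, hx⟩ := CompactSpace.iInter_nonempty hclosed hfin
  refine ⟨x, ?_⟩
  funext j
  exact Set.mem_iInter.mp hx j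

/-- set-level absolute extensor property -/
def TExt {E : Type} [TopologicalSpace E] (A : Set E) : Prop :=
  ∀ (Y : Type) [TopologicalSpace Y] [NormalSpace Y] (C : Set Y), IsClosed C →
    ∀ k : Y → E, ContinuousOn k C → Set.MapsTo k C A →
      ∃ k' : Y → E, Continuous k' ∧ (∀ y, k' y ∈ A) ∧ Set.EqOn k' k C

theorem TExt.fixedPoint {E : Type} [TopologicalSpace E] [T2Space E] {A : Set E} (hA : TExt A)
    (hc : IsCompact A) (hne : A.Nonempty) (k : E → E) (hk : ContinuousOn k A) (hkA : Set.MapsTo k A A) :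
    ∃ x ∈ A, k x = x := by
  classical
  have : CompactSpace A := isCompact_iff_compactSpace.mp hc
  let Y := C(A, unitInterval) → unitInterval
  let ι : A → Y := fun a f => f a
  have hι : Continuous ι := continuous_pi fun f => f.continuous
  have hinj : Function.Injective ι := by
    intro a b hab
    by_contra hne
    obtain ⟨f, hf0, hf1, hf⟩ := exists_continuous_zero_one_of_isClosed
      (isClosed_singleton (x := a)) (isClosed_singleton (x := b)) (by simpa using hne)
    have := congrFun hab (⟨fun x => ⟨f x, hf x⟩, by fun_prop⟩ : C(A, unitInterval))
    simp only [ι, ContinuousMap.coe_mk, Subtype.mk.injEq] at this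
    rw [hf0 (Set.mem_singleton a), hf1 (Set.mem_singleton b)] at this
    simp at this
  have hcl : IsClosedEmbedding ι := hι.isClosedEmbedding hinj
  obtain ⟨x0, hx0⟩ := hne
  let inv : Y → E := fun y => if h : ∃ a : A, ι a = y then (h.choose : E) else x0
  have hinv : ∀ a : A, inv (ι a) = a := by
    intro a
    have h : ∃ a' : A, ι a' = ι a := ⟨a, rfl⟩
    simp only [inv, h, dif_pos]
    exact congrArg _ (hinj h.choose_spec)
  have hinvc : ContinuousOn inv (Set.range ι) := by
    have h1 : Continuous (fun y : Set.range ι => ((hcl.isEmbedding.toHomeomorph.symm y : A) : E)) := by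
      fun_prop
    rw [continuousOn_iff_continuous_domRestrict]
    convert h1 using 1
    funext y
    obtain ⟨y, a, rfl⟩ := y
    have : (⟨ι a, a, rfl⟩ : Set.range ι) = hcl.isEmbedding.toHomeomorph a := rfl
    rw [this, Homeomorph.symm_apply_apply]
    exact hinv a
  obtain ⟨r, hr, hrA, hri⟩ := hA Y (Set.range ι) hcl.isClosed_range inv hinvc (by
    rintro _ ⟨a, rfl⟩
    rw [hinv]; exact a.2)
  let kk : A → A := fun a => ⟨k a, hkA a.2⟩
  have hkk : Continuous kk := by
    apply Continuous.subtype_mk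
    exact hk.domRestrict
  let rr : Y → A := fun y => ⟨r y, hrA y⟩
  have hrr : Continuous rr := hr.subtype_mk _
  obtain ⟨y, hy⟩ := brouwer_tychonoff (fun y => ι (kk (rr y))) (hι.comp (hkk.comp hrr))
  refine ⟨r y, hrA y, ?_⟩
  have h1 : r y = kk (rr y) := by
    conv_lhs => rw [← hy]
    rw [hri ⟨_, rfl⟩, hinv]
  exact h1.symm

/-- gluing -/
theorem TExt.glue {E : Type} [TopologicalSpace E] {A B : Set E} (hA : TExt A) (hB : TExt B)
    (hAB : TExt (A ∩ B)) (δ : E → ℝ) (hδ : ContinuousOn δ (A ∪ B))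
    (h3 : ∀ e ∈ A ∪ B, δ e ≤ 0 → e ∈ A) (h4 : ∀ e ∈ A ∪ B, 0 ≤ δ e → e ∈ B) :
    TExt (A ∪ B) := by
  classical
  intro Y _ _ C hC k hk hkm
  obtain ⟨u, hu⟩ := ContinuousMap.exists_restrict_eq hC
    (⟨C.domRestrict (δ ∘ k), (hδ.comp hk hkm).domRestrict⟩ : C(C, ℝ))
  have hu' : ∀ y ∈ C, u y = δ (k y) := fun y hy => by
    have := congrArg (fun f => f ⟨y, hy⟩) hu
    exact this
  have huc : Continuous u := u.continuous
  have cz : IsClosed {y | u y = 0} := isClosed_eq huc continuous_const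
  have cn : IsClosed {y | u y ≤ 0} := isClosed_le huc continuous_const
  have cp : IsClosed {y | 0 ≤ u y} := isClosed_le continuous_const huc
  obtain ⟨k0, hk0, hk0m, hk0e⟩ := hAB Y (C ∩ {y | u y = 0}) (hC.inter cz) k
    (hk.mono Set.inter_subset_left) (by
      rintro y ⟨hy, hy0⟩
      have hy0 : u y = 0 := hy0
      rw [hu' y hy] at hy0
      exact ⟨h3 _ (hkm hy) hy0.le, h4 _ (hkm hy) hy0.ge⟩)
  -- combined data on C ∪ {u = 0}
  let m : Y → E := fun y => if u y = 0 then k0 y else k y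
  have hmk : ∀ y ∈ C, m y = k y := by
    intro y hy
    by_cases h : u y = 0
    · simp only [m, h, if_true]; exact hk0e ⟨hy, h⟩
    · simp [m, h]
  have hm : ContinuousOn m (C ∪ {y | u y = 0}) := by
    apply ContinuousOn.union_of_isClosed _ _ hC cz
    · exact hk.congr hmk
    · exact hk0.continuousOn.congr (fun y hy => by
        have hy : u y = 0 := hy
        simp [m, hy])
  obtain ⟨kA, hkA, hkAm, hkAe⟩ := hA Y ((C ∩ {y | u y ≤ 0}) ∪ {y | u y = 0})
    ((hC.inter cn).union cz) m (hm.mono (by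
      apply Set.union_subset_union_left; exact Set.inter_subset_left)) (by
      intro y hy
      by_cases h : u y = 0
      · simp only [m, h, if_true]; exact (hk0m y).1
      · rcases hy with ⟨hy, hy0⟩ | hy
        · rw [hmk y hy]
          apply h3 _ (hkm hy)
          rw [← hu' y hy]; exact hy0
        · exact absurd hy h)
  obtain ⟨kB, hkB, hkBm, hkBe⟩ := hB Y ((C ∩ {y | 0 ≤ u y}) ∪ {y | u y = 0})
    ((hC.inter cp).union cz) m (hm.mono (by
      apply Set.union_subset_union_left; exact Set.inter_subset_left)) (by
      intro y hy
      by_cases h : u y = 0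
      · simp only [m, h, if_true]; exact (hk0m y).2
      · rcases hy with ⟨hy, hy0⟩ | hy
        · rw [hmk y hy]
          apply h4 _ (hkm hy)
          rw [← hu' y hy]; exact hy0
        · exact absurd hy h)
  refine ⟨fun y => if u y ≤ 0 then kA y else kB y, ?_, ?_, ?_⟩
  · apply Continuous.if_le hkA hkB huc continuous_const
    intro y hy
    rw [hkAe (Or.inr hy), hkBe (Or.inr hy)]
  · intro y
    by_cases h : u y ≤ 0
    · simp only [h, if_true]; exact Or.inl (hkAm y)
    · simp only [h, if_false]; exact Or.inr (hkBm y)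
  · intro y hy
    by_cases h : u y ≤ 0
    · simp only [h, if_true]; rw [hkAe (Or.inl ⟨hy, h⟩), hmk y hy]
    · simp only [h, if_false]; rw [hkBe (Or.inl ⟨hy, (not_le.mp h).le⟩), hmk y hy]

/-- image of a retract of the plane -/
theorem TExt.of_retract {E : Type} [TopologicalSpace E] (A : Set E) (s : ℝ × ℝ → E) (q : E → ℝ × ℝ)
    (ret : ℝ × ℝ → ℝ × ℝ) (hret : Continuous ret) (S : Set (ℝ × ℝ)) (hS : ∀ p, ret p ∈ S)
    (hs : ContinuousOn s S) (hsA : ∀ p ∈ S, s p ∈ A) (hq : ContinuousOn q A)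
    (hsq : ∀ e ∈ A, s (ret (q e)) = e) : TExt A := by
  intro Y _ _ C hC k hk hkm
  have hqk : ContinuousOn (q ∘ k) C := hq.comp hk hkm
  obtain ⟨u, hu⟩ := ContinuousMap.exists_restrict_eq hC
    (⟨C.domRestrict (fun y => (q (k y)).1), (continuous_fst.comp_continuousOn hqk).domRestrict⟩ : C(C, ℝ))
  obtain ⟨v, hv⟩ := ContinuousMap.exists_restrict_eq hC
    (⟨C.domRestrict (fun y => (q (k y)).2), (continuous_snd.comp_continuousOn hqk).domRestrict⟩ : C(C, ℝ))
  refine ⟨fun y => s (ret (u y, v y)), ?_, fun y => hsA _ (hS _), ?_⟩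
  · exact hs.comp_continuous (hret.comp (by fun_prop)) (fun y => hS _)
  · intro y hy
    have e1 : u y = (q (k y)).1 := by
      have := congrArg (fun f => f ⟨y, hy⟩) hu
      exact this
    have e2 : v y = (q (k y)).2 := by
      have := congrArg (fun f => f ⟨y, hy⟩) hv
      exact this
    show s (ret (u y, v y)) = k y
    rw [e1, e2]
    exact hsq _ (hkm hy)

/-- letter -/
def flet {n : ℕ} (s : Fin n × Bool) : FreeGroup (Fin n) := FreeGroup.mk [s]

/-- opposite letter -/
def obar {n : ℕ} (s : Fin n × Bool) : Fin n × Bool := (s.1, !s.2)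

/-- first letter -/
def fl {n : ℕ} (v : FreeGroup (Fin n)) : Option (Fin n × Bool) := v.toWord.head?

theorem obar_obar {n : ℕ} (s : Fin n × Bool) : obar (obar s) = s := by simp [obar]

theorem obar_ne {n : ℕ} (s : Fin n × Bool) : obar s ≠ s := by
  intro h
  have := congrArg Prod.snd h
  simp [obar] at this

theorem flet_obar {n : ℕ} (s : Fin n × Bool) : flet (obar s) = (flet s)⁻¹ := by
  simp [flet, obar, FreeGroup.inv_mk, FreeGroup.invRev]

theorem flet_true {n : ℕ} (i : Fin n) : flet (i, true) = FreeGroup.of i := rfl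

theorem flet_mul_toWord {n : ℕ} (s : Fin n × Bool) (v : FreeGroup (Fin n)) :
    (flet s * v).toWord = if fl v = some (obar s) then v.toWord.tail else s :: v.toWord := by
  have h : flet s * v = FreeGroup.mk (s :: v.toWord) := by
    conv_lhs => rw [← FreeGroup.mk_toWord (x := v)]
    simp [flet, FreeGroup.mul_mk]
  rw [h, FreeGroup.toWord_mk, FreeGroup.reduce.cons, FreeGroup.reduce_toWord]
  unfold fl
  cases hv : v.toWord with
  | nil => simp
  | cons a L =>
    simp only [List.head?_cons, Option.some.injEq, List.tail_cons]
    have : (s.1 = a.1 ∧ s.2 = !a.2) ↔ a = obar s := by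
      obtain ⟨s1, s2⟩ := s
      obtain ⟨a1, a2⟩ := a
      simp only [obar, Prod.mk.injEq]
      constructor
      · rintro ⟨h1, h2⟩; exact ⟨h1.symm, by rw [h2]; simp⟩
      · rintro ⟨h1, h2⟩; exact ⟨h1.symm, by rw [h2]; simp⟩
    by_cases h : a = obar s
    · rw [if_pos (this.mpr h), if_pos h]
    · rw [if_neg (fun hh => h (this.mp hh)), if_neg h]

theorem fl_eq_none {n : ℕ} (v : FreeGroup (Fin n)) : fl v = none ↔ v = 1 := by
  unfold fl
  rw [List.head?_eq_none_iff, FreeGroup.toWord_eq_nil_iff]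

theorem fl_one {n : ℕ} : fl (1 : FreeGroup (Fin n)) = none := (fl_eq_none 1).mpr rfl

theorem norm_flet_mul {n : ℕ} (s : Fin n × Bool) (v : FreeGroup (Fin n)) :
    (fl v = some (obar s) → (flet s * v).norm + 1 = v.norm) ∧
    (fl v ≠ some (obar s) → (flet s * v).norm = v.norm + 1 ∧ fl (flet s * v) = some s) := by
  constructor
  · intro h
    unfold FreeGroup.norm
    rw [flet_mul_toWord, if_pos h]
    unfold fl at h
    cases hv : v.toWord with
    | nil => rw [hv] at h; simp at h
    | cons a L => simp
  · intro h
    unfold FreeGroup.norm fl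
    rw [flet_mul_toWord, if_neg h]
    simp

theorem exists_flet_mul {n : ℕ} (v : FreeGroup (Fin n)) (hv : v ≠ 1) :
    ∃ s u, v = flet s * u ∧ v.norm = u.norm + 1 ∧ fl v = some s ∧ fl u ≠ some (obar s) := by
  cases h : fl v with
  | none => exact absurd ((fl_eq_none v).mp h) hv
  | some s =>
    have h1 := (norm_flet_mul (obar s) v).1 (by rw [obar_obar]; exact h)
    refine ⟨s, flet (obar s) * v, ?_, h1.symm, rfl, ?_⟩
    · rw [flet_obar]; group
    · intro h2
      have h3 := (norm_flet_mul s (flet (obar s) * v)).1 h2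
      have : flet s * (flet (obar s) * v) = v := by rw [flet_obar]; group
      rw [this] at h3
      omega

theorem fl_flet {n : ℕ} (s : Fin n × Bool) : fl (flet s) = some s := by
  simp [fl, flet, FreeGroup.toWord_mk, FreeGroup.reduce.cons]

/-- `v` starts with `obar s` iff `s v` does not start with `s`. -/
theorem fl_iff {n : ℕ} (s : Fin n × Bool) (v : FreeGroup (Fin n)) :
    fl v = some (obar s) ↔ fl (flet s * v) ≠ some s := by
  constructor
  · intro h h2
    have h3 := (norm_flet_mul s v).1 h
    have h4 := (norm_flet_mul (obar s) (flet s * v)).1 (by rw [obar_obar]; exact h2)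
    have : flet (obar s) * (flet s * v) = v := by rw [flet_obar]; group
    rw [this] at h4
    omega
  · intro h
    by_contra h2
    exact h ((norm_flet_mul s v).2 h2).2

/-- right multiplication -/
theorem norm_mul_flet {n : ℕ} (w : FreeGroup (Fin n)) (s : Fin n × Bool) :
    (fl w⁻¹ = some s → (w * flet s).norm + 1 = w.norm) ∧
    (fl w⁻¹ ≠ some s → (w * flet s).norm = w.norm + 1 ∧ fl (w * flet s)⁻¹ = some (obar s)) := by
  have e : (w * flet s)⁻¹ = flet (obar s) * w⁻¹ := by rw [flet_obar]; group
  have h := norm_flet_mul (obar s) w⁻¹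
  rw [obar_obar, ← e, FreeGroup.norm_inv_eq, FreeGroup.norm_inv_eq] at h
  exact h

theorem fl_mul_right {n : ℕ} (s : Fin n × Bool) : ∀ (k : ℕ) (v : FreeGroup (Fin n)), v.norm ≤ k →
    v ≠ 1 → v * flet s ≠ 1 → fl (v * flet s) = fl v := by
  intro k
  induction k with
  | zero =>
    intro v hk hv
    exact absurd (FreeGroup.norm_eq_zero.mp (Nat.le_zero.mp hk)) hv
  | succ k ih =>
    intro v hk hv hvs
    obtain ⟨t, u, hu, hn, hf, hfu⟩ := exists_flet_mul v hv
    by_cases h1 : fl (u * flet s) = some (obar t)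
    · exfalso
      by_cases hu1 : u = 1
      · subst hu1
        rw [one_mul, fl_flet] at h1
        have h1 := Option.some.inj h1
        apply hvs
        rw [hu, h1, flet_obar]
        group
      · have h2 : u * flet s ≠ 1 := by
          intro h
          rw [h, fl_one] at h1
          cases h1
        rw [ih u (by omega) hu1 h2] at h1
        exact hfu h1
    · have := ((norm_flet_mul t (u * flet s)).2 h1).2
      rw [hf, ← this, hu]
      congr 1
      group

theorem exists_mul_flet {n : ℕ} (w : FreeGroup (Fin n)) (hw : w ≠ 1) :
    ∃ w' t, w = w' * flet t ∧ w.norm = w'.norm + 1 ∧ fl w⁻¹ = some (obar t) := by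
  obtain ⟨s, u, hu, hn, hf, _⟩ := exists_flet_mul w⁻¹ (by simpa using hw)
  refine ⟨u⁻¹, obar s, ?_, ?_, ?_⟩
  · rw [flet_obar, ← mul_inv_rev, ← hu, inv_inv]
  · rw [FreeGroup.norm_inv_eq] at hn ⊢; exact hn
  · rw [obar_obar]; exact hf

/-- indicator of words starting with `b_i` -/
def aInd {n : ℕ} (i : Fin n) (v : FreeGroup (Fin n)) : ℤ := if fl v = some (i, true) then 1 else 0

/-- exponent sum -/
def expo {n : ℕ} (i : Fin n) : FreeGroup (Fin n) →* Multiplicative ℤ :=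
  FreeGroup.lift fun j => Multiplicative.ofAdd (if j = i then 1 else 0)

/-- the counting function -/
def TauP {n : ℕ} (i : Fin n) (y : FreeGroup (Fin n)) (c : ℤ) : Prop :=
  (Function.support fun v => aInd i (v * y) - aInd i v).Finite ∧
    ∑ᶠ v, (aInd i (v * y) - aInd i v) = c

theorem TauP.mul {n : ℕ} {i : Fin n} {y z : FreeGroup (Fin n)} {c d : ℤ} (hy : TauP i y c)
    (hz : TauP i z d) : TauP i (y * z) (c + d) := by
  have hsh : (Function.support fun v => aInd i (v * y * z) - aInd i (v * y)).Finite := by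
    have := hz.1.preimage (Set.injOn_of_injective (mul_left_injective y))
    exact this
  have hshs : ∑ᶠ v, (aInd i (v * y * z) - aInd i (v * y)) = d := by
    rw [← hz.2]
    exact finsum_comp_equiv (Equiv.mulRight y) (f := fun v => aInd i (v * z) - aInd i v)
  have hfun : (fun v => aInd i (v * (y * z)) - aInd i v) =
      fun v => (aInd i (v * y) - aInd i v) + (aInd i (v * y * z) - aInd i (v * y)) := by
    funext v
    rw [← mul_assoc]; ring
  refine ⟨?_, ?_⟩
  · rw [hfun]
    exact (hy.1.union hsh).subset (Function.support_add _ _)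
  · rw [hfun, finsum_add_distrib hy.1 hsh, hy.2, hshs]

theorem TauP.inv {n : ℕ} {i : Fin n} {y : FreeGroup (Fin n)} {c : ℤ} (hy : TauP i y c) :
    TauP i y⁻¹ (-c) := by
  have hfun : (fun v => aInd i (v * y⁻¹) - aInd i v) =
      fun v => -(fun u => (aInd i (u * y) - aInd i u)) (v * y⁻¹) := by
    funext v
    simp
  refine ⟨?_, ?_⟩
  · rw [hfun, Function.support_fun_neg]
    exact hy.1.preimage (Set.injOn_of_injective (mul_left_injective y⁻¹))
  · rw [hfun, finsum_neg_distrib, ← hy.2]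
    congr 1
    exact finsum_comp_equiv (Equiv.mulRight y⁻¹) (f := fun v => aInd i (v * y) - aInd i v)

theorem tauP_of {n : ℕ} (i j : Fin n) : TauP i (FreeGroup.of j) (if j = i then 1 else 0) := by
  have hz : ∀ v : FreeGroup (Fin n), v ≠ 1 →
      aInd i (v * FreeGroup.of j) - aInd i v = 0 := by
    intro v hv
    rw [← flet_true]
    by_cases h : v * flet (j, true) = 1
    · have hv2 : v = flet (obar (j, true)) := by
        rw [flet_obar]; exact eq_inv_of_mul_eq_one_left h
      unfold aInd
      rw [h, fl_one, hv2, fl_flet]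
      simp [obar]
    · unfold aInd
      rw [fl_mul_right (j, true) v.norm v le_rfl hv h]
      simp
  have hs : (Function.support fun v => aInd i (v * FreeGroup.of j) - aInd i v) ⊆ {1} := by
    intro v hv
    by_contra h
    exact hv (hz v h)
  refine ⟨(Set.finite_singleton _).subset hs, ?_⟩
  rw [finsum_eq_single _ 1 (fun v hv => hz v hv)]
  unfold aInd
  rw [one_mul, fl_one, ← flet_true, fl_flet]
  simp

theorem tauP_expo {n : ℕ} (i : Fin n) (y : FreeGroup (Fin n)) :
    TauP i y (Multiplicative.toAdd (expo i y)) := by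
  induction y using FreeGroup.induction_on with
  | C1 =>
    rw [map_one]
    refine ⟨?_, ?_⟩ <;> simp
  | of j => 
    have := tauP_of i j
    simpa [expo] using this
  | inv_of j h =>
    have := h.inv
    rw [map_inv, toAdd_inv]
    exact this
  | mul x y hx hy =>
    rw [map_mul, toAdd_mul]
    exact hx.mul hy

/-- moving along a half-edge of the twisted Cayley graph -/
def mv {n : ℕ} (φ : FreeGroup (Fin n) →* FreeGroup (Fin n)) (x : FreeGroup (Fin n))
    (s : Fin n × Bool) : FreeGroup (Fin n) := (flet s)⁻¹ * x * φ (flet s)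

/-- orbit map -/
def vt {n : ℕ} (φ : FreeGroup (Fin n) →* FreeGroup (Fin n)) (a w : FreeGroup (Fin n)) :
    FreeGroup (Fin n) := w⁻¹ * a * φ w

/-- edge of a half-edge -/
def posE {n : ℕ} (φ : FreeGroup (Fin n) →* FreeGroup (Fin n)) (x : FreeGroup (Fin n))
    (s : Fin n × Bool) : FreeGroup (Fin n) × Fin n := if s.2 then (x, s.1) else (mv φ x s, s.1)

theorem vt_mul {n : ℕ} (φ : FreeGroup (Fin n) →* FreeGroup (Fin n)) (a w : FreeGroup (Fin n))
    (s : Fin n × Bool) : vt φ a (w * flet s) = mv φ (vt φ a w) s := by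
  simp only [vt, mv, map_mul]; group

theorem mv_mv {n : ℕ} (φ : FreeGroup (Fin n) →* FreeGroup (Fin n)) (x : FreeGroup (Fin n))
    (s : Fin n × Bool) : mv φ (mv φ x s) (obar s) = x := by
  simp only [mv, flet_obar, map_inv]; group

theorem mv_mv' {n : ℕ} (φ : FreeGroup (Fin n) →* FreeGroup (Fin n)) (x : FreeGroup (Fin n))
    (s : Fin n × Bool) : mv φ (mv φ x (obar s)) s = x := by
  have := mv_mv φ x (obar s)
  rwa [obar_obar] at this

theorem posE_eq {n : ℕ} (φ : FreeGroup (Fin n) →* FreeGroup (Fin n)) {x y : FreeGroup (Fin n)}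
    {s t : Fin n × Bool} (h : posE φ x s = posE φ y t) :
    (y = x ∧ t = s) ∨ (y = mv φ x s ∧ t = obar s) := by
  obtain ⟨i, b⟩ := s
  obtain ⟨j, c⟩ := t
  cases b <;> cases c <;> simp only [posE, if_true, if_false, Prod.mk.injEq, Bool.false_eq_true] at h
  · obtain ⟨h1, rfl⟩ := h
    left
    have := congrArg (fun z => mv φ z (i, true)) h1
    have e : ((i, false) : Fin n × Bool) = obar (i, true) := rfl
    rw [e, mv_mv', mv_mv'] at this
    exact ⟨this.symm, rfl⟩
  · obtain ⟨h1, rfl⟩ := h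
    exact Or.inr ⟨h1.symm, rfl⟩
  · obtain ⟨h1, rfl⟩ := h
    right
    refine ⟨?_, rfl⟩
    rw [h1]
    have e : ((i, false) : Fin n × Bool) = obar (i, true) := rfl
    rw [e, mv_mv']
  · obtain ⟨h1, rfl⟩ := h
    exact Or.inl ⟨h1.symm, rfl⟩

/-- exceptional weight of an edge -/
def cw {n : ℕ} (φ : FreeGroup (Fin n) →* FreeGroup (Fin n)) (x : FreeGroup (Fin n)) (i : Fin n) : ℤ :=
  aInd i x - aInd i (x * φ (FreeGroup.of i))

theorem ball_finite {n : ℕ} (N : ℕ) : {w : FreeGroup (Fin n) | w.norm ≤ N}.Finite := by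
  have h : {l : List (Fin n × Bool) | l.length ≤ N}.Finite := List.finite_length_le _ _
  exact h.preimage (Set.injOn_of_injective FreeGroup.toWord_injective)

open Classical in
theorem gt_exists_orbit {n : ℕ} (φ : FreeGroup (Fin n) →* FreeGroup (Fin n))
    (hexp : ∀ i, expo i (φ (FreeGroup.of i)) = 1) :
    ∃ (a : FreeGroup (Fin n)) (S : Finset (FreeGroup (Fin n))),
      (∀ x ∈ S, ∃ w, x = vt φ a w) ∧
      (∀ w i, cw φ (vt φ a w) i ≠ 0 → vt φ a w ∈ S) ∧
      (∀ w, vt φ a w = 1 → vt φ a w ∈ S) ∧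
      1 ≤ (if (1 : FreeGroup (Fin n)) ∈ S then (1:ℤ) else 0) + ∑ x ∈ S, ∑ i, cw φ x i := by
  have hfin : ∀ i, (Function.support fun x => cw φ x i).Finite := by
    intro i
    have h := (tauP_expo i (φ (FreeGroup.of i))).1
    have e : (fun x => cw φ x i) = fun x => -(aInd i (x * φ (FreeGroup.of i)) - aInd i x) := by
      funext x; simp [cw]
    rw [e, Function.support_fun_neg]
    exact h
  have hsum : ∀ i, ∑ᶠ x, cw φ x i = 0 := by
    intro i
    have h := (tauP_expo i (φ (FreeGroup.of i))).2
    have e : (fun x => cw φ x i) = fun x => -(aInd i (x * φ (FreeGroup.of i)) - aInd i x) := by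
      funext x; simp [cw]
    rw [e, finsum_neg_distrib, h, hexp]
    simp
  let S0 : Finset (FreeGroup (Fin n)) := insert 1 (Finset.univ.biUnion fun i => (hfin i).toFinset)
  have hS0 : ∀ x i, cw φ x i ≠ 0 → x ∈ S0 := by
    intro x i hx
    simp only [S0, Finset.mem_insert, Finset.mem_biUnion]
    exact Or.inr ⟨i, Finset.mem_univ _, by simpa using hx⟩
  have hsum0 : ∀ i, ∑ x ∈ S0, cw φ x i = 0 := by
    intro i
    rw [← hsum i]
    symm
    apply finsum_eq_sum_of_support_subset
    intro x hx
    exact hS0 x i hx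
  let wt : FreeGroup (Fin n) → ℤ := fun x => (if x = 1 then 1 else 0) + ∑ i, cw φ x i
  have htot : ∑ x ∈ S0, wt x = 1 := by
    simp only [wt, Finset.sum_add_distrib]
    rw [Finset.sum_comm, Finset.sum_congr rfl (fun i _ => hsum0 i)]
    simp [S0]
  let st : Setoid (FreeGroup (Fin n)) :=
    { r := fun x y => ∃ w, y = vt φ x w
      iseqv := ⟨fun x => ⟨1, by simp [vt]⟩,
        fun {x y} ⟨w, h⟩ => ⟨w⁻¹, by rw [h]; simp only [vt, map_inv]; group⟩,
        fun {x y z} ⟨w, h⟩ ⟨u, h2⟩ => ⟨w * u, by rw [h2, h]; simp only [vt, map_mul]; group⟩⟩ }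
  have hex : ∃ q ∈ S0.image (Quotient.mk st), 0 < ∑ x ∈ S0 with Quotient.mk st x = q, wt x := by
    by_contra hcon
    push Not at hcon
    have h1 := Finset.sum_fiberwise_of_maps_to (s := S0) (t := S0.image (Quotient.mk st))
      (g := Quotient.mk st) (fun x hx => Finset.mem_image_of_mem _ hx) wt
    have h2 := Finset.sum_nonpos hcon
    rw [h1, htot] at h2
    norm_num at h2
  obtain ⟨q, hq, hpos⟩ := hex
  obtain ⟨a, ha, rfl⟩ := Finset.mem_image.mp hq
  refine ⟨a, S0.filter (fun x => Quotient.mk st x = Quotient.mk st a), ?_, ?_, ?_, ?_⟩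
  · intro x hx
    have h := (Finset.mem_filter.mp hx).2
    obtain ⟨w, hw⟩ := Quotient.exact h.symm
    exact ⟨w, hw⟩
  · intro w i h
    refine Finset.mem_filter.mpr ⟨hS0 _ i h, ?_⟩
    exact (Quotient.sound (⟨w, rfl⟩ : st.r a (vt φ a w))).symm
  · intro w h
    refine Finset.mem_filter.mpr ⟨by rw [h]; simp [S0], ?_⟩
    exact (Quotient.sound (⟨w, rfl⟩ : st.r a (vt φ a w))).symm
  · have h := hpos
    simp only [wt, Finset.sum_add_distrib] at h
    rw [Finset.sum_ite_eq'] at h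
    omega

open Classical in
theorem gt_ball {n : ℕ} (φ : FreeGroup (Fin n) →* FreeGroup (Fin n)) (a : FreeGroup (Fin n))
    (S : Finset (FreeGroup (Fin n))) (N : ℕ)
    (hS : ∀ x ∈ S, ∃ w, x = vt φ a w ∧ w.norm + 1 ≤ N)
    (hSc : ∀ w i, cw φ (vt φ a w) i ≠ 0 → vt φ a w ∈ S)
    (hS1 : ∀ w, vt φ a w = 1 → vt φ a w ∈ S)
    (hI : 1 ≤ (if (1 : FreeGroup (Fin n)) ∈ S then (1:ℤ) else 0) + ∑ x ∈ S, ∑ i, cw φ x i) :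
    (∀ w w', w.norm ≤ N → w'.norm ≤ N → vt φ a w = vt φ a w' → w = w') ∧
    (∀ w s, w.norm ≤ N → fl (vt φ a w) = some s →
      ∃ w' t, w'.norm ≤ N ∧ (w' * flet t).norm ≤ N ∧
        posE φ (vt φ a w) s = posE φ (vt φ a w') t) := by
  let B : Finset (FreeGroup (Fin n)) := (ball_finite N).toFinset
  have hB : ∀ w, w ∈ B ↔ w.norm ≤ N := fun w => by simp [B]
  let V : Finset (FreeGroup (Fin n)) := B.image (vt φ a)
  have hV : ∀ w : FreeGroup (Fin n), w.norm ≤ N → vt φ a w ∈ V := fun w hw =>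
    Finset.mem_image_of_mem _ ((hB w).mpr hw)
  have hV' : ∀ x ∈ V, ∃ w : FreeGroup (Fin n), w.norm ≤ N ∧ vt φ a w = x := by
    intro x hx
    obtain ⟨w, hw, rfl⟩ := Finset.mem_image.mp hx
    exact ⟨w, (hB w).mp hw, rfl⟩
  let E : Finset (FreeGroup (Fin n) × Fin n) :=
    ((B ×ˢ Finset.univ).filter (fun p => (p.1 * flet (p.2, true)).norm ≤ N)).image
      (fun p => (vt φ a p.1, p.2))
  have hE : ∀ (w : FreeGroup (Fin n)) s, w.norm ≤ N → (w * flet s).norm ≤ N →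
      posE φ (vt φ a w) s ∈ E := by
    intro w s h1 h2
    obtain ⟨i, b⟩ := s
    refine Finset.mem_image.mpr ?_
    cases b with
    | true =>
      refine ⟨(w, i), Finset.mem_filter.mpr ⟨?_, h2⟩, by simp [posE]⟩
      exact Finset.mem_product.mpr ⟨(hB w).mpr h1, Finset.mem_univ _⟩
    | false =>
      refine ⟨(w * flet (i, false), i), Finset.mem_filter.mpr ⟨?_, ?_⟩, ?_⟩
      · exact Finset.mem_product.mpr ⟨(hB _).mpr h2, Finset.mem_univ _⟩
      · have e : w * flet (i, false) * flet (i, true) = w := by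
          have : flet ((i, false) : Fin n × Bool) = (flet (i, true))⁻¹ := flet_obar (i, true)
          rw [this]; group
        simp only [e]; exact h1
      · simp [posE, vt_mul]
  have hE' : ∀ e ∈ E, ∃ w i, w.norm ≤ N ∧ (w * flet (i, true)).norm ≤ N ∧
      e = (vt φ a w, i) := by
    intro e he
    obtain ⟨⟨w, i⟩, h, rfl⟩ := Finset.mem_image.mp he
    obtain ⟨h1, h2⟩ := Finset.mem_filter.mp h
    exact ⟨w, i, (hB w).mp (Finset.mem_product.mp h1).1, h2, rfl⟩
  -- preferences
  let pe : FreeGroup (Fin n) → Option (FreeGroup (Fin n) × Fin n) := fun x => (fl x).map (posE φ x)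
  have hpe : ∀ e ∈ E, (((V.filter fun x => ∃ e ∈ E, pe x = some e).filter
      fun x => pe x = some e).card : ℤ) = 1 + cw φ e.1 e.2 := by
    intro e he
    obtain ⟨w, i, h1, h2, rfl⟩ := hE' e he
    simp only
    set y := vt φ a w with hy
    have hyV : y ∈ V := hV w h1
    have hmV : mv φ y (i, true) ∈ V := by rw [hy, ← vt_mul]; exact hV _ h2
    have hset : ((V.filter fun x => ∃ e ∈ E, pe x = some e).filter
      fun x => pe x = some (y, i)) = (({y} : Finset _).filter fun x => fl x = some (i, true)) ∪
        (({mv φ y (i, true)} : Finset _).filter fun x => fl x = some (i, false)) := by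
      ext x
      simp only [Finset.mem_filter, Finset.mem_union, Finset.mem_singleton, pe]
      have hp : posE φ y (i, true) = (y, i) := by simp [posE]
      constructor
      · rintro ⟨-, h⟩
        obtain ⟨s, hs, hs2⟩ := Option.map_eq_some_iff.mp h
        rw [← hp] at hs2
        rcases posE_eq φ hs2.symm with ⟨h3, h4⟩ | ⟨h3, h4⟩
        · left; exact ⟨h3, by rw [hs, h4]⟩
        · right; exact ⟨h3, by rw [hs, h4]; rfl⟩
      · rintro (⟨rfl, h⟩ | ⟨rfl, h⟩)
        · have : (fl y).map (posE φ y) = some (y, i) := by rw [h]; simp [posE]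
          exact ⟨⟨hyV, _, he, this⟩, this⟩
        · have : (fl (mv φ y (i, true))).map (posE φ (mv φ y (i, true))) = some (y, i) := by
            rw [h]
            have e2 := mv_mv φ y (i, true)
            have e3 : obar ((i, true) : Fin n × Bool) = (i, false) := rfl
            rw [e3] at e2
            simp [posE, e2]
          exact ⟨⟨hmV, _, he, this⟩, this⟩
    rw [hset, Finset.card_union_of_disjoint]
    · rw [Finset.filter_singleton, Finset.filter_singleton]
      have hfi := fl_iff (i, true) (mv φ y (i, true))
      have e4 : flet (i, true) * mv φ y (i, true) = y * φ (FreeGroup.of i) := by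
        simp only [mv, flet_true]; group
      have e3 : obar ((i, true) : Fin n × Bool) = (i, false) := rfl
      rw [e4, e3] at hfi
      simp only [cw, aInd, hfi]
      by_cases q1 : fl y = some (i, true) <;> by_cases q2 : fl (y * φ (FreeGroup.of i)) = some (i, true)
        <;> simp [q1, q2]
    · rw [Finset.disjoint_left]
      intro x hx hx2
      have h3 := (Finset.mem_filter.mp hx).2
      have h4 := (Finset.mem_filter.mp hx2).2
      rw [h3] at h4
      simp at h4
  have hcount : ((V.filter fun x => ∃ e ∈ E, pe x = some e).card : ℤ) = ∑ e ∈ E, (1 + cw φ e.1 e.2) := by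
    rw [← Finset.sum_congr rfl hpe, ← Nat.cast_sum]
    congr 1
    have hh : ∀ x ∈ (V.filter fun x => ∃ e ∈ E, pe x = some e), pe x ∈ E.image some := by
      intro x hx
      obtain ⟨e, he, hxe⟩ := (Finset.mem_filter.mp hx).2
      exact Finset.mem_image.mpr ⟨e, he, hxe.symm⟩
    rw [Finset.card_eq_sum_card_fiberwise hh, Finset.sum_image (fun _ _ _ _ h => Option.some.inj h)]
  -- the sum of c over E
  have hSV : ∀ x ∈ S, x ∈ V := by
    intro x hx
    obtain ⟨w, rfl, hw⟩ := hS x hx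
    exact hV w (by omega)
  have hSE : ∀ x ∈ S, ∀ i, (x, i) ∈ E := by
    intro x hx i
    obtain ⟨w, rfl, hw⟩ := hS x hx
    have h := hE w (i, true) (by omega) (by
      have h1 := norm_mul_flet w (i, true)
      by_cases h : fl w⁻¹ = some (i, true)
      · have := h1.1 h; omega
      · have := (h1.2 h).1; omega)
    simpa [posE] using h
  have hcsum : ∑ e ∈ E, cw φ e.1 e.2 = ∑ x ∈ S, ∑ i, cw φ x i := by
    rw [← Finset.sum_product']
    symm
    apply Finset.sum_subset
    · rintro ⟨x, i⟩ hx
      exact hSE x (Finset.mem_product.mp hx).1 i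
    · rintro e he hne
      obtain ⟨w, i, h1, h2, rfl⟩ := hE' e he
      by_contra hcc
      exact hne (Finset.mem_product.mpr ⟨hSc w i hcc, Finset.mem_univ _⟩)
  -- V count
  let Lv : Finset (FreeGroup (Fin n)) := V.filter fun x => x ≠ 1 ∧ ¬ ∃ e ∈ E, pe x = some e
  have hVc : (V.card : ℤ) = (if (1 : FreeGroup (Fin n)) ∈ S then (1:ℤ) else 0) +
      (V.filter fun x => ∃ e ∈ E, pe x = some e).card + Lv.card := by
    have h1 := Finset.card_filter_add_card_filter_not (s := V) (fun x => ∃ e ∈ E, pe x = some e)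
    have h2 : (V.filter fun x => ¬ ∃ e ∈ E, pe x = some e) = (V.filter fun x => x = 1) ∪ Lv := by
      ext x
      simp only [Lv, Finset.mem_filter, Finset.mem_union]
      constructor
      · rintro ⟨h3, h4⟩
        by_cases hx : x = 1
        · exact Or.inl ⟨h3, hx⟩
        · exact Or.inr ⟨h3, hx, h4⟩
      · rintro (⟨h3, rfl⟩ | ⟨h3, -, h4⟩)
        · exact ⟨h3, by rintro ⟨e, -, he⟩; simp [pe, fl_one] at he⟩
        · exact ⟨h3, h4⟩
    rw [h2, Finset.card_union_of_disjoint (by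
      rw [Finset.disjoint_left]
      intro x hx hx2
      exact (Finset.mem_filter.mp hx2).2.1 (Finset.mem_filter.mp hx).2)] at h1
    have h5 : (V.filter fun x => x = 1).card = if (1 : FreeGroup (Fin n)) ∈ S then 1 else 0 := by
      rw [Finset.filter_eq']
      have : (1 : FreeGroup (Fin n)) ∈ V ↔ (1 : FreeGroup (Fin n)) ∈ S := by
        constructor
        · intro h
          obtain ⟨w, _, hw⟩ := hV' _ h
          rw [← hw]; exact hS1 w hw
        · exact hSV 1
      by_cases h : (1 : FreeGroup (Fin n)) ∈ S
      · simp [h, this.mpr h]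
      · simp [h, mt this.mp h]
    rw [h5] at h1
    rw [← h1]
    push_cast
    ring
  have hVE : (E.card : ℤ) + 1 + Lv.card ≤ V.card := by
    rw [hVc, hcount, Finset.sum_add_distrib, hcsum]
    simp only [Finset.sum_const, nsmul_eq_mul, mul_one]
    linarith
  -- parents
  have hrep : ∀ x, ∃ r : FreeGroup (Fin n), x ∈ V → vt φ a r = x ∧ r.norm ≤ N ∧
      ∀ w, vt φ a w = x → r.norm ≤ w.norm := by
    intro x
    by_cases hx : x ∈ V
    · have hne : {w : FreeGroup (Fin n) | vt φ a w = x}.Nonempty := by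
        obtain ⟨w, -, hw⟩ := hV' x hx
        exact ⟨w, hw⟩
      obtain ⟨r, hr, hmin⟩ := WellFounded.has_min (InvImage.wf FreeGroup.norm wellFounded_lt)
        _ hne
      refine ⟨r, fun _ => ⟨hr, ?_, fun w hw => not_lt.mp (hmin w hw)⟩⟩
      obtain ⟨w, h1, hw⟩ := hV' x hx
      exact (not_lt.mp (hmin w hw)).trans h1
    · exact ⟨1, fun h => absurd h hx⟩
  choose ρ hρ using hrep
  have h1V : vt φ a 1 = a := by simp [vt]
  have haV : a ∈ V := by have := hV 1 (by simp); rwa [h1V] at this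
  let par : FreeGroup (Fin n) → Option (FreeGroup (Fin n) × Fin n) :=
    fun x => (fl (ρ x)⁻¹).map (posE φ x)
  have hpar : ∀ x ∈ V, x ≠ a → ∃ s, fl (ρ x)⁻¹ = some s ∧ par x = some (posE φ x s) ∧
      (ρ x * flet s).norm + 1 = (ρ x).norm ∧ vt φ a (ρ x * flet s) = mv φ x s := by
    intro x hx hxa
    cases h : fl (ρ x)⁻¹ with
    | none =>
      exfalso
      have h1 := inv_eq_one.mp ((fl_eq_none _).mp h)
      have := (hρ x hx).1
      rw [h1, h1V] at this
      exact hxa this.symm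
    | some s =>
      refine ⟨s, rfl, by simp [par, h], (norm_mul_flet _ _).1 h, ?_⟩
      rw [vt_mul, (hρ x hx).1]
  have hparinj : Set.InjOn par (V.erase a) := by
    intro x hx y hy hxy
    obtain ⟨hxa, hxV⟩ := Finset.mem_erase.mp hx
    obtain ⟨hya, hyV⟩ := Finset.mem_erase.mp hy
    obtain ⟨s, hs, hps, hn, hm⟩ := hpar x hxV hxa
    obtain ⟨t, ht, hpt, hnt, hmt⟩ := hpar y hyV hya
    rw [hps, hpt] at hxy
    rcases posE_eq φ (Option.some.inj hxy) with ⟨h, -⟩ | ⟨h1, h2⟩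
    · exact h.symm
    · exfalso
      have q1 := (hρ y hyV).2.2 _ (hm.trans h1.symm)
      have q2 := (hρ x hxV).2.2 _ (hmt.trans (by rw [h1, h2, mv_mv]))
      omega
  have hsub : (V.erase a).image par ⊆ E.image some := by
    intro e he
    obtain ⟨x, hx, rfl⟩ := Finset.mem_image.mp he
    obtain ⟨hxa, hxV⟩ := Finset.mem_erase.mp hx
    obtain ⟨s, hs, hps, hn, hm⟩ := hpar x hxV hxa
    refine Finset.mem_image.mpr ⟨posE φ x s, ?_, hps.symm⟩
    have := (hρ x hxV)
    have h := hE (ρ x) s this.2.1 (by omega)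
    rwa [this.1] at h
  have hcardE : (E.image some).card = E.card :=
    Finset.card_image_of_injective _ (Option.some_injective _)
  have hcardP : ((V.erase a).image par).card + 1 = V.card := by
    rw [Finset.card_image_of_injOn hparinj]
    exact Finset.card_erase_add_one haV
  have hle := Finset.card_le_card hsub
  have hL0 : Lv = ∅ := by
    rw [← Finset.card_eq_zero]; omega
  have himg : (V.erase a).image par = E.image some := Finset.eq_of_subset_of_card_le hsub (by omega)
  have hinj : ∀ k, ∀ w : FreeGroup (Fin n), w.norm = k → k ≤ N → ρ (vt φ a w) = w := by
    intro k
    induction k using Nat.strong_induction_on with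
    | _ k ih =>
    intro w hw hk
    by_cases hw1 : w = 1
    · subst hw1
      have := (hρ _ (hV 1 (by simp))).2.2 1 rfl
      simp only [FreeGroup.norm_one, Nat.le_zero] at this
      exact FreeGroup.norm_eq_zero.mp this
    · obtain ⟨w', t, hwt, hn, hft⟩ := exists_mul_flet w hw1
      have ihw := ih w'.norm (by omega) w' rfl (by omega)
      have he := hE w' t (by omega) (by rw [← hwt]; omega)
      have he2 : some (posE φ (vt φ a w') t) ∈ (V.erase a).image par := by
        rw [himg]; exact Finset.mem_image_of_mem _ he
      obtain ⟨x, hx, hxe⟩ := Finset.mem_image.mp he2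
      obtain ⟨hxa, hxV⟩ := Finset.mem_erase.mp hx
      obtain ⟨s, hs, hps, hn2, hm⟩ := hpar x hxV hxa
      rw [hps] at hxe
      rcases posE_eq φ (Option.some.inj hxe).symm with ⟨h1, h2⟩ | ⟨h1, h2⟩
      · exfalso
        rw [h1, ihw, h2] at hs
        have := (norm_mul_flet w' t).1 hs
        rw [← hwt] at this
        omega
      · rw [← vt_mul, ← hwt] at h1
        subst h1
        have q := (hρ _ hxV).2.2 w rfl
        have e1 : vt φ a (ρ (vt φ a w) * flet s) = vt φ a w' := by
          rw [hm, h2, hwt, vt_mul, mv_mv]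
        have ihu := ih _ (by omega) (ρ (vt φ a w) * flet s) rfl (by omega)
        rw [e1, ihw, h2, flet_obar] at ihu
        have e5 := eq_mul_inv_iff_mul_eq.mp ihu
        rw [← e5, ← hwt]
  refine ⟨?_, ?_⟩
  · intro w w' hw hw' h
    rw [← hinj _ w rfl hw, ← hinj _ w' rfl hw', h]
  · intro w s hw hs
    by_contra hcon
    have hmem : vt φ a w ∈ Lv := by
      refine Finset.mem_filter.mpr ⟨hV w hw, ?_, ?_⟩
      · intro h; rw [h, fl_one] at hs; cases hs
      · rintro ⟨e, he, hpe2⟩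
        obtain ⟨w', i, h1, h2, rfl⟩ := hE' e he
        apply hcon
        refine ⟨w', (i, true), h1, h2, ?_⟩
        simp only [pe, hs, Option.map_some] at hpe2
        rw [Option.some.inj hpe2]; simp [posE]
    rw [hL0] at hmem
    simp at hmem

/-- The algebraic Nielsen theorem. -/
theorem gt_main {n : ℕ} (φ : FreeGroup (Fin n) →* FreeGroup (Fin n))
    (hexp : ∀ i, expo i (φ (FreeGroup.of i)) = 1) :
    ∃ (a : FreeGroup (Fin n)) (N0 : ℕ), Function.Injective (vt φ a) ∧
      ∀ w : FreeGroup (Fin n), N0 < w.norm → ∃ s, fl (vt φ a w) = some s ∧ fl w⁻¹ = some s := by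
  classical
  obtain ⟨a, S, h1, h2, h3, h4⟩ := gt_exists_orbit φ hexp
  choose! r hr using h1
  let N0 := S.sup (fun x => (r x).norm + 1)
  have hN : ∀ N, N0 ≤ N → _ := fun N hN => gt_ball φ a S N
    (fun x hx => ⟨r x, hr x hx, le_trans (Finset.le_sup (f := fun x => (r x).norm + 1) hx) hN⟩) h2 h3
    (by convert h4)
  have hinj : Function.Injective (vt φ a) := by
    intro w w' h
    exact (hN (max N0 (max w.norm w'.norm)) (le_max_left _ _)).1 w w' (by simp) (by simp) h
  refine ⟨a, N0, hinj, ?_⟩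
  intro w hw
  have hne : vt φ a w ≠ 1 := by
    intro h
    have h5 := h3 w h
    have h6 := hinj (hr _ h5)
    have h7 := Finset.le_sup (f := fun x => (r x).norm + 1) h5
    rw [← h6] at h7
    change w.norm + 1 ≤ N0 at h7
    omega
  cases hs : fl (vt φ a w) with
  | none => exact absurd ((fl_eq_none _).mp hs) hne
  | some s =>
    refine ⟨s, rfl, ?_⟩
    obtain ⟨w', t, q1, q2, q3⟩ := (hN w.norm hw.le).2 w s le_rfl hs
    have hlt : (w * flet s).norm ≤ w.norm := by
      rcases posE_eq φ q3 with ⟨e1, e2⟩ | ⟨e1, e2⟩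
      · have e3 := hinj e1
        subst e3
        rw [← e2]; exact q2
      · rw [← vt_mul] at e1
        rw [← hinj e1]; exact q1
    by_contra hcon
    have := ((norm_mul_flet w s).2 hcon).1
    omega

instance fgTop (n : ℕ) : TopologicalSpace (FreeGroup (Fin n)) := ⊥
instance fgDisc (n : ℕ) : DiscreteTopology (FreeGroup (Fin n)) := ⟨rfl⟩

/-- the punctured plane -/
abbrev PX {n : ℕ} (c y : Fin n → ℝ) : Type := {p : ℝ × ℝ // ∀ i, p ≠ (c i, y i)}

/-- the two charts: `true` is the plane minus the closed downward rays, `false` minus the upward rays -/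
def pch {n : ℕ} (c y : Fin n → ℝ) (k : Bool) : Set (PX c y) :=
  {p | ∀ i, p.1.1 = c i → if k then y i < p.1.2 else p.1.2 < y i}

theorem exists_sidx {n : ℕ} (c : Fin n → ℝ) (hc : StrictMono c) (x : ℝ) :
    ∃ j : Fin (n+1), ∀ i : Fin n, c i < x ↔ i.castSucc < j := by
  by_cases h : ∀ i, c i < x
  · exact ⟨Fin.last n, fun i => by simp [h i, Fin.castSucc_lt_last]⟩
  · push Not at h
    have hne : {i | x ≤ c i}.Nonempty := h
    let m := WellFounded.min wellFounded_lt _ hne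
    have hm : x ≤ c m := WellFounded.min_mem wellFounded_lt _ hne
    refine ⟨m.castSucc, fun i => ?_⟩
    rw [Fin.castSucc_lt_castSucc_iff]
    constructor
    · intro hi
      by_contra h2
      have := hc.monotone (not_lt.mp h2)
      linarith
    · intro hi
      by_contra h2
      exact WellFounded.not_lt_min wellFounded_lt {i | x ≤ c i} (not_lt.mp h2) hi

/-- strip index -/
noncomputable def sidx {n : ℕ} (c : Fin n → ℝ) (hc : StrictMono c) (x : ℝ) : Fin (n+1) :=
  (exists_sidx c hc x).choose

theorem sidx_spec {n : ℕ} (c : Fin n → ℝ) (hc : StrictMono c) (x : ℝ) (i : Fin n) :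
    c i < x ↔ i.castSucc < sidx c hc x := (exists_sidx c hc x).choose_spec i

theorem sidx_unique {n : ℕ} (c : Fin n → ℝ) (hc : StrictMono c) (x : ℝ) (j : Fin (n+1))
    (h : ∀ i : Fin n, c i < x ↔ i.castSucc < j) : sidx c hc x = j := by
  have h2 : ∀ i : Fin n, i.castSucc < sidx c hc x ↔ i.castSucc < j := fun i =>
    (sidx_spec c hc x i).symm.trans (h i)
  apply le_antisymm
  · by_contra h3
    rw [not_le] at h3
    have hlt : j < Fin.last n := lt_of_lt_of_le h3 (Fin.le_last _)
    have := (h2 (j.castLT (Fin.lt_def.mp hlt))).mp (by simpa using h3)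
    simp at this
  · by_contra h3
    rw [not_le] at h3
    have hlt : sidx c hc x < Fin.last n := lt_of_lt_of_le h3 (Fin.le_last _)
    have := (h2 ((sidx c hc x).castLT (Fin.lt_def.mp hlt))).mpr (by simpa using h3)
    simp at this

/-- strip words -/
def sw {n : ℕ} (j : Fin (n+1)) : FreeGroup (Fin n) := Fin.partialProd FreeGroup.of j

theorem sw_zero {n : ℕ} : sw (0 : Fin (n+1)) = 1 := Fin.partialProd_zero _

theorem sw_succ {n : ℕ} (i : Fin n) : sw i.succ = sw i.castSucc * FreeGroup.of i :=
  Fin.partialProd_succ _ _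

/-- the transition word -/
noncomputable def tw {n : ℕ} (c : Fin n → ℝ) (hc : StrictMono c) (x : ℝ) : FreeGroup (Fin n) :=
  sw (sidx c hc x)

theorem sidx_eventually {n : ℕ} (c : Fin n → ℝ) (hc : StrictMono c) (x : ℝ) (hx : ∀ i, x ≠ c i) :
    ∀ᶠ x' in nhds x, sidx c hc x' = sidx c hc x := by
  have h : ∀ i : Fin n, ∀ᶠ x' in nhds x, (c i < x' ↔ c i < x) := by
    intro i
    rcases lt_or_gt_of_ne (hx i) with h | h
    · filter_upwards [eventually_lt_nhds h] with x' hx'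
      exact ⟨fun h2 => absurd h2 (not_lt.mpr hx'.le), fun h2 => absurd h2 (not_lt.mpr h.le)⟩
    · filter_upwards [eventually_gt_nhds h] with x' hx'
      exact ⟨fun _ => h, fun _ => hx'⟩
  filter_upwards [Filter.eventually_all.mpr h] with x' hx'
  apply sidx_unique
  intro i
  rw [hx' i]; exact sidx_spec c hc x i

theorem isOpen_pch {n : ℕ} (c y : Fin n → ℝ) (k : Bool) : IsOpen (pch c y k) := by
  have : pch c y k = ⋂ i, {p : PX c y | p.1.1 = c i → if k then y i < p.1.2 else p.1.2 < y i} := by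
    ext p; simp [pch]
  rw [this]
  apply isOpen_iInter_of_finite
  intro i
  have h : ∀ p : PX c y, (p.1.1 = c i → if k then y i < p.1.2 else p.1.2 < y i) ↔
      (p.1.1 ≠ c i ∨ if k then y i < p.1.2 else p.1.2 < y i) := fun p => by tauto
  simp only [h]
  apply IsOpen.union
  · exact isOpen_ne_fun (by fun_prop) continuous_const
  · cases k
    · simp only [Bool.false_eq_true, if_false]
      exact isOpen_lt (by fun_prop) continuous_const
    · simp only [if_true]
      exact isOpen_lt continuous_const (by fun_prop)

theorem pch_cover {n : ℕ} (c y : Fin n → ℝ) (hc : StrictMono c) (p : PX c y) (h : p ∉ pch c y true) :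
    p ∈ pch c y false := by
  simp only [pch, Set.mem_setOf_eq, if_true, not_forall, not_lt] at h
  obtain ⟨i, h1, h2⟩ := h
  intro j hj
  have : i = j := hc.injective (h1.symm.trans hj)
  subst this
  simp only [Bool.false_eq_true, if_false]
  refine lt_of_le_of_ne h2 ?_
  intro h3
  exact p.2 i (Prod.ext h1 h3)

theorem pch_inter {n : ℕ} (c y : Fin n → ℝ) (p : PX c y) (h : p ∈ pch c y true)
    (h' : p ∈ pch c y false) : ∀ i, p.1.1 ≠ c i := by
  intro i hi
  have h1 := h i hi
  have h2 := h' i hi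
  simp only [if_true, Bool.false_eq_true, if_false] at h1 h2
  linarith

/-- transition element from chart `i` to chart `j` -/
noncomputable def trE {n : ℕ} (c : Fin n → ℝ) (hc : StrictMono c) (i j : Bool) (x : ℝ) :
    FreeGroup (Fin n) :=
  if i = j then 1 else if i then (tw c hc x)⁻¹ else tw c hc x

open Classical in
/-- the bundle core -/
noncomputable def pcore {n : ℕ} (c y : Fin n → ℝ) (hc : StrictMono c) :
    FiberBundleCore Bool (PX c y) (FreeGroup (Fin n)) where
  baseSet := pch c y
  isOpen_baseSet := isOpen_pch c y
  indexAt p := if p ∈ pch c y true then true else false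
  mem_baseSet_at p := by
    by_cases h : p ∈ pch c y true
    · simp only [h, if_true]
    · simp only [h, if_false]; exact pch_cover c y hc p h
  coordChange i j p v := v * trE c hc i j p.1.1
  coordChange_self i p _ v := by simp [trE]
  continuousOn_coordChange i j := by
    by_cases hij : i = j
    · simp only [trE, hij, if_true, mul_one]; exact continuousOn_snd
    · have key : ∀ q ∈ (pch c y i ∩ pch c y j) ×ˢ (Set.univ : Set (FreeGroup (Fin n))),
          ∀ᶠ q' in nhds q, q'.2 * trE c hc i j q'.1.1.1 = q.2 * trE c hc i j q.1.1.1 := by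
        rintro ⟨p, v⟩ ⟨⟨h1, h2⟩, -⟩
        have hne : ∀ l, p.1.1 ≠ c l := by
          cases i <;> cases j
          · exact absurd rfl hij
          · exact pch_inter c y p h2 h1
          · exact pch_inter c y p h1 h2
          · exact absurd rfl hij
        have e1 := sidx_eventually c hc p.1.1 hne
        have t1 : Filter.Tendsto (fun q : PX c y × FreeGroup (Fin n) => q.1.1.1) (nhds (p, v))
            (nhds p.1.1) := by
          have : Continuous (fun q : PX c y × FreeGroup (Fin n) => q.1.1.1) := by fun_prop
          exact this.tendsto (p, v)
        have t2 : Filter.Tendsto (fun q : PX c y × FreeGroup (Fin n) => q.2) (nhds (p, v))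
            (nhds v) := continuous_snd.tendsto (p, v)
        have e2 : ∀ᶠ v' in nhds v, v' = v := by
          rw [nhds_discrete]; exact Filter.eventually_pure.mpr rfl
        filter_upwards [t1.eventually e1, t2.eventually e2] with q hq1 hq2
        simp only [trE, tw, hq1, hq2]
      intro q hq
      apply ContinuousAt.continuousWithinAt
      exact (tendsto_const_nhds).congr' ((key q hq).mono fun _ h => h.symm)
  coordChange_comp i j k p _ v := by
    cases i <;> cases j <;> cases k <;> simp [trE]

/-- the universal cover -/
abbrev PE {n : ℕ} (c y : Fin n → ℝ) (hc : StrictMono c) : Type := (pcore c y hc).TotalSpace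

/-- the projection -/
noncomputable def pr {n : ℕ} {c y : Fin n → ℝ} {hc : StrictMono c} (e : PE c y hc) : PX c y := e.proj

/-- label in a chart -/
noncomputable def lab {n : ℕ} {c y : Fin n → ℝ} {hc : StrictMono c} (k : Bool) (e : PE c y hc) :
    FreeGroup (Fin n) := ((pcore c y hc).localTriv k e).2

/-- point with label -/
noncomputable def mkE {n : ℕ} {c y : Fin n → ℝ} (hc : StrictMono c) (k : Bool) (p : PX c y)
    (v : FreeGroup (Fin n)) : PE c y hc := ((pcore c y hc).localTriv k).toOpenPartialHomeomorph.symm (p, v)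

theorem pr_covering {n : ℕ} {c y : Fin n → ℝ} {hc : StrictMono c} :
    IsCoveringMap (pr : PE c y hc → PX c y) :=
  FiberBundle.isCoveringMap

theorem pr_cont {n : ℕ} {c y : Fin n → ℝ} {hc : StrictMono c} :
    Continuous (pr : PE c y hc → PX c y) := pr_covering.continuous

theorem lab_continuousOn {n : ℕ} {c y : Fin n → ℝ} {hc : StrictMono c} (k : Bool) :
    ContinuousOn (lab k : PE c y hc → _) (pr ⁻¹' pch c y k) :=
  continuous_snd.comp_continuousOn ((pcore c y hc).localTriv k).continuousOn_toFun

theorem mkE_continuousOn {n : ℕ} {c y : Fin n → ℝ} (hc : StrictMono c) (k : Bool)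
    (v : FreeGroup (Fin n)) : ContinuousOn (fun p => mkE (y := y) hc k p v) (pch c y k) := by
  have h := ((pcore c y hc).localTriv k).continuousOn_invFun
  have h2 : ContinuousOn (fun p : PX c y => (p, v)) (pch c y k) := by fun_prop
  exact h.comp h2 (fun p hp => ⟨hp, trivial⟩)

theorem pr_mkE {n : ℕ} {c y : Fin n → ℝ} (hc : StrictMono c) (k : Bool) (p : PX c y)
    (v : FreeGroup (Fin n)) : pr (mkE hc k p v) = p := rfl

theorem lab_mkE {n : ℕ} {c y : Fin n → ℝ} (hc : StrictMono c) (k : Bool) (p : PX c y)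
    (hp : p ∈ pch c y k) (v : FreeGroup (Fin n)) : lab k (mkE hc k p v) = v := by
  have h := ((pcore c y hc).localTriv k).toOpenPartialHomeomorph.right_inv (x := (p, v)) ⟨hp, trivial⟩
  exact congrArg Prod.snd h

theorem mkE_lab {n : ℕ} {c y : Fin n → ℝ} (hc : StrictMono c) (k : Bool) (e : PE c y hc)
    (hp : pr e ∈ pch c y k) : mkE hc k (pr e) (lab k e) = e :=
  ((pcore c y hc).localTriv k).toOpenPartialHomeomorph.left_inv (x := e) hp

theorem lab_ext {n : ℕ} {c y : Fin n → ℝ} {hc : StrictMono c} (k : Bool) (e e' : PE c y hc)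
    (hp : pr e ∈ pch c y k) (h : pr e = pr e') (h2 : lab k e = lab k e') : e = e' := by
  rw [← mkE_lab hc k e hp, ← mkE_lab hc k e' (h ▸ hp), h, h2]

/-- raw fibre coordinate -/
noncomputable def fv {n : ℕ} {c y : Fin n → ℝ} {hc : StrictMono c} (e : PE c y hc) :
    FreeGroup (Fin n) := e.2

open Classical in
theorem lab_eq {n : ℕ} {c y : Fin n → ℝ} {hc : StrictMono c} (k : Bool) (e : PE c y hc) :
    lab k e = fv e * trE c hc (if pr e ∈ pch c y true then true else false) k (pr e).1.1 := rfl

theorem lab_change {n : ℕ} {c y : Fin n → ℝ} {hc : StrictMono c} (e : PE c y hc)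
    (h1 : pr e ∈ pch c y true) (_h2 : pr e ∈ pch c y false) :
    lab false e = lab true e * (tw c hc (pr e).1.1)⁻¹ := by
  simp [lab_eq, h1, trE]

/-- deck transformations -/
noncomputable def dk {n : ℕ} {c y : Fin n → ℝ} {hc : StrictMono c} (g : FreeGroup (Fin n))
    (e : PE c y hc) : PE c y hc := ⟨e.1, (g * fv e : FreeGroup (Fin n))⟩

theorem pr_dk {n : ℕ} {c y : Fin n → ℝ} {hc : StrictMono c} (g : FreeGroup (Fin n))
    (e : PE c y hc) : pr (dk g e) = pr e := rfl

theorem lab_dk {n : ℕ} {c y : Fin n → ℝ} {hc : StrictMono c} (k : Bool) (g : FreeGroup (Fin n))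
    (e : PE c y hc) : lab k (dk g e) = g * lab k e := by
  have : fv (dk g e) = g * fv e := rfl
  rw [lab_eq, lab_eq, this, pr_dk, mul_assoc]

theorem exists_chart {n : ℕ} {c y : Fin n → ℝ} (hc : StrictMono c) (p : PX c y) :
    ∃ k, p ∈ pch c y k := by
  by_cases h : p ∈ pch c y true
  · exact ⟨_, h⟩
  · exact ⟨_, pch_cover c y hc p h⟩

theorem dk_one {n : ℕ} {c y : Fin n → ℝ} {hc : StrictMono c} (e : PE c y hc) : dk 1 e = e := by
  obtain ⟨k, hk⟩ := exists_chart hc (pr e)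
  exact lab_ext k _ _ hk rfl (by rw [lab_dk, one_mul])

theorem dk_mul {n : ℕ} {c y : Fin n → ℝ} {hc : StrictMono c} (g g' : FreeGroup (Fin n))
    (e : PE c y hc) : dk (g * g') e = dk g (dk g' e) := by
  obtain ⟨k, hk⟩ := exists_chart hc (pr e)
  exact lab_ext k _ _ hk rfl (by rw [lab_dk, lab_dk, lab_dk, mul_assoc])

theorem dk_inj {n : ℕ} {c y : Fin n → ℝ} {hc : StrictMono c} (g g' : FreeGroup (Fin n))
    (e : PE c y hc) (h : dk g e = dk g' e) : g = g' := by
  have := congrArg (lab true) h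
  rw [lab_dk, lab_dk] at this
  exact mul_right_cancel this

theorem dk_trans {n : ℕ} {c y : Fin n → ℝ} {hc : StrictMono c} (e e' : PE c y hc)
    (h : pr e = pr e') : ∃ g, e' = dk g e := by
  obtain ⟨k, hk⟩ := exists_chart hc (pr e)
  refine ⟨lab k e' * (lab k e)⁻¹, lab_ext k _ _ (h ▸ hk) h.symm ?_⟩
  rw [lab_dk]; group

/-- continuity criterion for maps into the cover -/
theorem contAt_PE {n : ℕ} {c y : Fin n → ℝ} {hc : StrictMono c} {Z : Type*} [TopologicalSpace Z]
    (F : Z → PE c y hc) (S : Set Z) (z : Z) (k : Bool) (hk : pr (F z) ∈ pch c y k)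
    (h1 : ContinuousWithinAt (fun z => pr (F z)) S z)
    (h2 : ∀ᶠ z' in nhdsWithin z S, pr (F z') ∈ pch c y k → lab k (F z') = lab k (F z)) :
    ContinuousWithinAt F S z := by
  have h3 := (mkE_continuousOn (y := y) hc k (lab k (F z))).continuousAt
    ((isOpen_pch c y k).mem_nhds hk)
  have h4 : ContinuousWithinAt (fun z' => mkE hc k (pr (F z')) (lab k (F z))) S z :=
    ContinuousAt.comp_continuousWithinAt (f := fun z => pr (F z)) h3 h1
  unfold ContinuousWithinAt at h4 ⊢
  beta_reduce at h4
  rw [mkE_lab hc k _ hk] at h4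
  refine h4.congr' ?_
  filter_upwards [h2, h1.eventually ((isOpen_pch c y k).mem_nhds hk)] with z' hz hz'
  rw [← hz hz', mkE_lab hc k _ hz']

theorem lab_eventually {n : ℕ} {c y : Fin n → ℝ} {hc : StrictMono c} (k : Bool) (e : PE c y hc)
    (hk : pr e ∈ pch c y k) : ∀ᶠ e' in nhds e, lab k e' = lab k e := by
  have h := (lab_continuousOn (hc := hc) k).continuousAt
    (((isOpen_pch c y k).preimage pr_cont).mem_nhds hk)
  have : {lab k e} ∈ nhds (lab k e) := (isOpen_discrete _).mem_nhds rfl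
  exact h this

theorem dk_continuous {n : ℕ} {c y : Fin n → ℝ} {hc : StrictMono c} (g : FreeGroup (Fin n)) :
    Continuous (dk g : PE c y hc → PE c y hc) := by
  rw [← continuousOn_univ]
  intro e _
  obtain ⟨k, hk⟩ := exists_chart hc (pr e)
  refine contAt_PE _ _ _ k hk pr_cont.continuousWithinAt ?_
  rw [nhdsWithin_univ]
  filter_upwards [lab_eventually k e hk] with e' he' _
  rw [lab_dk, lab_dk, he']

/-- separating coordinates on the cover -/
noncomputable def acoord {n : ℕ} {c y : Fin n → ℝ} {hc : StrictMono c} (e : PE c y hc)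
    (q : Bool × FreeGroup (Fin n)) : ENNReal :=
  open Classical in if lab q.1 e = q.2 then Metric.infEDist (pr e) (pch c y q.1)ᶜ else 0

theorem acoord_pos {n : ℕ} {c y : Fin n → ℝ} {hc : StrictMono c} (e : PE c y hc)
    (k : Bool) (u : FreeGroup (Fin n)) (hk : pr e ∈ pch c y k) :
    acoord e (k, u) ≠ 0 ↔ lab k e = u := by
  unfold acoord
  by_cases h : lab k e = u
  · simp only [h, if_true, ne_eq, iff_true]
    intro h0
    have := (Metric.mem_iff_infEDist_zero_of_closed (isOpen_pch c y k).isClosed_compl).mpr h0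
    exact this hk
  · simp [h]

theorem acoord_cont {n : ℕ} {c y : Fin n → ℝ} {hc : StrictMono c} (q : Bool × FreeGroup (Fin n)) :
    Continuous (fun e : PE c y hc => acoord e q) := by
  obtain ⟨k, u⟩ := q
  have hcont : Continuous (fun e : PE c y hc => Metric.infEDist (pr e) (pch c y k)ᶜ) :=
    Metric.continuous_infEDist.comp pr_cont
  rw [continuous_iff_continuousAt]
  intro e
  by_cases hk : pr e ∈ pch c y k
  · by_cases hu : lab k e = u
    · refine (hcont.continuousAt).congr ?_
      filter_upwards [lab_eventually k e hk] with e' he'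
      simp [acoord, he', hu]
    · refine (continuousAt_const (y := (0 : ENNReal))).congr ?_
      filter_upwards [lab_eventually k e hk] with e' he'
      simp [acoord, he', hu]
  · have h0 : Metric.infEDist (pr e) (pch c y k)ᶜ = 0 := Metric.infEDist_zero_of_mem hk
    have h1 : acoord e (k, u) = 0 := by unfold acoord; simp [h0]
    unfold ContinuousAt
    beta_reduce
    rw [h1]
    have h2 : Filter.Tendsto (fun e : PE c y hc => Metric.infEDist (pr e) (pch c y k)ᶜ) (nhds e)
        (nhds 0) := by rw [← h0]; exact hcont.tendsto e
    refine tendsto_of_tendsto_of_tendsto_of_le_of_le tendsto_const_nhds h2 (fun _ => zero_le) ?_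
    intro e'
    simp only [acoord]
    split_ifs
    · exact le_rfl
    · exact zero_le

/-- injection of the cover into a metrizable space -/
noncomputable def embE {n : ℕ} {c y : Fin n → ℝ} {hc : StrictMono c} (e : PE c y hc) :
    PX c y × (Bool × FreeGroup (Fin n) → ENNReal) := (pr e, acoord e)

theorem embE_cont {n : ℕ} {c y : Fin n → ℝ} {hc : StrictMono c} :
    Continuous (embE : PE c y hc → _) :=
  pr_cont.prodMk (continuous_pi fun q => acoord_cont q)

theorem embE_inj {n : ℕ} {c y : Fin n → ℝ} {hc : StrictMono c} :
    Function.Injective (embE : PE c y hc → _) := by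
  intro e e' h
  have h1 : pr e = pr e' := congrArg Prod.fst h
  have h2 : acoord e = acoord e' := congrArg Prod.snd h
  obtain ⟨k, hk⟩ := exists_chart hc (pr e)
  refine lab_ext k e e' hk h1 ?_
  have h3 := (acoord_pos e k (lab k e) hk).mpr rfl
  rw [h2] at h3
  exact ((acoord_pos e' k (lab k e) (h1 ▸ hk)).mp h3).symm

instance peT2 {n : ℕ} {c y : Fin n → ℝ} {hc : StrictMono c} : T2Space (PE c y hc) :=
  T2Space.of_injective_continuous embE_inj embE_cont

theorem fg_countable (n : ℕ) : Countable (FreeGroup (Fin n)) := by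
  unfold FreeGroup; infer_instance

theorem TExt_union {n : ℕ} {c y : Fin n → ℝ} {hc : StrictMono c} (A B : Set (PE c y hc))
    (hAc : IsCompact A) (hBc : IsCompact B) (hAn : A.Nonempty) (hBn : B.Nonempty)
    (hA : TExt A) (hB : TExt B) (hAB : TExt (A ∩ B)) : TExt (A ∪ B) := by
  haveI := fg_countable n
  letI := TopologicalSpace.metrizableSpaceMetric (PX c y × (Bool × FreeGroup (Fin n) → ENNReal))
  have key : ∀ C : Set (PE c y hc), IsCompact C → C.Nonempty → ∀ e,
      Metric.infDist (embE e) (embE '' C) = 0 → e ∈ C := by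
    intro C hC hn e he
    have h1 : IsClosed (embE '' C) := (hC.image embE_cont).isClosed
    have := (h1.mem_iff_infDist_zero (hn.image _)).mpr he
    obtain ⟨e', he', h2⟩ := this
    rwa [← embE_inj h2]
  refine TExt.glue hA hB hAB (fun e => Metric.infDist (embE e) (embE '' A) -
    Metric.infDist (embE e) (embE '' B)) ?_ ?_ ?_
  · apply Continuous.continuousOn
    exact ((Metric.continuous_infDist_pt _).comp embE_cont).sub
      ((Metric.continuous_infDist_pt _).comp embE_cont)
  · rintro e (he | he) h
    · exact he
    · have h0 : Metric.infDist (embE e) (embE '' B) = 0 :=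
        Metric.infDist_zero_of_mem (Set.mem_image_of_mem _ he)
      rw [h0, sub_zero] at h
      exact key A hAc hAn e (le_antisymm h Metric.infDist_nonneg)
  · rintro e (he | he) h
    · have h0 : Metric.infDist (embE e) (embE '' A) = 0 :=
        Metric.infDist_zero_of_mem (Set.mem_image_of_mem _ he)
      rw [h0, zero_sub] at h
      exact key B hBc hBn e (le_antisymm (by linarith) Metric.infDist_nonneg)
    · exact he

/-- induction over parent closed finite sets -/
theorem pc_induction {ι : Type*} [DecidableEq ι] (par : ι → ι) (root : ι) (rk : ι → ℕ)
    (hrk : ∀ i, i ≠ root → rk (par i) < rk i) (D : Finset ι) (hroot : root ∈ D)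
    (hD : ∀ i ∈ D, par i ∈ D) (P : Finset ι → Prop) (h0 : P D)
    (hs : ∀ S : Finset ι, D ⊆ S → (∀ i ∈ S, par i ∈ S) → ∀ i, i ∉ S → par i ∈ S → P S →
      P (insert i S)) :
    ∀ S : Finset ι, D ⊆ S → (∀ i ∈ S, par i ∈ S) → P S := by
  intro S
  induction hk : (S \ D).card using Nat.strong_induction_on generalizing S with
  | _ k ih =>
    intro hDS hS
    by_cases hne : (S \ D).Nonempty
    · obtain ⟨i, hi, hmax⟩ := (S \ D).exists_max_image rk hne
      rw [Finset.mem_sdiff] at hi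
      have hir : i ≠ root := fun h => hi.2 (h ▸ hroot)
      have hpi : par i ≠ i := fun h => by have := hrk i hir; rw [h] at this; exact lt_irrefl _ this
      have hDS' : D ⊆ S.erase i := fun j hj =>
        Finset.mem_erase.mpr ⟨fun h => hi.2 (h ▸ hj), hDS hj⟩
      have hS' : ∀ j ∈ S.erase i, par j ∈ S.erase i := by
        intro j hj
        rw [Finset.mem_erase] at hj ⊢
        refine ⟨fun h => ?_, hS j hj.2⟩
        by_cases hjD : j ∈ D
        · exact hi.2 (h ▸ hD j hjD)
        · have h1 := hmax j (Finset.mem_sdiff.mpr ⟨hj.2, hjD⟩)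
          have h2 := hrk j (fun h => hjD (h ▸ hroot))
          rw [h] at h2
          omega
      have hlt : (S.erase i \ D).card < k := by
        rw [← hk]
        apply Finset.card_lt_card
        refine ⟨Finset.sdiff_subset_sdiff (Finset.erase_subset _ _) (le_refl _), fun h => ?_⟩
        have := h (Finset.mem_sdiff.mpr hi)
        simp at this
      have := hs (S.erase i) hDS' hS' i (by simp)
        (Finset.mem_erase.mpr ⟨hpi, hS i hi.1⟩) (ih _ hlt _ rfl hDS' hS')
      rwa [Finset.insert_erase hi.1] at this
    · rw [Finset.not_nonempty_iff_eq_empty, Finset.sdiff_eq_empty_iff_subset] at hne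
      rwa [Finset.Subset.antisymm hne hDS]

/-- union of tiles -/
def tun {ι E : Type*} (T : ι → Set E) (S : Finset ι) : Set E := ⋃ i ∈ S, T i

theorem tun_insert {ι E : Type*} [DecidableEq ι] (T : ι → Set E) (S : Finset ι) (i : ι) :
    tun T (insert i S) = T i ∪ tun T S := by
  unfold tun; rw [Finset.set_biUnion_insert]

theorem tun_inter {ι E : Type*} (T : ι → Set E) (par : ι → ι) (S : Finset ι)
    (hadj : ∀ i j, i ≠ j → (T i ∩ T j).Nonempty → par i = j ∨ par j = i)
    (hS : ∀ i ∈ S, par i ∈ S) (i : ι) (hi : i ∉ S) (hp : par i ∈ S) :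
    T i ∩ tun T S = T i ∩ T (par i) := by
  ext e
  simp only [tun, Set.mem_inter_iff, Set.mem_iUnion, exists_prop]
  constructor
  · rintro ⟨h1, j, hj, h2⟩
    refine ⟨h1, ?_⟩
    rcases hadj i j (fun h => hi (h ▸ hj)) ⟨e, h1, h2⟩ with h | h
    · rwa [h]
    · exact absurd (h ▸ hS j hj) hi
  · rintro ⟨h1, h2⟩
    exact ⟨h1, _, hp, h2⟩

theorem tun_compact {ι E : Type*} [TopologicalSpace E] (T : ι → Set E) (S : Finset ι)
    (hT : ∀ i, IsCompact (T i)) : IsCompact (tun T S) :=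
  S.isCompact_biUnion fun i _ => hT i

theorem tun_TExt {n : ℕ} {c y : Fin n → ℝ} {hc : StrictMono c} {ι : Type*} [DecidableEq ι]
    (T : ι → Set (PE c y hc)) (par : ι → ι)
    (root : ι) (rk : ι → ℕ) (hrk : ∀ i, i ≠ root → rk (par i) < rk i) (hpr : par root = root)
    (hadj : ∀ i j, i ≠ j → (T i ∩ T j).Nonempty → par i = j ∨ par j = i)
    (hc1 : ∀ i, IsCompact (T i)) (hne : ∀ i, (T i).Nonempty)
    (hT : ∀ i, TExt (T i)) (hg : ∀ i, i ≠ root → TExt (T i ∩ T (par i)))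
    (S : Finset ι) (hr : root ∈ S) (hS : ∀ i ∈ S, par i ∈ S) : TExt (tun T S) := by
  refine pc_induction par root rk hrk {root} (by simp) (by simp [hpr]) (fun S => TExt (tun T S)) ?_ ?_ S
    (by simpa using hr) hS
  · simpa [tun] using hT root
  · intro S hDS hS i hi hp h
    have hir : i ≠ root := fun h => hi (h ▸ hDS (by simp))
    rw [tun_insert]
    refine TExt_union _ _ (hc1 i) (tun_compact T S hc1) (hne i) ?_ (hT i) h ?_
    · obtain ⟨e, he⟩ := hne root
      exact ⟨e, Set.mem_biUnion (hDS (by simp)) he⟩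
    · rw [tun_inter T par S hadj hS i hi hp]; exact hg i hir

theorem tun_retract {E : Type} [TopologicalSpace E] [T2Space E] {ι : Type*} [DecidableEq ι]
    (T : ι → Set E) (par : ι → ι)
    (root : ι) (rk : ι → ℕ) (hrk : ∀ i, i ≠ root → rk (par i) < rk i)
    (hadj : ∀ i j, i ≠ j → (T i ∩ T j).Nonempty → par i = j ∨ par j = i)
    (hc1 : ∀ i, IsCompact (T i)) (hg : ∀ i, i ≠ root → TExt (T i ∩ T (par i)))
    (D : Finset ι) (hr : root ∈ D) (hD : ∀ i ∈ D, par i ∈ D)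
    (S : Finset ι) (hDS : D ⊆ S) (hS : ∀ i ∈ S, par i ∈ S) :
    ∃ R : E → E, ContinuousOn R (tun T S) ∧ (∀ e ∈ tun T S, R e ∈ tun T D) ∧
      (∀ e ∈ tun T D, R e = e) ∧
      ∀ i ∈ S, i ∉ D → ∃ k, par^[k] i ∉ D ∧ par^[k+1] i ∈ D ∧ ∀ e ∈ T i, R e ∈ T (par^[k] i) := by
  classical
  refine pc_induction par root rk hrk D hr hD (fun S => ∃ R : E → E, ContinuousOn R (tun T S) ∧
      (∀ e ∈ tun T S, R e ∈ tun T D) ∧ (∀ e ∈ tun T D, R e = e) ∧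
      ∀ i ∈ S, i ∉ D → ∃ k, par^[k] i ∉ D ∧ par^[k+1] i ∈ D ∧ ∀ e ∈ T i, R e ∈ T (par^[k] i))
    ?_ ?_ S hDS hS
  · exact ⟨id, continuousOn_id, fun e he => he, fun _ _ => rfl, fun i hi hi' => absurd hi hi'⟩
  · rintro S hDS hS i hi hp ⟨R, hR, hRD, hRid, hRi⟩
    have hir : i ≠ root := fun h => hi (h ▸ hDS hr)
    have hgate := tun_inter T par S hadj hS i hi hp
    haveI : CompactSpace (T i) := isCompact_iff_compactSpace.mp (hc1 i)
    have hTcl : ∀ i, IsClosed (T i) := fun i => (hc1 i).isClosed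
    obtain ⟨r, hr1, hr2, hr3⟩ := hg i hir (T i) {e | e.1 ∈ T (par i)}
      ((hTcl _).preimage continuous_subtype_val) (fun e => e.1)
      continuous_subtype_val.continuousOn (fun e he => ⟨e.2, he⟩)
    have hpS : T (par i) ⊆ tun T S := fun e he => Set.mem_biUnion (Finset.mem_coe.mpr hp) he
    let r' : E → E := fun e => if h : e ∈ T i then R (r ⟨e, h⟩) else e
    have hr'c : ContinuousOn r' (T i) := by
      rw [continuousOn_iff_continuous_restrict]
      have : (T i).domRestrict r' = fun e => R (r e) := by
        ext e; simp [Set.domRestrict, r']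
      rw [this]
      exact hR.comp_continuous hr1 (fun e => hpS (hr2 e).2)
    have heq : ∀ e ∈ T i ∩ tun T S, r' e = R e := by
      intro e he
      rw [hgate] at he
      have := hr3 (x := ⟨e, he.1⟩) he.2
      simp only [r', dif_pos he.1, this]
    let R' : E → E := fun e => if e ∈ tun T S then R e else r' e
    have hR'1 : ∀ e ∈ tun T S, R' e = R e := fun e he => if_pos he
    have hR'2 : ∀ e ∈ T i, R' e = r' e := by
      intro e he
      by_cases h : e ∈ tun T S
      · rw [hR'1 e h, heq e ⟨he, h⟩]
      · exact if_neg h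
    have hDS' : tun T D ⊆ tun T S := Set.biUnion_subset_biUnion_left hDS
    refine ⟨R', ?_, ?_, ?_, ?_⟩
    · rw [tun_insert]
      refine ContinuousOn.union_of_isClosed (hr'c.congr hR'2) (hR.congr hR'1) (hTcl i)
        (tun_compact T S hc1).isClosed
    · rw [tun_insert]
      rintro e (he | he)
      · rw [hR'2 e he]; simp only [r', dif_pos he]
        exact hRD _ (hpS (hr2 _).2)
      · rw [hR'1 e he]; exact hRD e he
    · intro e he
      rw [hR'1 e (hDS' he)]; exact hRid e he
    · intro j hj hjD
      rw [Finset.mem_insert] at hj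
      rcases hj with rfl | hj
      · by_cases hpD : par j ∈ D
        · refine ⟨0, hjD, by simpa using hpD, fun e he => ?_⟩
          rw [hR'2 e he]; simp only [r', dif_pos he, Function.iterate_zero, id]
          have h2 := hr2 ⟨e, he⟩
          rw [hRid _ (Set.mem_biUnion (Finset.mem_coe.mpr hpD) h2.2)]
          exact h2.1
        · obtain ⟨k, h1, h2, h3⟩ := hRi (par j) hp hpD
          refine ⟨k + 1, by simpa using h1, by simpa using h2, fun e he => ?_⟩
          rw [hR'2 e he]; simp only [r', dif_pos he]
          exact h3 _ (hr2 ⟨e, he⟩).2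
      · obtain ⟨k, h1, h2, h3⟩ := hRi j hj hjD
        refine ⟨k, h1, h2, fun e he => ?_⟩
        rw [hR'1 e (Set.mem_biUnion (Finset.mem_coe.mpr hj) he)]
        exact h3 e he

/-- data of a box with removed diamonds -/
structure TD (n : ℕ) where
  c : Fin n → ℝ
  y : Fin n → ℝ
  hc : StrictMono c
  ε : ℝ
  L : ℝ
  H : ℝ
  hε : 0 < ε
  hL0 : 0 < L
  hH0 : 0 < H
  hgap : ∀ i i', i < i' → c i + 2 * ε < c i'
  hL : ∀ i, -L < c i - ε ∧ c i + ε < L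
  hH : ∀ i, -H < y i - ε ∧ y i + ε < H

/-- box minus diamonds -/
def TD.K {n : ℕ} (t : TD n) : Set (ℝ × ℝ) :=
  {p | |p.1| ≤ t.L ∧ |p.2| ≤ t.H ∧ ∀ i, t.ε ≤ |p.1 - t.c i| + |p.2 - t.y i|}

/-- closed strip -/
def TD.St {n : ℕ} (t : TD n) (j : Fin (n+1)) : Set (ℝ × ℝ) :=
  {p | ∀ i : Fin n, (i.castSucc < j → t.c i ≤ p.1) ∧ (j ≤ i.castSucc → p.1 ≤ t.c i)}

/-- the cover -/
abbrev TD.E {n : ℕ} (t : TD n) : Type := PE t.c t.y t.hc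

/-- diamond half width -/
noncomputable def TD.d {n : ℕ} (t : TD n) (i : Fin n) (s : ℝ) : ℝ := max 0 (t.ε - |s - t.y i|)

noncomputable def TD.lb {n : ℕ} (t : TD n) (j : Fin (n+1)) (s : ℝ) : ℝ :=
  Fin.cases (-t.L) (fun i => t.c i + t.d i s) j

noncomputable def TD.rb {n : ℕ} (t : TD n) (j : Fin (n+1)) (s : ℝ) : ℝ :=
  Fin.lastCases t.L (fun i => t.c i - t.d i s) j

theorem TD.d_nonneg {n : ℕ} (t : TD n) (i : Fin n) (s : ℝ) : 0 ≤ t.d i s := le_max_left _ _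

theorem TD.d_le {n : ℕ} (t : TD n) (i : Fin n) (s : ℝ) : t.d i s ≤ t.ε :=
  max_le t.hε.le (by have := abs_nonneg (s - t.y i); linarith)

theorem TD.d_ge {n : ℕ} (t : TD n) (i : Fin n) (s : ℝ) : t.ε - |s - t.y i| ≤ t.d i s := le_max_right _ _

theorem TD.d_cont {n : ℕ} (t : TD n) (i : Fin n) : Continuous (t.d i) := by
  unfold TD.d; fun_prop

theorem TD.lb_cont {n : ℕ} (t : TD n) (j : Fin (n+1)) : Continuous (t.lb j) := by
  induction j using Fin.cases with
  | zero => exact continuous_const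
  | succ i => exact continuous_const.add (t.d_cont i)

theorem TD.lb_succ {n : ℕ} (t : TD n) (i : Fin n) (s : ℝ) : t.lb i.succ s = t.c i + t.d i s := rfl
theorem TD.lb_zero {n : ℕ} (t : TD n) (s : ℝ) : t.lb 0 s = -t.L := rfl
theorem TD.rb_cast {n : ℕ} (t : TD n) (i : Fin n) (s : ℝ) : t.rb i.castSucc s = t.c i - t.d i s := by
  simp [TD.rb]
theorem TD.rb_last {n : ℕ} (t : TD n) (s : ℝ) : t.rb (Fin.last n) s = t.L := by simp [TD.rb]

theorem TD.rb_cont {n : ℕ} (t : TD n) (j : Fin (n+1)) : Continuous (t.rb j) := by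
  induction j using Fin.lastCases with
  | last => rw [show t.rb (Fin.last n) = fun _ => t.L from funext t.rb_last]; exact continuous_const
  | cast i =>
    rw [show t.rb i.castSucc = fun s => t.c i - t.d i s from funext (t.rb_cast i)]
    exact continuous_const.sub (t.d_cont i)

theorem TD.le_lb {n : ℕ} (t : TD n) (j : Fin (n+1)) (s : ℝ) (i : Fin n) (h : i.castSucc < j) :
    t.c i + t.d i s ≤ t.lb j s := by
  induction j using Fin.cases with
  | zero => exact absurd h (by simp)
  | succ i' =>
    rw [TD.lb_succ]
    rw [Fin.castSucc_lt_succ_iff] at h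
    rcases h.eq_or_lt with rfl | h
    · exact le_rfl
    · have := t.hgap i i' h
      have := t.d_le i s
      have := t.d_nonneg i' s
      have := t.hε
      linarith

theorem TD.rb_le {n : ℕ} (t : TD n) (j : Fin (n+1)) (s : ℝ) (i : Fin n) (h : j ≤ i.castSucc) :
    t.rb j s ≤ t.c i - t.d i s := by
  induction j using Fin.lastCases with
  | last => exact absurd h (by simp [Fin.castSucc_lt_last])
  | cast i' =>
    rw [TD.rb_cast]
    rw [Fin.castSucc_le_castSucc_iff] at h
    rcases h.eq_or_lt with rfl | h
    · exact le_rfl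
    · have := t.hgap i' i h
      have := t.d_le i s
      have := t.d_nonneg i' s
      have := t.hε
      linarith

theorem TD.neg_L_le_lb {n : ℕ} (t : TD n) (j : Fin (n+1)) (s : ℝ) : -t.L ≤ t.lb j s := by
  induction j using Fin.cases with
  | zero => exact le_rfl
  | succ i => rw [TD.lb_succ]; have := t.hL i; have := t.d_nonneg i s; have := t.hε; linarith

theorem TD.rb_le_L {n : ℕ} (t : TD n) (j : Fin (n+1)) (s : ℝ) : t.rb j s ≤ t.L := by
  induction j using Fin.lastCases with
  | last => rw [TD.rb_last]
  | cast i => rw [TD.rb_cast]; have := t.hL i; have := t.d_nonneg i s; have := t.hε; linarith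

theorem TD.lb_le_rb {n : ℕ} (t : TD n) (j : Fin (n+1)) (s : ℝ) : t.lb j s ≤ t.rb j s := by
  have h0 := t.hL0
  induction j using Fin.cases with
  | zero =>
    rw [TD.lb_zero]
    rcases Fin.eq_castSucc_or_eq_last (0 : Fin (n+1)) with ⟨i, hi⟩ | h
    · rw [hi, TD.rb_cast]; have := t.hL i; have := t.d_le i s; linarith
    · rw [h, TD.rb_last]; linarith
  | succ i =>
    rw [TD.lb_succ]
    rcases Fin.eq_castSucc_or_eq_last i.succ with ⟨i', hi⟩ | h
    · rw [hi, TD.rb_cast]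
      have h2 : i < i' := by
        rw [← Fin.castSucc_lt_castSucc_iff, ← hi]; exact Fin.castSucc_lt_succ
      have := t.hgap i i' h2; have := t.d_le i s; have := t.d_le i' s; linarith
    · rw [h, TD.rb_last]; have := t.hL i; have := t.d_le i s; linarith

/-- strip part of the box in coordinates -/
def TD.Q {n : ℕ} (t : TD n) (j : Fin (n+1)) : Set (ℝ × ℝ) :=
  {p | |p.2| ≤ t.H ∧ t.lb j p.2 ≤ p.1 ∧ p.1 ≤ t.rb j p.2}

theorem TD.Q_eq {n : ℕ} (t : TD n) (j : Fin (n+1)) : t.Q j = t.K ∩ t.St j := by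
  ext ⟨x, s⟩
  simp only [TD.Q, TD.K, TD.St, Set.mem_inter_iff, Set.mem_ofPred_eq]
  constructor
  · rintro ⟨h1, h2, h3⟩
    have e1 : ∀ i : Fin n, i.castSucc < j → t.c i + t.d i s ≤ x := fun i hi =>
      (t.le_lb j s i hi).trans h2
    have e2 : ∀ i : Fin n, j ≤ i.castSucc → x ≤ t.c i - t.d i s := fun i hi =>
      h3.trans (t.rb_le j s i hi)
    refine ⟨⟨abs_le.mpr ⟨(t.neg_L_le_lb j s).trans h2, h3.trans (t.rb_le_L j s)⟩, h1, fun i => ?_⟩,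
      fun i => ⟨fun hi => ?_, fun hi => ?_⟩⟩
    · have := t.d_ge i s
      rcases lt_or_ge i.castSucc j with hi | hi
      · have := e1 i hi; have := le_abs_self (x - t.c i); linarith
      · have := e2 i hi; have := neg_le_abs (x - t.c i); linarith
    · have := e1 i hi; have := t.d_nonneg i s; linarith
    · have := e2 i hi; have := t.d_nonneg i s; linarith
  · rintro ⟨⟨h1, h2, h3⟩, h4⟩
    rw [abs_le] at h1
    refine ⟨h2, ?_, ?_⟩
    · induction j using Fin.cases with
      | zero => exact h1.1
      | succ i =>
        rw [TD.lb_succ]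
        have h5 := (h4 i).1 (Fin.castSucc_lt_succ)
        have h6 := h3 i
        rw [abs_of_nonneg (by linarith)] at h6
        have : t.d i s ≤ x - t.c i := max_le (by linarith) (by linarith)
        linarith
    · induction j using Fin.lastCases with
      | last => rw [TD.rb_last]; exact h1.2
      | cast i =>
        rw [TD.rb_cast]
        have h5 := (h4 i).2 le_rfl
        have h6 := h3 i
        rw [abs_of_nonpos (by linarith)] at h6
        have : t.d i s ≤ t.c i - x := max_le (by linarith) (by linarith)
        linarith

theorem TD.K_ne {n : ℕ} (t : TD n) (p : ℝ × ℝ) (hp : p ∈ t.K) : ∀ i, p ≠ (t.c i, t.y i) := by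
  rintro i rfl
  have := hp.2.2 i
  simp at this
  linarith [t.hε]

theorem TD.K_strip {n : ℕ} (t : TD n) (p : ℝ × ℝ) : ∃ j, p ∈ t.St j := by
  refine ⟨sidx t.c t.hc p.1, fun i => ⟨fun h => ((sidx_spec t.c t.hc p.1 i).mpr h).le, fun h => ?_⟩⟩
  by_contra h2
  exact absurd ((sidx_spec t.c t.hc p.1 i).mp (not_le.mp h2)) (not_lt.mpr h)

theorem TD.St_sidx {n : ℕ} (t : TD n) (j : Fin (n+1)) (p : ℝ × ℝ) (hp : p ∈ t.St j)
    (hne : ∀ i, p.1 ≠ t.c i) : sidx t.c t.hc p.1 = j := by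
  apply sidx_unique
  intro i
  refine ⟨fun h => ?_, fun h => lt_of_le_of_ne ((hp i).1 h) (hne i).symm⟩
  by_contra h2
  exact absurd ((hp i).2 (not_lt.mp h2)) (not_le.mpr h)

open Classical in
/-- section of the cover over a strip -/
noncomputable def TD.sec {n : ℕ} (t : TD n) (w : FreeGroup (Fin n)) (j : Fin (n+1)) (p : ℝ × ℝ) : t.E :=
  if h : ∀ i, p ≠ (t.c i, t.y i) then
    (if (⟨p, h⟩ : PX t.c t.y) ∈ pch t.c t.y true then mkE t.hc true ⟨p, h⟩ w
      else mkE t.hc false ⟨p, h⟩ (w * (sw j)⁻¹))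
  else mkE t.hc true ⟨(t.L + 1, 0), fun i h => by
    have h1 := (t.hL i).2
    have h2 : t.L + 1 = t.c i := congrArg Prod.fst h
    linarith [t.hε]⟩ 1

theorem TD.pr_sec {n : ℕ} (t : TD n) (w : FreeGroup (Fin n)) (j : Fin (n+1)) (p : ℝ × ℝ)
    (h : ∀ i, p ≠ (t.c i, t.y i)) : pr (t.sec w j p) = ⟨p, h⟩ := by
  unfold TD.sec
  rw [dif_pos h]
  split_ifs <;> exact pr_mkE _ _ _ _

theorem TD.lab_sec {n : ℕ} (t : TD n) (w : FreeGroup (Fin n)) (j : Fin (n+1)) (p : ℝ × ℝ)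
    (h : ∀ i, p ≠ (t.c i, t.y i)) (hp : p ∈ t.St j) (k : Bool)
    (hk : (⟨p, h⟩ : PX t.c t.y) ∈ pch t.c t.y k) :
    lab k (t.sec w j p) = if k then w else w * (sw j)⁻¹ := by
  unfold TD.sec
  rw [dif_pos h]
  cases k
  · by_cases h2 : (⟨p, h⟩ : PX t.c t.y) ∈ pch t.c t.y true
    · rw [if_pos h2, lab_change _ h2 hk, lab_mkE _ _ _ h2, pr_mkE, tw,
        t.St_sidx j p hp (pch_inter _ _ _ h2 hk)]
      simp
    · rw [if_neg h2, lab_mkE _ _ _ hk]; simp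
  · rw [if_pos hk, lab_mkE _ _ _ hk]; simp

theorem TD.sec_cont {n : ℕ} (t : TD n) (w : FreeGroup (Fin n)) (j : Fin (n+1)) :
    ContinuousOn (t.sec w j) {p | p ∈ t.St j ∧ ∀ i, p ≠ (t.c i, t.y i)} := by
  rintro p ⟨hp1, hp2⟩
  obtain ⟨k, hk⟩ := exists_chart t.hc (⟨p, hp2⟩ : PX t.c t.y)
  refine contAt_PE _ _ _ k (by rw [t.pr_sec w j p hp2]; exact hk) ?_ ?_
  · rw [continuousWithinAt_iff_continuousAt_restrict (fun p => pr (t.sec w j p)) (⟨hp1, hp2⟩ :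
      p ∈ {p | p ∈ t.St j ∧ ∀ i, p ≠ (t.c i, t.y i)})]
    apply Continuous.continuousAt
    refine Continuous.congr (f := fun q : {p | p ∈ t.St j ∧ ∀ i, p ≠ (t.c i, t.y i)} =>
      (⟨q.1, q.2.2⟩ : PX t.c t.y)) (by fun_prop) ?_
    intro q
    simp only [Set.domRestrict]
    rw [t.pr_sec w j q.1 q.2.2]
  · filter_upwards [self_mem_nhdsWithin] with p' hp' hk'
    rw [t.pr_sec w j p' hp'.2] at hk'
    rw [t.lab_sec w j p' hp'.2 hp'.1 k hk', t.lab_sec w j p hp2 hp1 k hk]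

/-- tiles -/
def TD.Til {n : ℕ} (t : TD n) (q : FreeGroup (Fin n) × Fin (n+1)) : Set t.E :=
  {e | (pr e).1 ∈ t.K ∧ (pr e).1 ∈ t.St q.2 ∧ (pr e ∈ pch t.c t.y true → lab true e = q.1) ∧
    (pr e ∈ pch t.c t.y false → lab false e = q.1 * (sw q.2)⁻¹)}

theorem TD.sec_mem {n : ℕ} (t : TD n) (q : FreeGroup (Fin n) × Fin (n+1)) (p : ℝ × ℝ)
    (hp : p ∈ t.K) (hp2 : p ∈ t.St q.2) : t.sec q.1 q.2 p ∈ t.Til q := by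
  have h := t.K_ne p hp
  have h1 := t.pr_sec q.1 q.2 p h
  refine ⟨by rw [h1]; exact hp, by rw [h1]; exact hp2, fun hk => ?_, fun hk => ?_⟩
  · rw [h1] at hk; simpa using t.lab_sec q.1 q.2 p h hp2 true hk
  · rw [h1] at hk; simpa using t.lab_sec q.1 q.2 p h hp2 false hk

theorem TD.sec_eq {n : ℕ} (t : TD n) (q : FreeGroup (Fin n) × Fin (n+1)) (e : t.E)
    (he : e ∈ t.Til q) : t.sec q.1 q.2 (pr e).1 = e := by
  have h := (pr e).2
  obtain ⟨k, hk⟩ := exists_chart t.hc (pr e)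
  have h1 := t.pr_sec q.1 q.2 (pr e).1 h
  refine lab_ext k _ _ (by rw [h1]; exact hk) h1 ?_
  rw [t.lab_sec q.1 q.2 _ h he.2.1 k hk]
  cases k
  · simpa using (he.2.2.2 hk).symm
  · simpa using (he.2.2.1 hk).symm

theorem TD.sec_cont_sub {n : ℕ} (t : TD n) (q : FreeGroup (Fin n) × Fin (n+1)) (S : Set (ℝ × ℝ))
    (hS : S ⊆ t.K ∩ t.St q.2) : ContinuousOn (t.sec q.1 q.2) S :=
  (t.sec_cont q.1 q.2).mono fun p hp => ⟨(hS hp).2, t.K_ne p (hS hp).1⟩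

theorem TD.Til_TExt {n : ℕ} (t : TD n) (q : FreeGroup (Fin n) × Fin (n+1)) : TExt (t.Til q) := by
  have hlr := t.lb_le_rb q.2
  refine TExt.of_retract (t.Til q) (t.sec q.1 q.2) (fun e => (pr e).1)
    (fun p => (max (t.lb q.2 (max (-t.H) (min t.H p.2))) (min (t.rb q.2 (max (-t.H) (min t.H p.2))) p.1),
      max (-t.H) (min t.H p.2))) ?_ (t.Q q.2) ?_ ?_ ?_ ?_ ?_
  · have := t.lb_cont q.2
    have := t.rb_cont q.2
    fun_prop
  · intro p
    have h := t.hH0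
    refine ⟨abs_le.mpr ⟨le_max_left _ _, max_le (by linarith) (min_le_left _ _)⟩, le_max_left _ _,
      max_le (hlr _) (min_le_left _ _)⟩
  · exact t.sec_cont_sub q _ (t.Q_eq q.2).le
  · intro p hp
    rw [t.Q_eq] at hp
    exact t.sec_mem q p hp.1 hp.2
  · exact (continuous_subtype_val.comp pr_cont).continuousOn
  · intro e he
    have h1 : (pr e).1 ∈ t.Q q.2 := by rw [t.Q_eq]; exact ⟨he.1, he.2.1⟩
    have h2 : max (-t.H) (min t.H (pr e).1.2) = (pr e).1.2 := by
      have := abs_le.mp h1.1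
      rw [min_eq_right this.2, max_eq_right this.1]
    beta_reduce
    rw [h2, min_eq_right h1.2.2, max_eq_right h1.2.1]
    exact t.sec_eq q e he

theorem TD.St_closed {n : ℕ} (t : TD n) (j : Fin (n+1)) : IsClosed (t.St j) := by
  have : t.St j = ⋂ i : Fin n, {p | (i.castSucc < j → t.c i ≤ p.1) ∧ (j ≤ i.castSucc → p.1 ≤ t.c i)} := by
    ext p; simp [TD.St]
  rw [this]
  refine isClosed_iInter fun i => ?_
  rcases lt_or_ge i.castSucc j with h | h
  · simp only [h, not_le.mpr h, true_imp_iff, false_imp_iff, and_true]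
    exact isClosed_le continuous_const continuous_fst
  · simp only [h, not_lt.mpr h, true_imp_iff, false_imp_iff, true_and]
    exact isClosed_le continuous_fst continuous_const

theorem TD.K_compact {n : ℕ} (t : TD n) : IsCompact t.K := by
  have h1 : IsClosed t.K := by
    have : t.K = {p : ℝ × ℝ | |p.1| ≤ t.L} ∩ ({p : ℝ × ℝ | |p.2| ≤ t.H} ∩
      ⋂ i, {p : ℝ × ℝ | t.ε ≤ |p.1 - t.c i| + |p.2 - t.y i|}) := by ext; simp [TD.K]
    rw [this]
    refine (isClosed_le (by fun_prop) (by fun_prop)).inter ((isClosed_le (by fun_prop) (by fun_prop)).inter ?_)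
    exact isClosed_iInter fun i => isClosed_le (by fun_prop) (by fun_prop)
  refine IsCompact.of_isClosed_subset (isCompact_Icc.prod isCompact_Icc) h1
    (s := Set.Icc (-t.L) t.L ×ˢ Set.Icc (-t.H) t.H) ?_
  intro p hp
  exact ⟨abs_le.mp hp.1, abs_le.mp hp.2.1⟩

theorem TD.Til_compact {n : ℕ} (t : TD n) (q : FreeGroup (Fin n) × Fin (n+1)) : IsCompact (t.Til q) := by
  have h1 : IsCompact (t.K ∩ t.St q.2) := t.K_compact.inter_right (t.St_closed _)
  have h2 : t.Til q = t.sec q.1 q.2 '' (t.K ∩ t.St q.2) := by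
    ext e
    constructor
    · intro he
      exact ⟨(pr e).1, ⟨he.1, he.2.1⟩, t.sec_eq q e he⟩
    · rintro ⟨p, hp, rfl⟩
      exact t.sec_mem q p hp.1 hp.2
  rw [h2]
  exact h1.image_of_continuousOn (t.sec_cont_sub q _ le_rfl)

theorem TD.Til_nonempty {n : ℕ} (t : TD n) (q : FreeGroup (Fin n) × Fin (n+1)) : (t.Til q).Nonempty := by
  have h : (t.lb q.2 0, (0:ℝ)) ∈ t.Q q.2 := ⟨by simpa using t.hH0.le, le_rfl, t.lb_le_rb q.2 0⟩
  rw [t.Q_eq] at h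
  exact ⟨_, t.sec_mem q _ h.1 h.2⟩

theorem TD.adj_lt {n : ℕ} (t : TD n) (w w' : FreeGroup (Fin n)) (j j' : Fin (n+1)) (hjj : j < j')
    (e : t.E) (h : e ∈ t.Til (w, j)) (h' : e ∈ t.Til (w', j')) :
    ∃ i : Fin n, j = i.castSucc ∧ j' = i.succ ∧ (pr e).1.1 = t.c i ∧
      (pr e ∈ pch t.c t.y true → w' = w) ∧ (pr e ∈ pch t.c t.y false → w' = w * FreeGroup.of i) := by
  have hx : ∀ i : Fin n, j ≤ i.castSucc → i.castSucc < j' → (pr e).1.1 = t.c i := fun i h1 h2 =>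
    le_antisymm ((h.2.1 i).2 h1) ((h'.2.1 i).1 h2)
  rcases Fin.eq_castSucc_or_eq_last j with ⟨i, rfl⟩ | hl
  · have hxi := hx i le_rfl hjj
    have hj' : j' = i.succ := by
      by_contra hne
      have hlt : i.succ < j' := lt_of_le_of_ne (Fin.castSucc_lt_iff_succ_le.mp hjj) (Ne.symm hne)
      rcases Fin.eq_castSucc_or_eq_last i.succ with ⟨i2, hi2⟩ | hl
      · have h2 := hx i2 (hi2 ▸ Fin.castSucc_lt_succ.le) (hi2 ▸ hlt)
        have h3 : i = i2 := t.hc.injective (hxi.symm.trans h2)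
        rw [← h3] at hi2
        exact absurd hi2 (Fin.castSucc_lt_succ).ne'
      · rw [hl] at hlt
        exact absurd hlt (not_lt.mpr (Fin.le_last _))
    subst hj'
    refine ⟨i, rfl, rfl, hxi, fun hk => ?_, fun hk => ?_⟩
    · exact (h'.2.2.1 hk).symm.trans (h.2.2.1 hk)
    · have h1 := (h'.2.2.2 hk).symm.trans (h.2.2.2 hk)
      simp only [sw_succ] at h1
      have h2 := congrArg (fun g => g * (sw i.castSucc * FreeGroup.of i)) h1
      simpa [mul_assoc] using h2
  · rw [hl] at hjj
    exact absurd hjj (not_lt.mpr (Fin.le_last _))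

theorem TD.adj_eq {n : ℕ} (t : TD n) (w w' : FreeGroup (Fin n)) (j : Fin (n+1))
    (e : t.E) (h : e ∈ t.Til (w, j)) (h' : e ∈ t.Til (w', j)) : w = w' := by
  obtain ⟨k, hk⟩ := exists_chart t.hc (pr e)
  cases k
  · have := (h.2.2.2 hk).symm.trans (h'.2.2.2 hk)
    exact mul_right_cancel this
  · exact (h.2.2.1 hk).symm.trans (h'.2.2.1 hk)

/-- adjacency relation -/
def tadj {n : ℕ} (q q' : FreeGroup (Fin n) × Fin (n+1)) : Prop :=
  ∃ i : Fin n, q.2 = i.castSucc ∧ q'.2 = i.succ ∧ (q'.1 = q.1 ∨ q'.1 = q.1 * FreeGroup.of i)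

theorem TD.adj {n : ℕ} (t : TD n) (q q' : FreeGroup (Fin n) × Fin (n+1)) (hne : q ≠ q')
    (h : (t.Til q ∩ t.Til q').Nonempty) : tadj q q' ∨ tadj q' q := by
  obtain ⟨e, h1, h2⟩ := h
  obtain ⟨w, j⟩ := q
  obtain ⟨w', j'⟩ := q'
  obtain ⟨k, hk⟩ := exists_chart t.hc (pr e)
  rcases lt_trichotomy j j' with hj | hj | hj
  · left
    obtain ⟨i, a1, a2, -, a3, a4⟩ := t.adj_lt w w' j j' hj e h1 h2
    refine ⟨i, a1, a2, ?_⟩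
    cases k
    · exact Or.inr (a4 hk)
    · exact Or.inl (a3 hk)
  · subst hj
    exact absurd (by rw [t.adj_eq w w' j e h1 h2]) hne
  · right
    obtain ⟨i, a1, a2, -, a3, a4⟩ := t.adj_lt w' w j' j hj e h2 h1
    refine ⟨i, a1, a2, ?_⟩
    cases k
    · exact Or.inr (a4 hk)
    · exact Or.inl (a3 hk)

theorem TD.gate_pts {n : ℕ} (t : TD n) (i : Fin n) (s : ℝ) (hs : |s| ≤ t.H) (hs2 : t.ε ≤ |s - t.y i|) :
    ((t.c i, s) : ℝ × ℝ) ∈ t.K ∧ ((t.c i, s) : ℝ × ℝ) ∈ t.St i.castSucc ∧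
      ((t.c i, s) : ℝ × ℝ) ∈ t.St i.succ := by
  have hL := t.hL i
  have hε := t.hε
  refine ⟨⟨abs_le.mpr ⟨by simp only; linarith, by simp only; linarith⟩, hs, fun l => ?_⟩,
    fun l => ⟨fun h => ?_, fun h => ?_⟩, fun l => ⟨fun h => ?_, fun h => ?_⟩⟩
  · have h0 := abs_nonneg (s - t.y l)
    rcases lt_trichotomy i l with h | h | h
    · have := t.hgap i l h
      have := neg_le_abs (t.c i - t.c l)
      simp only; linarith
    · subst h; simpa using hs2
    · have := t.hgap l i h
      have := le_abs_self (t.c i - t.c l)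
      simp only; linarith
  · exact t.hc.monotone (Fin.castSucc_lt_castSucc_iff.mp h).le
  · exact t.hc.monotone (Fin.castSucc_le_castSucc_iff.mp h)
  · exact t.hc.monotone (Fin.castSucc_lt_succ_iff.mp h)
  · exact t.hc.monotone (Fin.succ_le_castSucc_iff.mp h).le

/-- gate sets have the extension property -/
theorem TD.gate_TExt {n : ℕ} (t : TD n) (q q' : FreeGroup (Fin n) × Fin (n+1)) (h : tadj q q') :
    TExt (t.Til q ∩ t.Til q') := by
  obtain ⟨w, j⟩ := q
  obtain ⟨w', j'⟩ := q'
  obtain ⟨i, h1, h2, h3⟩ := h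
  simp only at h1 h2 h3
  subst h1 h2
  have hε := t.hε
  have hH := t.hH i
  have hlt : i.castSucc < i.succ := Fin.castSucc_lt_succ
  have hof : FreeGroup.of i ≠ (1 : FreeGroup (Fin n)) := FreeGroup.of_ne_one i
  -- common construction
  have main : ∀ a b : ℝ, a ≤ b → (∀ s ∈ Set.Icc a b, |s| ≤ t.H ∧ t.ε ≤ |s - t.y i|) →
      (∀ s ∈ Set.Icc a b, t.sec w i.castSucc (t.c i, s) ∈ t.Til (w', i.succ)) →
      (∀ e ∈ t.Til (w, i.castSucc) ∩ t.Til (w', i.succ), (pr e).1.2 ∈ Set.Icc a b) →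
      TExt (t.Til (w, i.castSucc) ∩ t.Til (w', i.succ)) := by
    intro a b hab hs hs2 he
    refine TExt.of_retract _ (t.sec w i.castSucc) (fun e => (pr e).1)
      (fun p => (t.c i, max a (min b p.2))) (by fun_prop) ({t.c i} ×ˢ Set.Icc a b) ?_ ?_ ?_ ?_ ?_
    · intro p
      exact ⟨rfl, le_max_left _ _, max_le hab (min_le_left _ _)⟩
    · refine t.sec_cont_sub (w, i.castSucc) _ ?_
      rintro ⟨x, s⟩ ⟨hx, hs'⟩
      simp only [Set.mem_singleton_iff] at hx
      subst hx
      obtain ⟨u1, u2, -⟩ := t.gate_pts i s (hs s hs').1 (hs s hs').2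
      exact ⟨u1, u2⟩
    · rintro ⟨x, s⟩ ⟨hx, hs'⟩
      simp only [Set.mem_singleton_iff] at hx
      subst hx
      obtain ⟨u1, u2, -⟩ := t.gate_pts i s (hs s hs').1 (hs s hs').2
      exact ⟨t.sec_mem (w, i.castSucc) _ u1 u2, hs2 s hs'⟩
    · exact (continuous_subtype_val.comp pr_cont).continuousOn
    · intro e hee
      have h5 := he e hee
      obtain ⟨i', a1, -, a2, -⟩ := t.adj_lt w w' _ _ hlt e hee.1 hee.2
      rw [← Fin.castSucc_injective n a1] at a2
      beta_reduce
      rw [min_eq_right h5.2, max_eq_right h5.1, ← a2]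
      exact t.sec_eq (w, i.castSucc) e hee.1
  -- charts on the gate
  have hch : ∀ s (hp : ∀ l, ((t.c i, s) : ℝ × ℝ) ≠ (t.c l, t.y l)), ∀ k : Bool,
      ((⟨(t.c i, s), hp⟩ : PX t.c t.y) ∈ pch t.c t.y k ↔ if k then t.y i < s else s < t.y i) := by
    intro s hp k
    constructor
    · intro h; exact h i rfl
    · intro h l hl
      have : i = l := t.hc.injective hl
      subst this; exact h
  have hch2 : ∀ e ∈ t.Til (w, i.castSucc) ∩ t.Til (w', i.succ), (pr e).1.1 = t.c i ∧
      (t.y i < (pr e).1.2 → w' = w) ∧ ((pr e).1.2 < t.y i → w' = w * FreeGroup.of i) := by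
    intro e hee
    obtain ⟨i', a1, -, a2, a3, a4⟩ := t.adj_lt w w' _ _ hlt e hee.1 hee.2
    rw [← Fin.castSucc_injective n a1] at a2 a4
    refine ⟨a2, fun h => a3 fun l hl => ?_, fun h => a4 fun l hl => ?_⟩
    · have : i = l := t.hc.injective (a2.symm.trans hl)
      subst this; exact h
    · have : i = l := t.hc.injective (a2.symm.trans hl)
      subst this; exact h
  rcases h3 with h3 | h3
  · subst h3
    refine main (t.y i + t.ε) t.H (by linarith) ?_ ?_ ?_
    · intro s hs
      exact ⟨abs_le.mpr ⟨by linarith [hs.1], hs.2⟩, by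
        have := le_abs_self (s - t.y i); linarith [hs.1]⟩
    · intro s hs
      have hs3 : t.ε ≤ |s - t.y i| := by have := le_abs_self (s - t.y i); linarith [hs.1]
      obtain ⟨u1, u2, u3⟩ := t.gate_pts i s (abs_le.mpr ⟨by linarith [hs.1], hs.2⟩) hs3
      have hp := t.K_ne _ u1
      have e1 := t.pr_sec w' i.castSucc _ hp
      refine ⟨by rw [e1]; exact u1, by rw [e1]; exact u3, fun hk => ?_, fun hk => ?_⟩
      · rw [e1] at hk; simpa using t.lab_sec w' i.castSucc _ hp u2 true hk
      · rw [e1, hch] at hk; simp only [Bool.false_eq_true, if_false] at hk; linarith [hs.1]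
    · intro e hee
      obtain ⟨a2, a3, a4⟩ := hch2 e hee
      have hK := hee.1.1
      have h6 := hK.2.2 i
      rw [a2, sub_self, abs_zero, zero_add] at h6
      refine ⟨?_, (abs_le.mp hK.2.1).2⟩
      by_contra h7
      push Not at h7
      have h8 : (pr e).1.2 < t.y i := by
        by_contra h9
        rw [abs_of_nonneg (by linarith)] at h6
        linarith
      have := a4 h8
      exact hof (by simpa using this.symm)
  · subst h3
    refine main (-t.H) (t.y i - t.ε) (by linarith) ?_ ?_ ?_
    · intro s hs
      exact ⟨abs_le.mpr ⟨hs.1, by linarith [hs.2]⟩, by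
        have := neg_le_abs (s - t.y i); linarith [hs.2]⟩
    · intro s hs
      have hs3 : t.ε ≤ |s - t.y i| := by have := neg_le_abs (s - t.y i); linarith [hs.2]
      obtain ⟨u1, u2, u3⟩ := t.gate_pts i s (abs_le.mpr ⟨hs.1, by linarith [hs.2]⟩) hs3
      have hp := t.K_ne _ u1
      have e1 := t.pr_sec w i.castSucc _ hp
      refine ⟨by rw [e1]; exact u1, by rw [e1]; exact u3, fun hk => ?_, fun hk => ?_⟩
      · rw [e1, hch] at hk; simp only [if_true] at hk; linarith [hs.2]
      · rw [e1] at hk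
        have := t.lab_sec w i.castSucc _ hp u2 false hk
        rw [this]; simp [sw_succ, mul_assoc]
    · intro e hee
      obtain ⟨a2, a3, a4⟩ := hch2 e hee
      have hK := hee.1.1
      have h6 := hK.2.2 i
      rw [a2, sub_self, abs_zero, zero_add] at h6
      refine ⟨(abs_le.mp hK.2.1).1, ?_⟩
      by_contra h7
      push Not at h7
      have h8 : t.y i < (pr e).1.2 := by
        by_contra h9
        rw [abs_of_nonpos (by linarith)] at h6
        linarith
      have := a3 h8
      exact hof (by simpa using this)

/-- starting strip of a word -/
def tstart {n : ℕ} (w : FreeGroup (Fin n)) : Fin (n+1) :=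
  match fl w⁻¹ with
  | none => 0
  | some (i, true) => i.castSucc
  | some (i, false) => i.succ

/-- parent tile at the start -/
def tpar0 {n : ℕ} (w : FreeGroup (Fin n)) : FreeGroup (Fin n) × Fin (n+1) :=
  match fl w⁻¹ with
  | none => (1, 0)
  | some (i, true) => (w * flet (i, true), i.succ)
  | some (i, false) => (w * flet (i, false), i.castSucc)

/-- parent tile -/
def tpar {n : ℕ} (q : FreeGroup (Fin n) × Fin (n+1)) : FreeGroup (Fin n) × Fin (n+1) :=
  if q.2 = tstart q.1 then tpar0 q.1
  else if tstart q.1 < q.2 then (q.1, ⟨q.2.1 - 1, by omega⟩)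
  else (q.1, ⟨min (q.2.1 + 1) n, by omega⟩)

/-- rank of a tile -/
def trk {n : ℕ} (q : FreeGroup (Fin n) × Fin (n+1)) : ℕ :=
  (n+1) * q.1.norm + ((q.2.1 - (tstart q.1).1) + ((tstart q.1).1 - q.2.1))

theorem tstart_one {n : ℕ} : tstart (1 : FreeGroup (Fin n)) = 0 := by
  have : fl (1 : FreeGroup (Fin n))⁻¹ = none := by rw [inv_one]; exact fl_one
  simp only [tstart, this]

theorem tpar_root {n : ℕ} : tpar ((1 : FreeGroup (Fin n)), 0) = (1, 0) := by
  have : fl (1 : FreeGroup (Fin n))⁻¹ = none := by rw [inv_one]; exact fl_one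
  simp only [tpar, tstart_one, tpar0, this, if_true]

theorem trk_lt {n : ℕ} (q : FreeGroup (Fin n) × Fin (n+1)) (hq : q ≠ (1, 0)) : trk (tpar q) < trk q := by
  obtain ⟨w, j⟩ := q
  unfold tpar
  by_cases h : j = tstart w
  · simp only [h, if_true]
    have h2 : ∃ s, fl w⁻¹ = some s := by
      rw [← Option.isSome_iff_exists, Option.isSome_iff_ne_none, ne_eq, fl_eq_none, inv_eq_one]
      rintro rfl
      rw [tstart_one] at h
      exact hq (by rw [h])
    obtain ⟨⟨i, b⟩, hs⟩ := h2
    have h3 := (norm_mul_flet w (i, b)).1 hs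
    have key : ∀ q : FreeGroup (Fin n) × Fin (n+1), q.1 = w * flet (i, b) →
        trk q < (n+1) * w.norm := by
      rintro ⟨w', j'⟩ hw
      simp only [trk]
      simp only at hw
      subst hw
      rw [← h3]
      have := j'.2
      have := (tstart (w * flet (i, b))).2
      rw [mul_add]; omega
    have h4 : (n+1) * w.norm ≤ trk (w, tstart w) := by simp [trk]
    refine lt_of_lt_of_le (key _ ?_) h4
    cases b <;> simp [tpar0, hs]
  · simp only [h, if_false]
    split_ifs with h5
    · have : (tstart w).1 < j.1 := h5
      simp only [trk]; omega
    · have h6 : j < tstart w := lt_of_le_of_ne (not_lt.mp h5) h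
      have : j.1 < (tstart w).1 := h6
      have := (tstart w).2
      simp only [trk]; omega

theorem tadj_par {n : ℕ} (q q' : FreeGroup (Fin n) × Fin (n+1)) (h : tadj q q') :
    tpar q = q' ∨ tpar q' = q := by
  obtain ⟨w, j⟩ := q
  obtain ⟨w', j'⟩ := q'
  obtain ⟨i, h1, h2, h3⟩ := h
  simp only at h1 h2 h3
  subst h1 h2
  rcases h3 with h3 | h3
  · subst h3
    rcases lt_or_ge i.castSucc (tstart w') with h | h
    · left
      unfold tpar
      rw [if_neg h.ne, if_neg (not_lt.mpr h.le)]
      congr 1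
      ext
      have := i.2
      simp
    · right
      have h' : tstart w' < i.succ := Fin.le_castSucc_iff.mp h
      unfold tpar
      rw [if_neg h'.ne', if_pos h']
      congr 1
  · rw [← flet_true] at h3
    by_cases hs : fl w⁻¹ = some (i, true)
    · left
      have : tstart w = i.castSucc := by simp [tstart, hs]
      unfold tpar
      rw [if_pos this.symm]
      simp [tpar0, hs, h3]
    · right
      have h4 := ((norm_mul_flet w (i, true)).2 hs).2
      rw [← h3] at h4
      simp only [obar, Bool.not_true] at h4
      have : tstart w' = i.succ := by simp [tstart, h4]
      unfold tpar
      rw [if_pos this.symm]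
      have h5 : flet (i, false) = (flet (i, true) : FreeGroup (Fin n))⁻¹ := by
        rw [← flet_obar]; rfl
      simp only [tpar0, h4, h5]
      simp [h3]

theorem tpar_adj {n : ℕ} (q : FreeGroup (Fin n) × Fin (n+1)) (hq : q ≠ (1, 0)) :
    tadj q (tpar q) ∨ tadj (tpar q) q := by
  obtain ⟨w, j⟩ := q
  unfold tpar
  by_cases h : j = tstart w
  · simp only [h, if_true]
    have h2 : ∃ s, fl w⁻¹ = some s := by
      rw [← Option.isSome_iff_exists, Option.isSome_iff_ne_none, ne_eq, fl_eq_none, inv_eq_one]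
      rintro rfl
      rw [tstart_one] at h
      exact hq (by rw [h])
    obtain ⟨⟨i, b⟩, hs⟩ := h2
    cases b
    · right
      refine ⟨i, by simp [tpar0, hs], by simp [tstart, hs], Or.inr ?_⟩
      have h5 : flet (i, false) = (flet (i, true) : FreeGroup (Fin n))⁻¹ := by
        rw [← flet_obar]; rfl
      simp only [tpar0, hs, h5, flet_true]
      simp
    · left
      refine ⟨i, by simp [tstart, hs], by simp [tpar0, hs], Or.inr ?_⟩
      simp only [tpar0, hs, flet_true]
  · simp only [h, if_false]
    split_ifs with h5
    · right
      have : (tstart w).1 < j.1 := h5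
      have hj := j.2
      exact ⟨⟨j.1 - 1, by omega⟩, by ext; simp, by ext; simp; omega, Or.inl rfl⟩
    · left
      have h6 : j < tstart w := lt_of_le_of_ne (not_lt.mp h5) h
      have : j.1 < (tstart w).1 := h6
      have := (tstart w).2
      exact ⟨⟨j.1, by omega⟩, by ext; simp, by ext; simp; omega, Or.inl rfl⟩

theorem tpar_word {n : ℕ} (q : FreeGroup (Fin n) × Fin (n+1)) :
    (tpar q).1 = q.1 ∨ ∃ s, (tpar q).1 = q.1 * flet s ∧ (tpar q).1.norm + 1 = q.1.norm := by
  obtain ⟨w, j⟩ := q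
  unfold tpar
  by_cases h : j = tstart w
  · simp only [h, if_true]
    rcases hs : fl w⁻¹ with _ | ⟨i, b⟩
    · left
      rw [fl_eq_none, inv_eq_one] at hs
      subst hs
      have : fl (1 : FreeGroup (Fin n))⁻¹ = none := by rw [inv_one]; exact fl_one
      simp only [tpar0, this]
    · right
      refine ⟨(i, b), ?_⟩
      have h3 := (norm_mul_flet w (i, b)).1 hs
      cases b <;> simp [tpar0, hs, h3]
  · simp only [h, if_false]
    split_ifs <;> simp

theorem tpar_norm_le {n : ℕ} (q : FreeGroup (Fin n) × Fin (n+1)) :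
    (tpar q).1.norm ≤ q.1.norm ∧ q.1.norm ≤ (tpar q).1.norm + 1 := by
  rcases tpar_word q with h | ⟨s, h1, h2⟩
  · rw [h]; omega
  · omega

theorem norm_flet {n : ℕ} (s : Fin n × Bool) : (flet s : FreeGroup (Fin n)).norm = 1 := by
  have := (norm_mul_flet 1 s).2 (by rw [inv_one, fl_one]; simp)
  simpa using this.1

theorem tpar_prefix {n : ℕ} (w' : FreeGroup (Fin n)) (q : FreeGroup (Fin n) × Fin (n+1))
    (h : (tpar q).1.norm = w'.norm + (w'⁻¹ * (tpar q).1).norm) :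
    q.1.norm = w'.norm + (w'⁻¹ * q.1).norm := by
  rcases tpar_word q with h1 | ⟨s, h1, h2⟩
  · rw [h1] at h; exact h
  · have h3 : w'⁻¹ * q.1 = w'⁻¹ * (tpar q).1 * (flet s)⁻¹ := by rw [h1]; group
    have h4 : (w'⁻¹ * q.1).norm ≤ (w'⁻¹ * (tpar q).1).norm + 1 := by
      rw [h3]
      refine (FreeGroup.norm_mul_le _ _).trans ?_
      rw [FreeGroup.norm_inv_eq, norm_flet]
    have h5 : q.1.norm ≤ w'.norm + (w'⁻¹ * q.1).norm := by
      have := FreeGroup.norm_mul_le w' (w'⁻¹ * q.1)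
      rwa [mul_inv_cancel_left] at this
    omega

theorem tpar_prefix_iter {n : ℕ} (k : ℕ) (q : FreeGroup (Fin n) × Fin (n+1)) :
    q.1.norm = (tpar^[k] q).1.norm + ((tpar^[k] q).1⁻¹ * q.1).norm := by
  induction k generalizing q with
  | zero => simp
  | succ k ih =>
    rw [Function.iterate_succ_apply]
    exact tpar_prefix _ q (ih (tpar q))

/-- ball of tiles -/
noncomputable def tball (n N : ℕ) : Finset (FreeGroup (Fin n) × Fin (n+1)) :=
  (ball_finite N).toFinset ×ˢ Finset.univ

theorem mem_tball {n N : ℕ} (q : FreeGroup (Fin n) × Fin (n+1)) : q ∈ tball n N ↔ q.1.norm ≤ N := by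
  simp [tball]

theorem TD.Til_adj_par {n : ℕ} (t : TD n) (q q' : FreeGroup (Fin n) × Fin (n+1)) (hne : q ≠ q')
    (h : (t.Til q ∩ t.Til q').Nonempty) : tpar q = q' ∨ tpar q' = q := by
  rcases t.adj q q' hne h with h | h
  · exact tadj_par _ _ h
  · exact (tadj_par _ _ h).symm

theorem TD.gate_par {n : ℕ} (t : TD n) (q : FreeGroup (Fin n) × Fin (n+1)) (hq : q ≠ (1, 0)) :
    TExt (t.Til q ∩ t.Til (tpar q)) := by
  rcases tpar_adj q hq with h | h
  · exact t.gate_TExt _ _ h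
  · rw [Set.inter_comm]; exact t.gate_TExt _ _ h

theorem TD.ball_TExt {n : ℕ} (t : TD n) (N : ℕ) : TExt (tun t.Til (tball n N)) := by
  classical
  refine tun_TExt t.Til tpar (1, 0) trk trk_lt tpar_root t.Til_adj_par t.Til_compact t.Til_nonempty
    t.Til_TExt t.gate_par _ ?_ ?_
  · simp [mem_tball]
  · intro q hq
    rw [mem_tball] at hq ⊢
    exact (tpar_norm_le q).1.trans hq

/-- fixed point theorem on a ball in the cover -/
theorem TD.ball_fixed {n : ℕ} (t : TD n) (N M : ℕ) (hNM : N ≤ M) (F : t.E → t.E)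
    (hF : Continuous F) (hFM : ∀ e ∈ tun t.Til (tball n N), F e ∈ tun t.Til (tball n M)) :
    ∃ e ∈ tun t.Til (tball n N), F e = e ∨
      ∃ q q' : FreeGroup (Fin n) × Fin (n+1), F e ∈ t.Til q ∧ e ∈ t.Til q' ∧ N < q'.1.norm ∧
        q.1.norm = q'.1.norm + (q'.1⁻¹ * q.1).norm := by
  classical
  have hpc : ∀ N, ∀ q ∈ tball n N, tpar q ∈ tball n N := by
    intro N q hq
    rw [mem_tball] at hq ⊢
    exact (tpar_norm_le q).1.trans hq
  obtain ⟨R, hR1, hR2, hR3, hR4⟩ := tun_retract t.Til tpar (1, 0) trk trk_lt t.Til_adj_par t.Til_compact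
    t.gate_par (tball n N) (by simp [mem_tball]) (hpc N) (tball n M)
    (fun q hq => by rw [mem_tball] at hq ⊢; omega) (hpc M)
  obtain ⟨e, he, hee⟩ := (t.ball_TExt N).fixedPoint (tun_compact _ _ t.Til_compact)
    (by
      obtain ⟨e, he⟩ := t.Til_nonempty (1, 0)
      exact ⟨e, Set.mem_biUnion (by simp [mem_tball]) he⟩) (fun e => R (F e))
    (hR1.comp hF.continuousOn hFM) (fun e he => hR2 _ (hFM e he))
  refine ⟨e, he, ?_⟩
  have h1 := hFM e he
  simp only [tun, Set.mem_iUnion, exists_prop] at h1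
  obtain ⟨q, hq, hFq⟩ := h1
  by_cases hqN : q ∈ tball n N
  · left
    rw [← hR3 (F e) (Set.mem_biUnion hqN hFq)]; exact hee
  · right
    obtain ⟨k, k1, k2, k3⟩ := hR4 q hq hqN
    refine ⟨q, tpar^[k] q, hFq, ?_, ?_, tpar_prefix_iter k q⟩
    · have := k3 _ hFq
      rwa [hee] at this
    · rw [mem_tball] at k1; omega

/-- sign of a chart -/
noncomputable def sgk (k : Bool) : ℝ := if k then 1 else -1

theorem sgk_sq (k : Bool) : sgk k * sgk k = 1 := by cases k <;> simp [sgk]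

theorem mem_pch {n : ℕ} {c y : Fin n → ℝ} (k : Bool) (p : PX c y) :
    p ∈ pch c y k ↔ ∀ i, p.1.1 = c i → sgk k * y i < sgk k * p.1.2 := by
  cases k <;> simp [pch, sgk]

/-- build chart points -/
noncomputable def mkch {n : ℕ} {c y : Fin n → ℝ} (k : Bool) (p : ℝ × ℝ)
    (h : ∀ i, p.1 = c i → sgk k * y i < sgk k * p.2) : pch c y k :=
  ⟨⟨p, fun i hi => by
    have h1 := h i (congrArg Prod.fst hi)
    rw [show p.2 = y i from congrArg Prod.snd hi] at h1
    exact lt_irrefl _ h1⟩, (mem_pch k _).mpr h⟩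

theorem exists_bound_y {n : ℕ} (y : Fin n → ℝ) : ∃ M : ℝ, ∀ i, |y i| < M := by
  refine ⟨(∑ i, |y i|) + 1, fun i => ?_⟩
  have := Finset.single_le_sum (f := fun i => |y i|) (fun i _ => abs_nonneg _) (Finset.mem_univ i)
  linarith

theorem pch_contractible {n : ℕ} {c y : Fin n → ℝ} (k : Bool) : ContractibleSpace (pch c y k) := by
  rw [contractible_iff_id_nullhomotopic]
  obtain ⟨M, hM⟩ := exists_bound_y y
  have hM' : ∀ i, sgk k * y i < M := fun i => by
    refine lt_of_le_of_lt ?_ (hM i)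
    cases k
    · simpa [sgk] using neg_le_abs (y i)
    · simpa [sgk] using le_abs_self (y i)
  have hs := sgk_sq k
  have key : ∀ (p : pch c y k) (x : ℝ), (x = p.1.1.1 ∨ M ≤ sgk k * p.1.1.2) → ∀ s : ℝ,
      0 ≤ s → ∀ i, x = c i → sgk k * y i < sgk k * (p.1.1.2 + sgk k * s) := by
    intro p x hx s hs0 i hi
    rw [mul_add, ← mul_assoc, hs, one_mul]
    rcases hx with hx | hx
    · have := (mem_pch k _).mp p.2 i (hx ▸ hi); linarith
    · have := hM' i; linarith
  -- push map
  let m : pch c y k → ℝ := fun p => max 0 (M - sgk k * p.1.1.2)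
  have hm0 : ∀ p, 0 ≤ m p := fun p => le_max_left _ _
  have hmc : Continuous m := by fun_prop
  let f1 : C(pch c y k, pch c y k) := ⟨fun p => mkch k (p.1.1.1, p.1.1.2 + sgk k * m p)
    (fun i hi => key p _ (Or.inl rfl) _ (hm0 p) i hi), by
      unfold mkch
      apply Continuous.subtype_mk; apply Continuous.subtype_mk; fun_prop⟩
  have hf1 : ∀ p, M ≤ sgk k * (f1 p).1.1.2 := by
    intro p
    show M ≤ sgk k * (p.1.1.2 + sgk k * m p)
    rw [mul_add, ← mul_assoc, hs, one_mul]
    have : M - sgk k * p.1.1.2 ≤ m p := le_max_right _ _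
    linarith
  have H1 : (ContinuousMap.id (pch c y k)).Homotopic f1 := by
    refine ⟨⟨⟨fun q => mkch k (q.2.1.1.1, q.2.1.1.2 + sgk k * ((q.1 : ℝ) * m q.2))
      (fun i hi => key q.2 _ (Or.inl rfl) _ (mul_nonneg q.1.2.1 (hm0 _)) i hi), ?_⟩, ?_, ?_⟩⟩
    · unfold mkch
      apply Continuous.subtype_mk; apply Continuous.subtype_mk; fun_prop
    · intro p; simp [mkch]
    · intro p; simp [mkch, f1]
  let p0 : pch c y k := mkch k (0, sgk k * M) (fun i _ => by
    simp only; rw [← mul_assoc, hs, one_mul]; exact hM' i)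
  have H2 : f1.Homotopic (ContinuousMap.const _ p0) := by
    refine ⟨⟨⟨fun q => mkch k ((1 - (q.1 : ℝ)) * (f1 q.2).1.1.1,
      (1 - (q.1 : ℝ)) * (f1 q.2).1.1.2 + q.1 * (sgk k * M)) (fun i _ => ?_), ?_⟩, ?_, ?_⟩⟩
    · have h1 := hf1 q.2
      have h2 := hM' i
      have h3 := q.1.2.1
      have h4 : (q.1 : ℝ) ≤ 1 := q.1.2.2
      simp only
      have : sgk k * ((1 - (q.1 : ℝ)) * (f1 q.2).1.1.2 + q.1 * (sgk k * M)) =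
        (1 - (q.1 : ℝ)) * (sgk k * (f1 q.2).1.1.2) + q.1 * ((sgk k * sgk k) * M) := by ring
      rw [this, hs]
      nlinarith
    · unfold mkch
      apply Continuous.subtype_mk; apply Continuous.subtype_mk; fun_prop
    · intro p
      apply Subtype.ext; apply Subtype.ext
      simp [mkch]
    · intro p
      apply Subtype.ext; apply Subtype.ext
      simp [mkch, p0]
  exact ⟨p0, H1.trans H2⟩

theorem PX_open {n : ℕ} (c y : Fin n → ℝ) : IsOpen {p : ℝ × ℝ | ∀ i, p ≠ (c i, y i)} := by
  have : {p : ℝ × ℝ | ∀ i, p ≠ (c i, y i)} = ⋂ i, {(c i, y i)}ᶜ := by ext; simp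
  rw [this]
  exact isOpen_iInter_of_finite fun i => isOpen_compl_singleton

theorem PX_lpc {n : ℕ} (c y : Fin n → ℝ) : LocallyPathConnectedSpace (PX c y) :=
  (PX_open c y).locallyPathConnectedSpace

theorem pch_lift {n : ℕ} {c y : Fin n → ℝ} (hc : StrictMono c) (k : Bool) (h : PX c y → PX c y)
    (hh : Continuous h) : ∃ F : PX c y → PE c y hc, ContinuousOn F (pch c y k) ∧
      ∀ p ∈ pch c y k, pr (F p) = h p := by
  classical
  haveI := pch_contractible (c := c) (y := y) k
  haveI := PX_lpc c y
  haveI : LocallyPathConnectedSpace (pch c y k) := (isOpen_pch c y k).locallyPathConnectedSpace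
  obtain ⟨a0⟩ : Nonempty (pch c y k) := inferInstance
  obtain ⟨k', hk'⟩ := exists_chart hc (h a0.1)
  obtain ⟨F, ⟨hF1, hF2⟩, -⟩ := (pr_covering (hc := hc)).existsUnique_continuousMap_lifts
    (⟨fun p => h p.1, by fun_prop⟩ : C(pch c y k, PX c y)) a0 (mkE hc k' (h a0.1) 1) rfl
  refine ⟨fun p => if hp : p ∈ pch c y k then F ⟨p, hp⟩ else mkE hc k' (h a0.1) 1, ?_, ?_⟩
  · rw [continuousOn_iff_continuous_domRestrict]
    convert F.continuous using 1
    funext p; simp [Set.domRestrict]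
  · intro p hp
    simp only [dif_pos hp]
    exact congrFun hF2 ⟨p, hp⟩

theorem PX_preconn {n : ℕ} {c y : Fin n → ℝ} (C : Set (ℝ × ℝ)) (hC : IsPreconnected C)
    (hX : ∀ p ∈ C, ∀ i, p ≠ (c i, y i)) : IsPreconnected {p : PX c y | p.1 ∈ C} := by
  refine (Topology.IsInducing.isPreconnected_image (f := (Subtype.val : PX c y → ℝ × ℝ)) ⟨rfl⟩).mp ?_
  convert hC
  ext p
  constructor
  · rintro ⟨q, hq, rfl⟩; exact hq
  · intro hp; exact ⟨⟨p, hX p hp⟩, hp, rfl⟩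

/-- open strips -/
def ostrip {n : ℕ} (c : Fin n → ℝ) (j : Fin (n+1)) : Set (ℝ × ℝ) :=
  {p | ∀ i : Fin n, (i.castSucc < j → c i < p.1) ∧ (j ≤ i.castSucc → p.1 < c i)}

theorem ostrip_convex {n : ℕ} (c : Fin n → ℝ) (j : Fin (n+1)) : Convex ℝ (ostrip c j) := by
  have : ostrip c j = ⋂ i : Fin n, {p : ℝ × ℝ | (i.castSucc < j → c i < p.1) ∧ (j ≤ i.castSucc → p.1 < c i)} := by
    ext p; simp [ostrip]
  rw [this]
  refine convex_iInter fun i => ?_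
  rcases lt_or_ge i.castSucc j with h | h
  · simp only [h, not_le.mpr h, true_imp_iff, false_imp_iff, and_true]
    exact convex_halfSpace_gt (LinearMap.isLinear (LinearMap.fst ℝ ℝ ℝ)) _
  · simp only [h, not_lt.mpr h, true_imp_iff, false_imp_iff, true_and]
    exact convex_halfSpace_lt (LinearMap.isLinear (LinearMap.fst ℝ ℝ ℝ)) _

theorem ostrip_ne {n : ℕ} (c : Fin n → ℝ) (j : Fin (n+1)) (p : ℝ × ℝ) (hp : p ∈ ostrip c j) (i : Fin n) :
    p.1 ≠ c i := by
  rcases lt_or_ge i.castSucc j with h | h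
  · exact ((hp i).1 h).ne'
  · exact ((hp i).2 h).ne

theorem ostrip_sidx {n : ℕ} (c : Fin n → ℝ) (hc : StrictMono c) (p : ℝ × ℝ) (hp : ∀ i, p.1 ≠ c i) :
    p ∈ ostrip c (sidx c hc p.1) := by
  intro i
  refine ⟨fun h => (sidx_spec c hc p.1 i).mpr h, fun h => ?_⟩
  refine lt_of_le_of_ne ?_ (hp i)
  by_contra h2
  exact absurd ((sidx_spec c hc p.1 i).mp (not_le.mp h2)) (not_lt.mpr h)

theorem ostrip_pch {n : ℕ} {c y : Fin n → ℝ} (j : Fin (n+1)) (p : PX c y) (hp : p.1 ∈ ostrip c j)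
    (k : Bool) : p ∈ pch c y k := fun i hi => absurd hi (ostrip_ne c j _ hp i)

/-- lifts on charts differ by a deck transformation on strips -/
theorem strip_const {n : ℕ} {c y : Fin n → ℝ} {hc : StrictMono c} (h : PX c y → PX c y)
    (ft ff : PX c y → PE c y hc)
    (ht1 : ContinuousOn ft (pch c y true)) (ht2 : ∀ p ∈ pch c y true, pr (ft p) = h p)
    (hf1 : ContinuousOn ff (pch c y false)) (hf2 : ∀ p ∈ pch c y false, pr (ff p) = h p)
    (j : Fin (n+1)) :
    ∃ s : FreeGroup (Fin n), ∀ p : PX c y, p.1 ∈ ostrip c j → ff p = dk s (ft p) := by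
  have hX : ∀ p ∈ ostrip c j, ∀ i, p ≠ (c i, y i) := fun p hp i hi =>
    ostrip_ne c j p hp i (congrArg Prod.fst hi)
  by_cases hne : ∃ p0 : PX c y, p0.1 ∈ ostrip c j
  · obtain ⟨p0, hp0⟩ := hne
    obtain ⟨s, hs⟩ := dk_trans (ft p0) (ff p0) (by
      rw [ht2 _ (ostrip_pch j p0 hp0 _), hf2 _ (ostrip_pch j p0 hp0 _)])
    refine ⟨s, ?_⟩
    have := (pr_covering (hc := hc)).eqOn_of_comp_eqOn
      (PX_preconn (c := c) (y := y) (ostrip c j) (ostrip_convex c j).isPreconnected hX)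
      (g₁ := ff) (g₂ := fun p => dk s (ft p))
      (hf1.mono fun p hp => ostrip_pch j p hp _)
      ((dk_continuous s).comp_continuousOn (ht1.mono fun p hp => ostrip_pch j p hp _))
      (fun p hp => by
        show pr (ff p) = pr (dk s (ft p))
        rw [pr_dk, ht2 _ (ostrip_pch j p hp _), hf2 _ (ostrip_pch j p hp _)]) hp0 hs
    exact this
  · exact ⟨1, fun p hp => absurd ⟨p, hp⟩ hne⟩

theorem exists_lift {n : ℕ} {c y : Fin n → ℝ} (hc : StrictMono c) (h : PX c y → PX c y)
    (hh : Continuous h) :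
    ∃ (ft ff : PX c y → PE c y hc) (s : Fin (n+1) → FreeGroup (Fin n)),
    ContinuousOn ft (pch c y true) ∧ (∀ p ∈ pch c y true, pr (ft p) = h p) ∧
    ContinuousOn ff (pch c y false) ∧ (∀ p ∈ pch c y false, pr (ff p) = h p) ∧
    s 0 = 1 ∧ ∀ j, ∀ p : PX c y, p.1 ∈ ostrip c j → ff p = dk (s j) (ft p) := by
  obtain ⟨ft, ht1, ht2⟩ := pch_lift hc true h hh
  obtain ⟨ff, hf1, hf2⟩ := pch_lift hc false h hh
  choose s hs using strip_const h ft ff ht1 ht2 hf1 hf2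
  refine ⟨ft, fun p => dk (s 0)⁻¹ (ff p), fun j => (s 0)⁻¹ * s j, ht1, ht2,
    (dk_continuous _).comp_continuousOn hf1, fun p hp => ?_, by simp, fun j p hp => ?_⟩
  · rw [pr_dk]; exact hf2 p hp
  · beta_reduce
    rw [hs j p hp, dk_mul]

/-- the full lift with its equivariance -/
theorem full_lift {n : ℕ} {c y : Fin n → ℝ} {hc : StrictMono c} (h : PX c y → PX c y)
    (ft ff : PX c y → PE c y hc) (s : Fin (n+1) → FreeGroup (Fin n))
    (ht1 : ContinuousOn ft (pch c y true)) (ht2 : ∀ p ∈ pch c y true, pr (ft p) = h p)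
    (hf1 : ContinuousOn ff (pch c y false)) (hf2 : ∀ p ∈ pch c y false, pr (ff p) = h p)
    (hs0 : s 0 = 1) (hs : ∀ j, ∀ p : PX c y, p.1 ∈ ostrip c j → ff p = dk (s j) (ft p)) :
    ∃ f : PE c y hc → PE c y hc, Continuous f ∧ (∀ e, pr (f e) = h (pr e)) ∧
      ∀ w e, f (dk w e) = dk (FreeGroup.lift (fun i : Fin n => (s i.castSucc)⁻¹ * s i.succ) w) (f e) := by
  classical
  set φ : FreeGroup (Fin n) →* FreeGroup (Fin n) :=
    FreeGroup.lift (fun i : Fin n => (s i.castSucc)⁻¹ * s i.succ) with hφ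
  have hφs : ∀ j, φ (sw j) = s j := by
    intro j
    induction j using Fin.induction with
    | zero => rw [sw_zero, map_one, hs0]
    | succ i ih => rw [sw_succ, map_mul, ih, hφ, FreeGroup.lift_apply_of]; simp
  let fk : Bool → PX c y → PE c y hc := fun k => if k then ft else ff
  have fk1 : ∀ k, ContinuousOn (fk k) (pch c y k) := by
    intro k; cases k
    · simpa [fk] using hf1
    · simpa [fk] using ht1
  have fk2 : ∀ k, ∀ p ∈ pch c y k, pr (fk k p) = h p := by
    intro k; cases k
    · simpa [fk] using hf2
    · simpa [fk] using ht2
  let G : Bool → PE c y hc → PE c y hc := fun k e => dk (φ (lab k e)) (fk k (pr e))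
  have hG : ∀ e, pr e ∈ pch c y true → pr e ∈ pch c y false → G true e = G false e := by
    intro e h1 h2
    have h3 := ostrip_sidx c hc (pr e).1 (pch_inter c y _ h1 h2)
    simp only [G, fk, if_true, Bool.false_eq_true, if_false]
    rw [hs _ _ h3, lab_change e h1 h2, ← dk_mul, map_mul, map_inv, tw, hφs]
    simp
  let f : PE c y hc → PE c y hc := fun e => if pr e ∈ pch c y true then G true e else G false e
  have hf : ∀ k e, pr e ∈ pch c y k → f e = G k e := by
    intro k e hk
    cases k
    · by_cases h1 : pr e ∈ pch c y true
      · simp only [f, if_pos h1]; exact hG e h1 hk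
      · simp only [f, if_neg h1]
    · simp only [f, if_pos hk]
  refine ⟨f, ?_, ?_, ?_⟩
  · rw [continuous_iff_continuousAt]
    intro e
    obtain ⟨k, hk⟩ := exists_chart hc (pr e)
    have hn : pr ⁻¹' (pch c y k) ∈ nhds e := ((isOpen_pch c y k).preimage pr_cont).mem_nhds hk
    have h1 : ContinuousAt (fun e' => dk (φ (lab k e)) (fk k (pr e'))) e := by
      apply (dk_continuous _).continuousAt.comp
      exact ContinuousAt.comp (f := pr) ((fk1 k).continuousAt ((isOpen_pch c y k).mem_nhds hk))
        pr_cont.continuousAt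
    refine h1.congr ?_
    filter_upwards [hn, lab_eventually k e hk] with e' he' hl
    rw [hf k e' he']
    simp only [G, hl]
  · intro e
    obtain ⟨k, hk⟩ := exists_chart hc (pr e)
    rw [hf k e hk]
    simp only [G]
    rw [pr_dk, fk2 k _ hk]
  · intro w e
    obtain ⟨k, hk⟩ := exists_chart hc (pr e)
    rw [hf k e hk, hf k (dk w e) hk]
    simp only [G]
    rw [lab_dk, pr_dk, map_mul, dk_mul]

theorem expo_of {n : ℕ} (i j : Fin n) : expo i (FreeGroup.of j) =
    Multiplicative.ofAdd (if j = i then (1:ℤ) else 0) := by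
  simp [expo]

theorem expo_sw {n : ℕ} (i : Fin n) (j : Fin (n+1)) :
    expo i (sw j) = Multiplicative.ofAdd (if i.castSucc < j then (1:ℤ) else 0) := by
  induction j using Fin.induction with
  | zero => rw [sw_zero, map_one]; simp
  | succ l ih =>
    rw [sw_succ, map_mul, ih, expo_of, ← ofAdd_add]
    congr 1
    simp only [Fin.castSucc_lt_succ_iff, Fin.castSucc_lt_castSucc_iff]
    rcases lt_trichotomy i l with h | h | h
    · simp [h, h.le, h.ne']
    · simp [h]
    · simp [h.not_gt, h.not_ge, h.ne]

open Classical in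
/-- local exponent function -/
noncomputable def psi {n : ℕ} {c y : Fin n → ℝ} {hc : StrictMono c} (i : Fin n) (k : Bool)
    (e : PE c y hc) : Multiplicative ℤ :=
  expo i (lab k e) * (if k then 1 else Multiplicative.ofAdd (if c i < (pr e).1.1 then (1:ℤ) else 0))

theorem psi_eq {n : ℕ} {c y : Fin n → ℝ} {hc : StrictMono c} (i : Fin n) (e : PE c y hc)
    (h1 : pr e ∈ pch c y true) (h2 : pr e ∈ pch c y false) : psi i true e = psi i false e := by
  simp only [psi, if_true, mul_one, Bool.false_eq_true, if_false]
  rw [lab_change e h1 h2, map_mul, map_inv, tw, expo_sw]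
  simp only [sidx_spec c hc]
  simp

open Classical in
/-- global exponent function -/
noncomputable def psiG {n : ℕ} {c y : Fin n → ℝ} {hc : StrictMono c} (i : Fin n)
    (e : PE c y hc) : Multiplicative ℤ :=
  if pr e ∈ pch c y true then psi i true e else psi i false e

theorem psiG_eq {n : ℕ} {c y : Fin n → ℝ} {hc : StrictMono c} (i : Fin n) (k : Bool) (e : PE c y hc)
    (hk : pr e ∈ pch c y k) : psiG i e = psi i k e := by
  unfold psiG
  cases k
  · by_cases h : pr e ∈ pch c y true
    · rw [if_pos h]; exact psi_eq i e h hk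
    · rw [if_neg h]
  · rw [if_pos hk]

theorem psiG_dk {n : ℕ} {c y : Fin n → ℝ} {hc : StrictMono c} (i : Fin n) (g : FreeGroup (Fin n))
    (e : PE c y hc) : psiG i (dk g e) = expo i g * psiG i e := by
  obtain ⟨k, hk⟩ := exists_chart hc (pr e)
  rw [psiG_eq i k e hk, psiG_eq i k (dk g e) hk]
  simp only [psi, lab_dk, map_mul, mul_assoc]
  rfl

theorem psiG_cont {n : ℕ} {c y : Fin n → ℝ} {hc : StrictMono c} (i : Fin n) :
    ContinuousOn (psiG i : PE c y hc → _) {e | (pr e).1.1 ≠ c i} := by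
  intro e he
  apply ContinuousAt.continuousWithinAt
  obtain ⟨k, hk⟩ := exists_chart hc (pr e)
  have hn : pr ⁻¹' (pch c y k) ∈ nhds e := ((isOpen_pch c y k).preimage pr_cont).mem_nhds hk
  have hx : ContinuousAt (fun e : PE c y hc => (pr e).1.1) e :=
    (continuous_fst.comp (continuous_subtype_val.comp pr_cont)).continuousAt
  have h1 : ∀ᶠ e' in nhds e, (c i < (pr e').1.1 ↔ c i < (pr e).1.1) := by
    rcases lt_or_gt_of_ne he with h | h
    · filter_upwards [hx.eventually (eventually_lt_nhds h)] with e' he'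
      simp only [not_lt.mpr he'.le, not_lt.mpr h.le]
    · filter_upwards [hx.eventually (eventually_gt_nhds h)] with e' he'
      simp only [he', h]
  refine (continuousAt_const (y := psiG i e)).congr ?_
  filter_upwards [hn, h1, lab_eventually k e hk] with e' a1 a2 a3
  rw [psiG_eq i k e hk, psiG_eq i k e' a1]
  simp only [psi, a2, a3]

theorem square_preconn (a b r : ℝ) (hr : 0 < r) (k : Bool) :
    IsPreconnected {p : ℝ × ℝ | (|p.1 - a| < r ∧ |p.2 - b| < r) ∧ (p.1 = a → sgk k * b < sgk k * p.2)} := by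
  have hsq : Convex ℝ {p : ℝ × ℝ | |p.1 - a| < r ∧ |p.2 - b| < r} := by
    have : {p : ℝ × ℝ | |p.1 - a| < r ∧ |p.2 - b| < r} = Set.Ioo (a-r) (a+r) ×ˢ Set.Ioo (b-r) (b+r) := by
      ext ⟨x, z⟩; simp [abs_lt]; constructor <;> rintro ⟨⟨h1, h2⟩, h3, h4⟩ <;>
        refine ⟨⟨?_, ?_⟩, ?_, ?_⟩ <;> linarith
    rw [this]
    exact (convex_Ioo _ _).prod (convex_Ioo _ _)
  have hT : Convex ℝ {p : ℝ × ℝ | sgk k * b < sgk k * p.2} :=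
    convex_halfSpace_gt (LinearMap.isLinear ((sgk k) • LinearMap.snd ℝ ℝ ℝ)) _
  have hLft : Convex ℝ {p : ℝ × ℝ | p.1 < a} :=
    convex_halfSpace_lt (LinearMap.isLinear (LinearMap.fst ℝ ℝ ℝ)) _
  have hRt : Convex ℝ {p : ℝ × ℝ | a < p.1} :=
    convex_halfSpace_gt (LinearMap.isLinear (LinearMap.fst ℝ ℝ ℝ)) _
  have hs := sgk_sq k
  have hs1 : |sgk k| = 1 := by cases k <;> simp [sgk]
  have e1 : ∀ x : ℝ, |x - a| < r → (x, b + sgk k * (r/2)) ∈ {p : ℝ × ℝ | |p.1 - a| < r ∧ |p.2 - b| < r} ∩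
      {p : ℝ × ℝ | sgk k * b < sgk k * p.2} := by
    intro x hx
    refine ⟨⟨hx, ?_⟩, ?_⟩
    · simp only [add_sub_cancel_left, abs_mul, hs1, one_mul]
      rw [abs_of_pos (by linarith)]; linarith
    · simp only [Set.mem_ofPred_eq, mul_add, ← mul_assoc, hs]; linarith
  have h2 : |a - r/2 - a| < r := by rw [abs_lt]; constructor <;> linarith
  have h3 : |a + r/2 - a| < r := by rw [abs_lt]; constructor <;> linarith
  have q1 : (a - r/2, b + sgk k * (r/2)) ∈ {p : ℝ × ℝ | |p.1 - a| < r ∧ |p.2 - b| < r} ∩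
      {p : ℝ × ℝ | p.1 < a} := ⟨(e1 _ h2).1, show a - r/2 < a by linarith⟩
  have q2 : (a + r/2, b + sgk k * (r/2)) ∈ {p : ℝ × ℝ | |p.1 - a| < r ∧ |p.2 - b| < r} ∩
      {p : ℝ × ℝ | a < p.1} := ⟨(e1 _ h3).1, show a < a + r/2 by linarith⟩
  have P1 := IsPreconnected.union (a - r/2, b + sgk k * (r/2))
    q1 (e1 _ h2)
    (hsq.inter hLft).isPreconnected (hsq.inter hT).isPreconnected
  have P2 := IsPreconnected.union (a + r/2, b + sgk k * (r/2)) (Or.inr (e1 _ h3))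
    q2 P1 (hsq.inter hRt).isPreconnected
  convert P2 using 1
  ext p
  simp only [Set.mem_union, Set.mem_inter_iff, Set.mem_ofPred_eq]
  constructor
  · rintro ⟨h4, h5⟩
    rcases lt_trichotomy p.1 a with h | h | h
    · exact Or.inl (Or.inl ⟨h4, h⟩)
    · exact Or.inl (Or.inr ⟨h4, h5 h⟩)
    · exact Or.inr ⟨h4, h⟩
  · rintro ((⟨h4, h5⟩ | ⟨h4, h5⟩) | ⟨h4, h5⟩)
    · exact ⟨h4, fun h => absurd h h5.ne⟩
    · exact ⟨h4, fun _ => h5⟩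
    · exact ⟨h4, fun h => absurd h h5.ne'⟩

theorem expo_lift {n : ℕ} {c y : Fin n → ℝ} {hc : StrictMono c} (h : PX c y → PX c y)
    (ft ff : PX c y → PE c y hc) (s : Fin (n+1) → FreeGroup (Fin n))
    (ht1 : ContinuousOn ft (pch c y true)) (ht2 : ∀ p ∈ pch c y true, pr (ft p) = h p)
    (hf1 : ContinuousOn ff (pch c y false)) (hf2 : ∀ p ∈ pch c y false, pr (ff p) = h p)
    (hs : ∀ j, ∀ p : PX c y, p.1 ∈ ostrip c j → ff p = dk (s j) (ft p))
    (i : Fin n) (r : ℝ) (hr : 0 < r) (hgap : ∀ l, l ≠ i → r ≤ |c l - c i|)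
    (hne : ∀ p : PX c y, |p.1.1 - c i| < r → |p.1.2 - y i| < r → (h p).1.1 ≠ c i) :
    expo i ((s i.castSucc)⁻¹ * s i.succ) = 1 := by
  have key : ∀ (k : Bool) (f : PX c y → PE c y hc), ContinuousOn f (pch c y k) →
      (∀ p ∈ pch c y k, pr (f p) = h p) → ∀ p q : PX c y,
      p.1 ∈ {p : ℝ × ℝ | (|p.1 - c i| < r ∧ |p.2 - y i| < r) ∧ (p.1 = c i → sgk k * y i < sgk k * p.2)} →
      q.1 ∈ {p : ℝ × ℝ | (|p.1 - c i| < r ∧ |p.2 - y i| < r) ∧ (p.1 = c i → sgk k * y i < sgk k * p.2)} →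
      psiG i (f p) = psiG i (f q) := by
    intro k f hf1 hf2 p q hp hq
    have hpre := PX_preconn (c := c) (y := y) _ (square_preconn (c i) (y i) r hr k) (by
      rintro p ⟨⟨h1, -⟩, h3⟩ l hl
      by_cases hli : l = i
      · subst hli
        have h4 := h3 (congrArg Prod.fst hl)
        rw [hl] at h4
        exact lt_irrefl _ h4
      · have := hgap l hli
        rw [hl] at h1
        exact absurd h1 (not_lt.mpr this))
    have hsub : ∀ p : PX c y, p.1 ∈ {p : ℝ × ℝ | (|p.1 - c i| < r ∧ |p.2 - y i| < r) ∧
        (p.1 = c i → sgk k * y i < sgk k * p.2)} → p ∈ pch c y k := by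
      intro p hp
      rw [mem_pch]
      intro l hl
      by_cases hli : l = i
      · subst hli; exact hp.2 hl
      · have := hgap l hli
        rw [← hl] at this
        exact absurd hp.1.1 (not_lt.mpr this)
    refine hpre.constant (f := fun p => psiG i (f p)) ?_ hp hq
    refine (psiG_cont i).comp (hf1.mono hsub) ?_
    intro p hp
    simp only [Set.mem_ofPred_eq]
    rw [hf2 p (hsub p hp)]
    exact hne p hp.1.1 hp.1.2
  have hXL : ∀ σ : ℝ, |σ| = 1/2 → ∀ l, ((c i + σ * r, y i) : ℝ × ℝ) ≠ (c l, y l) := by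
    intro σ hσ l hl
    have h1 : c i + σ * r = c l := congrArg Prod.fst hl
    have h2 : |c l - c i| = r / 2 := by
      rw [← h1, add_sub_cancel_left, abs_mul, hσ, abs_of_pos hr]; ring
    by_cases hli : l = i
    · subst hli; simp at h2; linarith
    · have := hgap l hli; linarith
  have hL1 : |(-(1/2) : ℝ)| = 1/2 := by rw [abs_neg, abs_of_pos]; norm_num
  have hR1 : |((1/2) : ℝ)| = 1/2 := by rw [abs_of_pos]; norm_num
  let pL : PX c y := ⟨_, hXL _ hL1⟩
  let pR : PX c y := ⟨_, hXL _ hR1⟩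
  have mL : ∀ k, pL.1 ∈ {p : ℝ × ℝ | (|p.1 - c i| < r ∧ |p.2 - y i| < r) ∧
      (p.1 = c i → sgk k * y i < sgk k * p.2)} := by
    intro k
    refine ⟨⟨?_, by simpa [pL] using hr⟩, fun h => ?_⟩
    · simp only [pL, add_sub_cancel_left, abs_mul, hL1, abs_of_pos hr]; linarith
    · simp only [pL] at h; linarith
  have mR : ∀ k, pR.1 ∈ {p : ℝ × ℝ | (|p.1 - c i| < r ∧ |p.2 - y i| < r) ∧
      (p.1 = c i → sgk k * y i < sgk k * p.2)} := by
    intro k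
    refine ⟨⟨?_, by simpa [pR] using hr⟩, fun h => ?_⟩
    · simp only [pR, add_sub_cancel_left, abs_mul, hR1, abs_of_pos hr]; linarith
    · simp only [pR] at h; linarith
  have gl : ∀ l, l < i → c l + r ≤ c i := by
    intro l hl
    have h1 := hgap l hl.ne
    rw [abs_of_neg (by linarith [hc hl])] at h1; linarith
  have gr : ∀ l, i < l → c i + r ≤ c l := by
    intro l hl
    have h1 := hgap l hl.ne'
    rw [abs_of_pos (by linarith [hc hl])] at h1; linarith
  have sL : pL.1 ∈ ostrip c i.castSucc := by
    intro l
    simp only [pL, Fin.castSucc_lt_castSucc_iff, Fin.castSucc_le_castSucc_iff]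
    refine ⟨fun hl => ?_, fun hl => ?_⟩
    · have := gl l hl; linarith
    · have := hc.monotone hl; linarith
  have sR : pR.1 ∈ ostrip c i.succ := by
    intro l
    simp only [pR, Fin.castSucc_lt_succ_iff, Fin.succ_le_castSucc_iff]
    refine ⟨fun hl => ?_, fun hl => ?_⟩
    · have := hc.monotone hl; linarith
    · have := gr l hl; linarith
  have k1 := key true ft ht1 ht2 pL pR (mL _) (mR _)
  have k2 := key false ff hf1 hf2 pL pR (mL _) (mR _)
  rw [hs _ pL sL, hs _ pR sR, psiG_dk, psiG_dk, k1] at k2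
  rw [map_mul, map_inv, mul_right_cancel k2]
  simp

theorem norm_inv_mul_fl {n : ℕ} (k : ℕ) (x v : FreeGroup (Fin n)) (hk : x.norm ≤ k) (hv : v ≠ 1)
    (h : fl x ≠ fl v) : (x⁻¹ * v).norm = x.norm + v.norm := by
  induction k generalizing x v with
  | zero =>
    have : x = 1 := FreeGroup.norm_eq_zero.mp (by omega)
    subst this; simp
  | succ k ih =>
    by_cases hx : x = 1
    · subst hx; simp
    obtain ⟨s, u, hsu, hn, hs, hu⟩ := exists_flet_mul x hx
    have h1 := (norm_flet_mul (obar s) v).2 (by rw [obar_obar]; rw [hs] at h; exact fun h' => h h'.symm)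
    have h2 : x⁻¹ * v = u⁻¹ * (flet (obar s) * v) := by rw [hsu, flet_obar]; group
    rw [h2, ih u (flet (obar s) * v) (by omega) ?_ (by rw [h1.2]; exact hu), h1.1, hn]
    · ring
    · intro h3; rw [h3] at h1; simp at h1

theorem fl_ne_of_norm {n : ℕ} (w x : FreeGroup (Fin n)) (hx : x ≠ 1)
    (h : (w * x).norm = w.norm + x.norm) : fl x ≠ fl w⁻¹ := by
  intro h2
  obtain ⟨s, u, hsu, hn, hs, hu⟩ := exists_flet_mul x hx
  have h3 := (norm_mul_flet w s).1 (by rw [← h2, hs])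
  have h4 := FreeGroup.norm_mul_le (w * flet s) u
  rw [mul_assoc, ← hsu] at h4
  omega

theorem TD.Til_dk {n : ℕ} (t : TD n) (g w : FreeGroup (Fin n)) (j : Fin (n+1)) (e : t.E)
    (he : e ∈ t.Til (w, j)) : dk g e ∈ t.Til (g * w, j) := by
  refine ⟨he.1, he.2.1, fun h => ?_, fun h => ?_⟩
  · rw [lab_dk, he.2.2.1 h]
  · rw [lab_dk, he.2.2.2 h, mul_assoc]

theorem TD.exists_Til {n : ℕ} (t : TD n) (e : t.E) (he : (pr e).1 ∈ t.K) : ∃ q, e ∈ t.Til q := by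
  obtain ⟨j, hj⟩ := t.K_strip (pr e).1
  have h1 := t.sec_mem (1, j) (pr e).1 he hj
  have h2 : pr (t.sec 1 j (pr e).1) = pr e := t.pr_sec 1 j (pr e).1 (pr e).2
  obtain ⟨g, hg⟩ := dk_trans _ e h2
  refine ⟨(g * 1, j), ?_⟩
  rw [hg]
  exact t.Til_dk g 1 j _ h1

theorem TD.compact_bound {n : ℕ} (t : TD n) (S : Set t.E) (hS : IsCompact S) :
    ∃ C, ∀ e ∈ S, ∀ q, e ∈ t.Til q → q.1.norm ≤ C := by
  obtain ⟨C0, hC0⟩ : ∃ C0, ∀ j : Fin (n+1), (sw j : FreeGroup (Fin n)).norm ≤ C0 := by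
    obtain ⟨C0, h⟩ := (Set.finite_range (fun j : Fin (n+1) => (sw j : FreeGroup (Fin n)).norm)).bddAbove
    exact ⟨C0, fun j => h ⟨j, rfl⟩⟩
  refine hS.induction_on (p := fun S => ∃ C, ∀ e ∈ S, ∀ q, e ∈ t.Til q → q.1.norm ≤ C) ?_ ?_ ?_ ?_
  · exact ⟨0, fun e he => absurd he (Set.notMem_empty e)⟩
  · rintro A B hAB ⟨C, hC⟩
    exact ⟨C, fun e he => hC e (hAB he)⟩
  · rintro A B ⟨C, hC⟩ ⟨C', hC'⟩
    refine ⟨max C C', fun e he q hq => ?_⟩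
    rcases he with he | he
    · exact le_max_of_le_left (hC e he q hq)
    · exact le_max_of_le_right (hC' e he q hq)
  · intro e he
    obtain ⟨k, hk⟩ := exists_chart t.hc (pr e)
    refine ⟨{e' | pr e' ∈ pch t.c t.y k ∧ lab k e' = lab k e}, mem_nhdsWithin_of_mem_nhds ?_,
      (lab k e).norm + C0, ?_⟩
    · exact Filter.inter_mem (((isOpen_pch _ _ k).preimage pr_cont).mem_nhds hk) (lab_eventually k e hk)
    · rintro e' ⟨h1, h2⟩ q hq
      cases k
      · have h3 := hq.2.2.2 h1
        have h4 : q.1 = lab false e * sw q.2 := by rw [← h2, h3]; group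
        rw [h4]
        exact (FreeGroup.norm_mul_le _ _).trans (Nat.add_le_add_left (hC0 _) _)
      · have h3 := hq.2.2.1 h1
        rw [← h3, h2]; omega

theorem TD.Til_near {n : ℕ} (t : TD n) (e : t.E) (q q' : FreeGroup (Fin n) × Fin (n+1))
    (h : e ∈ t.Til q) (h' : e ∈ t.Til q') : (q.1⁻¹ * q'.1).norm ≤ 1 := by
  by_cases hqq : q = q'
  · subst hqq; simp
  rcases t.adj q q' hqq ⟨e, h, h'⟩ with ⟨i, -, -, h3 | h3⟩ | ⟨i, -, -, h3 | h3⟩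
  · rw [h3]; simp
  · rw [h3, inv_mul_cancel_left]; simp
  · rw [h3]; simp
  · rw [h3]
    have : (q'.1 * FreeGroup.of i)⁻¹ * q'.1 = (FreeGroup.of i)⁻¹ := by group
    rw [this, FreeGroup.norm_inv_eq]; simp

theorem TD.theoremC {n : ℕ} (t : TD n) (h : PX t.c t.y → PX t.c t.y) (hh : Continuous h)
    (hK : ∀ p, (h p).1 ∈ t.K)
    (hne : ∀ i, ∃ r > 0, ∀ p : PX t.c t.y, |p.1.1 - t.c i| < r → |p.1.2 - t.y i| < r →
      (h p).1.1 ≠ t.c i) :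
    ∃ (F : t.E → t.E) (ψ : FreeGroup (Fin n) → FreeGroup (Fin n)) (e : t.E), Continuous F ∧ F e = e ∧
      (∀ e, pr (F e) = h (pr e)) ∧ (∀ w e, F (dk w e) = dk (ψ w) (F e)) ∧
      ∀ w, ψ w = w → w = 1 := by
  obtain ⟨ft, ff, s, ht1, ht2, hf1, hf2, hs0, hs⟩ := exists_lift t.hc h hh
  obtain ⟨f, fc, fp, fe⟩ := full_lift h ft ff s ht1 ht2 hf1 hf2 hs0 hs
  obtain ⟨a, N0, hinj, hbig⟩ := gt_main (FreeGroup.lift fun i => (s i.castSucc)⁻¹ * s i.succ) (by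
    intro i
    rw [FreeGroup.lift_apply_of]
    obtain ⟨r, hr, hr2⟩ := hne i
    refine expo_lift h ft ff s ht1 ht2 hf1 hf2 hs i (min r t.ε) (lt_min hr t.hε) ?_ ?_
    · intro l hl
      refine (min_le_right _ _).trans ?_
      rcases lt_or_gt_of_ne hl with h1 | h1
      · have := t.hgap l i h1
        rw [abs_of_neg (by linarith [t.hε])]; linarith [t.hε]
      · have := t.hgap i l h1
        rw [abs_of_pos (by linarith [t.hε])]; linarith [t.hε]
    · intro p h1 h2
      exact hr2 p (h1.trans_le (min_le_left _ _)) (h2.trans_le (min_le_left _ _)))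
  generalize FreeGroup.lift (fun i : Fin n => (s i.castSucc)⁻¹ * s i.succ) = φ at fe hinj hbig
  -- the bound
  have hcomp : IsCompact (⋃ j, t.Til (1, j)) := isCompact_iUnion fun j => t.Til_compact _
  obtain ⟨C, hC⟩ := t.compact_bound _ (hcomp.image fc)
  have hCF : ∀ w j e, e ∈ t.Til (w, j) → ∃ u j', u.norm ≤ C ∧ dk a (f e) ∈ t.Til (a * φ w * u, j') := by
    intro w j e he
    have h1 : dk w⁻¹ e ∈ t.Til (1, j) := by
      have := t.Til_dk w⁻¹ w j e he
      rwa [inv_mul_cancel] at this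
    obtain ⟨⟨u, j'⟩, hq⟩ := t.exists_Til (f (dk w⁻¹ e)) (by rw [fp]; exact hK _)
    refine ⟨u, j', hC _ ⟨_, Set.mem_iUnion.mpr ⟨j, h1⟩, rfl⟩ _ hq, ?_⟩
    have h2 : dk a (f e) = dk (a * φ w) (f (dk w⁻¹ e)) := by
      rw [fe, ← dk_mul, map_inv, mul_assoc, mul_inv_cancel, mul_one]
    rw [h2]
    exact t.Til_dk _ _ _ _ hq
  -- choose N
  have hfin : {w | (vt φ a w).norm ≤ C + 1}.Finite :=
    (ball_finite (n := n) (C+1)).preimage hinj.injOn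
  obtain ⟨N1, hN1⟩ := (hfin.image FreeGroup.norm).bddAbove
  set N := max N0 N1 with hN
  have hfin2 : {m | ∃ w : FreeGroup (Fin n), w.norm ≤ N ∧ m = (a * φ w).norm}.Finite := by
    refine ((ball_finite (n := n) N).image (fun w => (a * φ w).norm)).subset ?_
    rintro m ⟨w, hw, rfl⟩
    exact ⟨w, hw, rfl⟩
  obtain ⟨M1, hM1⟩ := hfin2.bddAbove
  set M := max N (M1 + C) with hM
  have hF : Continuous (fun e => dk a (f e)) := (dk_continuous a).comp fc
  obtain ⟨e, he, hcase⟩ := t.ball_fixed N M (le_max_left _ _) (fun e => dk a (f e)) hF (by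
    intro e he
    simp only [tun, Set.mem_iUnion] at he
    obtain ⟨⟨w, j⟩, hq, he⟩ := he
    rw [mem_tball] at hq
    obtain ⟨u, j', hu, h1⟩ := hCF w j e he
    simp only [tun, Set.mem_iUnion]
    refine ⟨_, ?_, h1⟩
    rw [mem_tball]
    refine (FreeGroup.norm_mul_le _ _).trans (le_max_of_le_right (Nat.add_le_add ?_ hu))
    exact hM1 ⟨w, hq, rfl⟩)
  have hfix : dk a (f e) = e := by
    rcases hcase with h1 | ⟨q, ⟨w, j⟩, h1, h2, h3, h4⟩
    · exact h1
    exfalso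
    obtain ⟨u, j', hu, h5⟩ := hCF w j e h2
    have h6 := t.Til_near _ _ _ h1 h5
    simp only at h3 h4 h6
    obtain ⟨s, hs1, hs2⟩ := hbig w (lt_of_le_of_lt (le_max_left _ _) h3)
    have hv1 : vt φ a w ≠ 1 := by rw [Ne, ← fl_eq_none, hs1]; simp
    have hvn : C + 1 < (vt φ a w).norm := by
      by_contra h7
      have := hN1 ⟨w, not_lt.mp h7, rfl⟩
      exact absurd (lt_of_le_of_lt (le_max_right N0 N1) h3) (not_lt.mpr this)
    set x := w⁻¹ * q.1 with hx
    have h7 : (x⁻¹ * vt φ a w).norm = x.norm + (vt φ a w).norm := by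
      refine norm_inv_mul_fl _ x _ le_rfl hv1 ?_
      by_cases hx1 : x = 1
      · rw [hx1, fl_one, hs1]; simp
      · rw [hs1, ← hs2]
        refine fl_ne_of_norm w x hx1 ?_
        rw [hx, mul_inv_cancel_left]; exact h4
    have h8 : x⁻¹ * vt φ a w = (q.1⁻¹ * (a * φ w * u)) * u⁻¹ := by
      rw [hx, vt]; group
    have h9 := FreeGroup.norm_mul_le (q.1⁻¹ * (a * φ w * u)) u⁻¹
    rw [← h8, FreeGroup.norm_inv_eq] at h9
    omega
  refine ⟨fun e => dk a (f e), fun w => a * φ w * a⁻¹, e, hF, hfix, fun e => fp e, ?_, ?_⟩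
  · intro w e
    simp only [fe, ← dk_mul]
    congr 1; group
  · intro w hw
    apply hinj
    have h1 : a * φ w = w * a := eq_mul_of_mul_inv_eq hw |>.trans (by rfl)
    simp only [vt, map_one, mul_assoc, h1]
    group

/-- clamp to the box -/
noncomputable def TD.cl {n : ℕ} (t : TD n) (p : ℝ × ℝ) : ℝ × ℝ :=
  (max (-t.L) (min t.L p.1), max (-t.H) (min t.H p.2))

/-- diamond norm -/
noncomputable def TD.dn {n : ℕ} (t : TD n) (i : Fin n) (p : ℝ × ℝ) : ℝ := |p.1 - t.c i| + |p.2 - t.y i|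

/-- retraction onto `K` -/
noncomputable def TD.R {n : ℕ} (t : TD n) (p : ℝ × ℝ) : ℝ × ℝ :=
  t.cl p + ∑ i, (max 1 (t.ε / t.dn i (t.cl p)) - 1) • (t.cl p - (t.c i, t.y i))

theorem TD.dn_pos {n : ℕ} (t : TD n) (i : Fin n) (p : ℝ × ℝ) (h : p ≠ (t.c i, t.y i)) : 0 < t.dn i p := by
  by_contra h2
  have h3 := abs_nonneg (p.1 - t.c i)
  have h4 := abs_nonneg (p.2 - t.y i)
  unfold TD.dn at h2
  have h5 : |p.1 - t.c i| = 0 := by linarith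
  have h6 : |p.2 - t.y i| = 0 := by linarith
  apply h
  ext
  · exact sub_eq_zero.mp (abs_eq_zero.mp h5)
  · exact sub_eq_zero.mp (abs_eq_zero.mp h6)

theorem TD.dn_uniq {n : ℕ} (t : TD n) (i j : Fin n) (p : ℝ × ℝ) (h : |p.1 - t.c i| ≤ t.ε)
    (h2 : |p.1 - t.c j| ≤ t.ε) : i = j := by
  rw [abs_le] at h h2
  rcases lt_trichotomy i j with h3 | h3 | h3
  · have := t.hgap i j h3; linarith
  · exact h3
  · have := t.hgap j i h3; linarith

theorem TD.cl_eq {n : ℕ} (t : TD n) (p : ℝ × ℝ) (i : Fin n) (h : t.dn i (t.cl p) < t.ε) : t.cl p = p := by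
  unfold TD.dn at h
  have h3 := abs_nonneg ((t.cl p).1 - t.c i)
  have h4 := abs_nonneg ((t.cl p).2 - t.y i)
  have h5 : |(t.cl p).1 - t.c i| < t.ε := by linarith
  have h6 : |(t.cl p).2 - t.y i| < t.ε := by linarith
  rw [abs_lt] at h5 h6
  have a1 := t.hL i
  have a2 := t.hH i
  unfold TD.cl at h5 h6 ⊢
  simp only at h5 h6
  ext
  · simp only
    rcases le_total t.L p.1 with h7 | h7
    · rw [min_eq_left h7] at h5 ⊢
      rcases max_cases (-t.L) t.L with ⟨h8, h9⟩ | ⟨h8, h9⟩ <;> rw [h8] at h5 <;> linarith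
    · rw [min_eq_right h7] at h5 ⊢
      rcases max_cases (-t.L) p.1 with ⟨h8, h9⟩ | ⟨h8, h9⟩
      · rw [h8] at h5; linarith
      · exact h8
  · simp only
    rcases le_total t.H p.2 with h7 | h7
    · rw [min_eq_left h7] at h6 ⊢
      rcases max_cases (-t.H) t.H with ⟨h8, h9⟩ | ⟨h8, h9⟩ <;> rw [h8] at h6 <;> linarith
    · rw [min_eq_right h7] at h6 ⊢
      rcases max_cases (-t.H) p.2 with ⟨h8, h9⟩ | ⟨h8, h9⟩
      · rw [h8] at h6; linarith
      · exact h8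

theorem TD.cl_ne {n : ℕ} (t : TD n) (p : ℝ × ℝ) (i : Fin n) (h : p ≠ (t.c i, t.y i)) :
    t.cl p ≠ (t.c i, t.y i) := by
  intro h2
  have : t.dn i (t.cl p) < t.ε := by rw [h2]; simp [TD.dn, t.hε]
  rw [t.cl_eq p i this] at h2
  exact h h2

theorem TD.R_cases {n : ℕ} (t : TD n) (p : ℝ × ℝ) (hp : ∀ i, p ≠ (t.c i, t.y i)) :
    (t.R p = t.cl p ∧ ∀ i, t.ε ≤ t.dn i (t.cl p)) ∨
    (∃ i, t.dn i p < t.ε ∧ ∃ m > 1, m * t.dn i p = t.ε ∧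
      t.R p = (t.c i + m * (p.1 - t.c i), t.y i + m * (p.2 - t.y i))) := by
  have hterm : ∀ i, t.ε ≤ t.dn i (t.cl p) → max 1 (t.ε / t.dn i (t.cl p)) - 1 = 0 := by
    intro i hi
    rw [max_eq_left, sub_self]
    exact (div_le_one (t.dn_pos i _ (t.cl_ne p i (hp i)))).mpr hi
  by_cases h : ∀ i, t.ε ≤ t.dn i (t.cl p)
  · left
    refine ⟨?_, h⟩
    unfold TD.R
    rw [Finset.sum_eq_zero, add_zero]
    intro i _
    rw [hterm i (h i), zero_smul]
  · right
    push Not at h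
    obtain ⟨i, hi⟩ := h
    have hcl := t.cl_eq p i hi
    rw [hcl] at hi
    have hpos := t.dn_pos i p (hp i)
    have hm : 1 < t.ε / t.dn i p := (one_lt_div hpos).mpr hi
    refine ⟨i, hi, t.ε / t.dn i p, hm, div_mul_cancel₀ _ hpos.ne', ?_⟩
    unfold TD.R
    rw [hcl] at hterm ⊢
    rw [Finset.sum_eq_single i, max_eq_right hm.le]
    · ext
      · simp only [Prod.fst_add, Prod.smul_fst, Prod.fst_sub, smul_eq_mul]; ring
      · simp only [Prod.snd_add, Prod.smul_snd, Prod.snd_sub, smul_eq_mul]; ring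
    · intro j _ hj
      rw [hterm j, zero_smul]
      by_contra h2
      push Not at h2
      apply hj
      apply t.dn_uniq j i p
      · unfold TD.dn at h2; linarith [abs_nonneg (p.2 - t.y j)]
      · unfold TD.dn at hi; linarith [abs_nonneg (p.2 - t.y i)]
    · simp

theorem TD.R_cont {n : ℕ} (t : TD n) : ContinuousOn t.R {p | ∀ i, p ≠ (t.c i, t.y i)} := by
  have hcl : Continuous t.cl := by unfold TD.cl; fun_prop
  unfold TD.R
  refine hcl.continuousOn.add (continuousOn_finsetSum _ fun i _ => ?_)
  refine ContinuousOn.fun_smul ?_ (hcl.sub continuous_const).continuousOn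
  refine ContinuousOn.sub (ContinuousOn.sup continuousOn_const ?_) continuousOn_const
  refine ContinuousOn.div continuousOn_const ?_ ?_
  · unfold TD.dn; fun_prop
  · intro p hp
    exact (t.dn_pos i _ (t.cl_ne p i (hp i))).ne'

theorem TD.cl_box {n : ℕ} (t : TD n) (p : ℝ × ℝ) : |(t.cl p).1| ≤ t.L ∧ |(t.cl p).2| ≤ t.H := by
  have h1 := t.hL0
  have h2 := t.hH0
  unfold TD.cl
  constructor <;> rw [abs_le] <;> simp <;> linarith

theorem TD.R_K {n : ℕ} (t : TD n) (p : ℝ × ℝ) (hp : ∀ i, p ≠ (t.c i, t.y i)) : t.R p ∈ t.K := by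
  rcases t.R_cases p hp with ⟨h1, h2⟩ | ⟨i, h1, m, hm, h2, h3⟩
  · rw [h1]
    exact ⟨(t.cl_box p).1, (t.cl_box p).2, h2⟩
  · have hd : t.dn i (t.R p) = t.ε := by
      rw [h3, ← h2]; unfold TD.dn
      simp only [add_sub_cancel_left, abs_mul, abs_of_pos (by linarith : (0:ℝ) < m)]; ring
    have b1 : |(t.R p).1 - t.c i| ≤ t.ε := by
      unfold TD.dn at hd; linarith [abs_nonneg ((t.R p).2 - t.y i)]
    have b2 : |(t.R p).2 - t.y i| ≤ t.ε := by
      unfold TD.dn at hd; linarith [abs_nonneg ((t.R p).1 - t.c i)]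
    have a1 := t.hL i
    have a2 := t.hH i
    refine ⟨?_, ?_, ?_⟩
    · rw [abs_le] at b1 ⊢; constructor <;> linarith
    · rw [abs_le] at b2 ⊢; constructor <;> linarith
    · intro j
      by_cases hj : j = i
      · rw [hj]; exact hd.ge
      · by_contra h4
        push Not at h4
        exact hj (t.dn_uniq j i (t.R p) (by linarith [abs_nonneg ((t.R p).2 - t.y j)]) b1)

theorem TD.cl_fst_lt {n : ℕ} (t : TD n) (p : ℝ × ℝ) (a : ℝ) (ha : -t.L < a) (h : p.1 < a) :
    (t.cl p).1 < a := max_lt ha (lt_of_le_of_lt (min_le_right _ _) h)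

theorem TD.lt_cl_fst {n : ℕ} (t : TD n) (p : ℝ × ℝ) (a : ℝ) (ha : a < t.L) (h : a < p.1) :
    a < (t.cl p).1 := lt_max_of_lt_right (lt_min ha h)

theorem TD.cl_snd_lt {n : ℕ} (t : TD n) (p : ℝ × ℝ) (a : ℝ) (ha : -t.H < a) (h : p.2 < a) :
    (t.cl p).2 < a := max_lt ha (lt_of_le_of_lt (min_le_right _ _) h)

theorem TD.lt_cl_snd {n : ℕ} (t : TD n) (p : ℝ × ℝ) (a : ℝ) (ha : a < t.H) (h : a < p.2) :
    a < (t.cl p).2 := lt_max_of_lt_right (lt_min ha h)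

theorem TD.R_lt {n : ℕ} (t : TD n) (p : ℝ × ℝ) (hp : ∀ i, p ≠ (t.c i, t.y i)) (i : Fin n)
    (h : p.1 < t.c i) : (t.R p).1 < t.c i := by
  have hε := t.hε
  rcases t.R_cases p hp with ⟨h1, h2⟩ | ⟨j, h1, m, hm, h2, h3⟩
  · rw [h1]; exact t.cl_fst_lt p _ (by linarith [(t.hL i).1]) h
  · rw [h3]
    unfold TD.dn at h1 h2
    have a1 := abs_nonneg (p.2 - t.y j)
    have a2 := le_abs_self (p.1 - t.c j)
    have a3 := neg_abs_le (p.1 - t.c j)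
    simp only
    rcases lt_trichotomy j i with h4 | h4 | h4
    · have := t.hgap j i h4
      nlinarith
    · subst h4; nlinarith
    · have := t.hgap i j h4
      linarith

theorem TD.lt_R {n : ℕ} (t : TD n) (p : ℝ × ℝ) (hp : ∀ i, p ≠ (t.c i, t.y i)) (i : Fin n)
    (h : t.c i < p.1) : t.c i < (t.R p).1 := by
  have hε := t.hε
  rcases t.R_cases p hp with ⟨h1, h2⟩ | ⟨j, h1, m, hm, h2, h3⟩
  · rw [h1]; exact t.lt_cl_fst p _ (by linarith [(t.hL i).2]) h
  · rw [h3]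
    unfold TD.dn at h1 h2
    have a1 := abs_nonneg (p.2 - t.y j)
    have a2 := le_abs_self (p.1 - t.c j)
    have a3 := neg_abs_le (p.1 - t.c j)
    simp only
    rcases lt_trichotomy j i with h4 | h4 | h4
    · have := t.hgap j i h4
      linarith
    · subst h4; nlinarith
    · have := t.hgap i j h4
      nlinarith

theorem TD.R_eq {n : ℕ} (t : TD n) (p : ℝ × ℝ) (hp : ∀ i, p ≠ (t.c i, t.y i)) (i : Fin n)
    (h : p.1 = t.c i) : (t.R p).1 = t.c i ∧ (p.2 < t.y i → (t.R p).2 < t.y i) ∧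
      (t.y i < p.2 → t.y i < (t.R p).2) := by
  have hε := t.hε
  rcases t.R_cases p hp with ⟨h1, h2⟩ | ⟨j, h1, m, hm, h2, h3⟩
  · rw [h1]
    refine ⟨?_, t.cl_snd_lt p _ (by linarith [(t.hH i).1]), t.lt_cl_snd p _ (by linarith [(t.hH i).2])⟩
    have := t.hL i
    unfold TD.cl
    simp only
    rw [min_eq_right (by linarith), max_eq_right (by linarith), h]
  · have : j = i := t.dn_uniq j i p (by unfold TD.dn at h1; linarith [abs_nonneg (p.2 - t.y j)])
      (by rw [h]; simp [hε.le])
    subst this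
    rw [h3, h]
    refine ⟨by simp, fun h => ?_, fun h => ?_⟩ <;> simp only <;> nlinarith

theorem TD.R_fix {n : ℕ} (t : TD n) (p : ℝ × ℝ) (hp : p ∈ t.K) : t.R p = p := by
  have hcl : t.cl p = p := by
    have h1 := abs_le.mp hp.1
    have h2 := abs_le.mp hp.2.1
    unfold TD.cl
    ext
    · simp only; rw [min_eq_right h1.2, max_eq_right h1.1]
    · simp only; rw [min_eq_right h2.2, max_eq_right h2.1]
  rcases t.R_cases p (t.K_ne p hp) with ⟨h1, h2⟩ | ⟨i, h1, -⟩
  · rw [h1, hcl]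
  · exact absurd (hp.2.2 i) (not_le.mpr h1)

theorem TD.R_bdry {n : ℕ} (t : TD n) (p : ℝ × ℝ) (hp : ∀ i, p ≠ (t.c i, t.y i)) (hne : t.R p ≠ p) :
    (∃ i, t.dn i p < t.ε ∧ t.dn i (t.R p) = t.ε) ∨ |(t.R p).1| = t.L ∨ |(t.R p).2| = t.H := by
  rcases t.R_cases p hp with ⟨h1, h2⟩ | ⟨i, h1, m, hm, h2, h3⟩
  · right
    by_contra h4
    push Not at h4
    rw [h1] at h4 hne
    have b := t.cl_box p
    have b1 := abs_lt.mp (lt_of_le_of_ne b.1 h4.1)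
    have b2 := abs_lt.mp (lt_of_le_of_ne b.2 h4.2)
    apply hne
    unfold TD.cl at b1 b2 ⊢
    simp only [lt_max_iff, max_lt_iff, lt_min_iff, min_lt_iff, lt_irrefl, false_or] at b1 b2
    ext
    · simp only; rw [min_eq_right b1.2.2.le, max_eq_right b1.1.2.le]
    · simp only; rw [min_eq_right b2.2.2.le, max_eq_right b2.1.2.le]
  · left
    refine ⟨i, h1, ?_⟩
    rw [h3, ← h2]; unfold TD.dn
    simp only [add_sub_cancel_left, abs_mul, abs_of_pos (by linarith : (0:ℝ) < m)]; ring

/-- retraction as a self map of the punctured plane -/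
noncomputable def TD.RX {n : ℕ} (t : TD n) (p : PX t.c t.y) : PX t.c t.y :=
  ⟨t.R p.1, t.K_ne _ (t.R_K p.1 p.2)⟩

theorem TD.RX_cont {n : ℕ} (t : TD n) : Continuous t.RX := by
  refine Continuous.subtype_mk ?_ _
  exact t.R_cont.comp_continuous continuous_subtype_val (fun p => p.2)

theorem TD.RX_side {n : ℕ} (t : TD n) (p : PX t.c t.y) (i : Fin n) :
    t.c i < (t.RX p).1.1 ↔ t.c i < p.1.1 := by
  refine ⟨fun h => ?_, fun h => t.lt_R p.1 p.2 i h⟩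
  by_contra h2
  rcases lt_or_eq_of_le (not_lt.mp h2) with h3 | h3
  · exact absurd h (not_lt.mpr (t.R_lt p.1 p.2 i h3).le)
  · exact absurd h (not_lt.mpr (t.R_eq p.1 p.2 i h3).1.le)

theorem TD.RX_eq {n : ℕ} (t : TD n) (p : PX t.c t.y) (i : Fin n) :
    (t.RX p).1.1 = t.c i → p.1.1 = t.c i := by
  intro h
  rcases lt_trichotomy p.1.1 (t.c i) with h1 | h1 | h1
  · exact absurd h (t.R_lt p.1 p.2 i h1).ne
  · exact h1
  · exact absurd h (t.lt_R p.1 p.2 i h1).ne'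

theorem TD.RX_pch {n : ℕ} (t : TD n) (p : PX t.c t.y) (k : Bool) (h : p ∈ pch t.c t.y k) :
    t.RX p ∈ pch t.c t.y k := by
  rw [mem_pch] at h ⊢
  intro i hi
  have h1 := t.RX_eq p i hi
  have h2 := h i h1
  have h3 := t.R_eq p.1 p.2 i h1
  cases k
  · simp only [sgk, Bool.false_eq_true, if_false, neg_mul, one_mul, neg_lt_neg_iff] at h2 ⊢
    exact h3.2.1 h2
  · simp only [sgk, if_true, one_mul] at h2 ⊢
    exact h3.2.2 h2

theorem TD.RX_tw {n : ℕ} (t : TD n) (p : PX t.c t.y) :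
    tw t.c t.hc (t.RX p).1.1 = tw t.c t.hc p.1.1 := by
  unfold tw
  congr 1
  apply sidx_unique
  intro i
  rw [t.RX_side]; first | exact (sidx_spec t.c t.hc p.1.1 i).symm | exact sidx_spec t.c t.hc p.1.1 i

open Classical in
/-- lift of the retraction -/
noncomputable def TD.Rt {n : ℕ} (t : TD n) (e : t.E) : t.E :=
  if pr e ∈ pch t.c t.y true then mkE t.hc true (t.RX (pr e)) (lab true e)
  else mkE t.hc false (t.RX (pr e)) (lab false e)

theorem TD.pr_Rt {n : ℕ} (t : TD n) (e : t.E) : pr (t.Rt e) = t.RX (pr e) := by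
  unfold TD.Rt
  split_ifs <;> rfl

theorem TD.lab_Rt {n : ℕ} (t : TD n) (e : t.E) (k : Bool) (hk : pr e ∈ pch t.c t.y k) :
    lab k (t.Rt e) = lab k e := by
  unfold TD.Rt
  by_cases h : pr e ∈ pch t.c t.y true
  · rw [if_pos h]
    cases k
    · have a1 := t.RX_pch _ _ h
      have a2 := t.RX_pch _ _ hk
      rw [lab_change _ a1 a2, lab_change _ h hk, lab_mkE _ _ _ a1, pr_mkE, t.RX_tw]
    · rw [lab_mkE _ _ _ (t.RX_pch _ _ h)]
  · rw [if_neg h]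
    cases k
    · rw [lab_mkE _ _ _ (t.RX_pch _ _ hk)]
    · exact absurd hk h

theorem TD.Rt_cont {n : ℕ} (t : TD n) : Continuous t.Rt := by
  rw [← continuousOn_univ]
  intro e _
  obtain ⟨k, hk⟩ := exists_chart t.hc (pr e)
  refine contAt_PE _ _ _ k (by rw [t.pr_Rt]; exact t.RX_pch _ _ hk) ?_ ?_
  · simp only [t.pr_Rt]
    exact (t.RX_cont.comp pr_cont).continuousWithinAt
  · rw [nhdsWithin_univ]
    filter_upwards [lab_eventually k e hk, ((isOpen_pch _ _ k).preimage pr_cont).mem_nhds hk] with e' h1 h2 h3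
    rw [t.lab_Rt _ k hk, t.lab_Rt _ k h2, h1]

theorem TD.Rt_fix {n : ℕ} (t : TD n) (e : t.E) (h : (pr e).1 ∈ t.K) : t.Rt e = e := by
  obtain ⟨k, hk⟩ := exists_chart t.hc (pr e)
  have h1 : pr (t.Rt e) = pr e := by
    rw [t.pr_Rt]; exact Subtype.ext (t.R_fix _ h)
  exact lab_ext k _ _ (by rw [h1]; exact hk) h1 (t.lab_Rt e k hk)

theorem mkE_dk {n : ℕ} {c y : Fin n → ℝ} (hc : StrictMono c) (k : Bool) (p : PX c y)
    (hp : p ∈ pch c y k) (g w : FreeGroup (Fin n)) : mkE hc k p (g * w) = dk g (mkE hc k p w) := by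
  refine lab_ext k _ _ hp rfl ?_
  rw [lab_dk, lab_mkE _ _ _ hp, lab_mkE _ _ _ hp]

/-- constancy of labels along a connected set -/
theorem lab_F_const {n : ℕ} {c y : Fin n → ℝ} {hc : StrictMono c} (F : PE c y hc → PE c y hc)
    (hF : Continuous F) (k : Bool) (S : Set (ℝ × ℝ)) (hS : IsPreconnected S)
    (h1 : ∀ p ∈ S, ∀ i, p ≠ (c i, y i))
    (h2 : ∀ p : PX c y, p.1 ∈ S → p ∈ pch c y k)
    (h3 : ∀ e : PE c y hc, (pr e).1 ∈ S → pr (F e) ∈ pch c y k) (w : FreeGroup (Fin n))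
    (p q : PX c y) (hp : p.1 ∈ S) (hq : q.1 ∈ S) :
    lab k (F (mkE hc k p w)) = lab k (F (mkE hc k q w)) := by
  refine (PX_preconn S hS h1).constant (f := fun p => lab k (F (mkE hc k p w))) ?_ hp hq
  refine (lab_continuousOn k).comp (hF.comp_continuousOn ((mkE_continuousOn hc k w).mono h2)) ?_
  intro p hp
  exact h3 _ hp

theorem sw_last_ne {n : ℕ} (hn : 0 < n) : (sw (Fin.last n) : FreeGroup (Fin n)) ≠ 1 := by
  intro h
  have h1 := expo_sw (⟨0, hn⟩ : Fin n) (Fin.last n)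
  rw [h, map_one, if_pos (Fin.castSucc_lt_last _)] at h1
  have h2 := congrArg Multiplicative.toAdd h1
  simp at h2

theorem TD.theoremD {n : ℕ} (hn : 0 < n) (t : TD n) (h1 : ℝ × ℝ → ℝ × ℝ) (h1c : Continuous h1)
    (hX : ∀ p, (∀ i, p ≠ (t.c i, t.y i)) → ∀ i, h1 p ≠ (t.c i, t.y i))
    (hdiam : ∀ i p, t.dn i p = t.ε → t.ε ≤ t.dn i (h1 p))
    (hne : ∀ i, ∃ r > 0, ∀ p : ℝ × ℝ, |p.1 - t.c i| < r → |p.2 - t.y i| < r → (h1 p).1 ≠ t.c i)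
    (M : ℝ) (hM : M < t.H)
    (hT : ∀ p : ℝ × ℝ, M < p.2 → ∀ i, t.y i < p.2 ∧ t.y i < (h1 p).2)
    (hB : ∀ p : ℝ × ℝ, p.2 < -M → ∀ i, p.2 < t.y i ∧ (h1 p).2 < t.y i)
    (hL : ∀ p : ℝ × ℝ, p.1 = -t.L → |p.2| ≤ t.H → ∀ i, (h1 p).1 < t.c i)
    (hR : ∀ p : ℝ × ℝ, p.1 = t.L → |p.2| ≤ t.H → ∀ i, t.c i < (h1 p).1)
    (hfix : ∀ z, h1 z = z → ∃ Q : ℝ × ℝ → ℝ × ℝ,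
      ContinuousOn Q (Set.Icc 0 1 ×ˢ Set.Icc 0 1) ∧
      (∀ a ∈ Set.Icc (0:ℝ) 1, ∀ b ∈ Set.Icc (0:ℝ) 1, ∀ i, Q (a, b) ≠ (t.c i, t.y i)) ∧
      (∀ b ∈ Set.Icc (0:ℝ) 1, Q (0, b) = z) ∧
      (∀ a ∈ Set.Icc (0:ℝ) 1, Q (a, 1) = h1 (Q (a, 0))) ∧
      ((∀ b ∈ Set.Icc (0:ℝ) 1, M < (Q (1, b)).2) ∨ (∀ b ∈ Set.Icc (0:ℝ) 1, (Q (1, b)).2 < -M))) :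
    False := by
  -- the map on the punctured plane
  let h : PX t.c t.y → PX t.c t.y := fun p => t.RX ⟨h1 p.1, hX p.1 p.2⟩
  have hh : Continuous h := t.RX_cont.comp (Continuous.subtype_mk (h1c.comp continuous_subtype_val) _)
  obtain ⟨F, ψ, e0, Fc, Fe0, Fpr, Fdk, hψ⟩ := t.theoremC h hh (fun p => t.R_K _ (hX p.1 p.2)) (by
    intro i
    obtain ⟨r, hr, hr2⟩ := hne i
    exact ⟨r, hr, fun p a b hc => hr2 p.1 a b (t.RX_eq _ i hc)⟩)
  -- regions
  have chT : ∀ p : PX t.c t.y, M < p.1.2 → p ∈ pch t.c t.y true := by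
    intro p hp
    rw [mem_pch]; intro i _; simp only [sgk, if_true, one_mul]; exact (hT _ hp i).1
  have chB : ∀ p : PX t.c t.y, p.1.2 < -M → p ∈ pch t.c t.y false := by
    intro p hp
    rw [mem_pch]; intro i _
    simp only [sgk, Bool.false_eq_true, if_false, neg_mul, one_mul, neg_lt_neg_iff]; exact (hB _ hp i).1
  have chT' : ∀ p : PX t.c t.y, M < p.1.2 → h p ∈ pch t.c t.y true := by
    intro p hp
    apply t.RX_pch
    rw [mem_pch]; intro i _; simp only [sgk, if_true, one_mul]; exact (hT _ hp i).2
  have chB' : ∀ p : PX t.c t.y, p.1.2 < -M → h p ∈ pch t.c t.y false := by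
    intro p hp
    apply t.RX_pch
    rw [mem_pch]; intro i _
    simp only [sgk, Bool.false_eq_true, if_false, neg_mul, one_mul, neg_lt_neg_iff]; exact (hB _ hp i).2
  have chl : ∀ (p : PX t.c t.y), (∀ i, p.1.1 < t.c i) → ∀ k, p ∈ pch t.c t.y k := by
    intro p hp k
    rw [mem_pch]; intro i hi; exact absurd hi (hp i).ne
  have chr : ∀ (p : PX t.c t.y), (∀ i, t.c i < p.1.1) → ∀ k, p ∈ pch t.c t.y k := by
    intro p hp k
    rw [mem_pch]; intro i hi; exact absurd hi (hp i).ne'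
  have twl : ∀ x : ℝ, (∀ i, x < t.c i) → tw t.c t.hc x = 1 := by
    intro x hx
    have : sidx t.c t.hc x = 0 := by
      apply sidx_unique
      intro i
      simp [(hx i).le]
    rw [tw, this, sw_zero]
  have twr : ∀ x : ℝ, (∀ i, t.c i < x) → tw t.c t.hc x = sw (Fin.last n) := by
    intro x hx
    have : sidx t.c t.hc x = Fin.last n := by
      apply sidx_unique
      intro i
      simp [hx i, Fin.castSucc_lt_last]
    rw [tw, this]
  have hε := t.hε
  have pl : ∀ p : PX t.c t.y, p.1.1 = -t.L → ∀ i, p.1.1 < t.c i := fun p hp i => by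
    rw [hp]; linarith [(t.hL i).1]
  have prr : ∀ p : PX t.c t.y, p.1.1 = t.L → ∀ i, t.c i < p.1.1 := fun p hp i => by
    rw [hp]; linarith [(t.hL i).2]
  have hl : ∀ p : PX t.c t.y, p.1.1 = -t.L → |p.1.2| ≤ t.H → ∀ i, (h p).1.1 < t.c i :=
    fun p a b i => t.R_lt _ (hX p.1 p.2) i (hL p.1 a b i)
  have hr : ∀ p : PX t.c t.y, p.1.1 = t.L → |p.1.2| ≤ t.H → ∀ i, t.c i < (h p).1.1 :=
    fun p a b i => t.lt_R _ (hX p.1 p.2) i (hR p.1 a b i)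
  -- sets
  let ST : Set (ℝ × ℝ) := {p | M < p.2}
  let SB : Set (ℝ × ℝ) := {p | p.2 < -M}
  let SL : Set (ℝ × ℝ) := {p | p.1 = -t.L ∧ |p.2| ≤ t.H}
  let SR : Set (ℝ × ℝ) := {p | p.1 = t.L ∧ |p.2| ≤ t.H}
  have cT : IsPreconnected ST :=
    (convex_halfSpace_gt (LinearMap.isLinear (LinearMap.snd ℝ ℝ ℝ)) M).isPreconnected
  have cB : IsPreconnected SB :=
    (convex_halfSpace_lt (LinearMap.isLinear (LinearMap.snd ℝ ℝ ℝ)) (-M)).isPreconnected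
  have cside : ∀ x : ℝ, IsPreconnected {p : ℝ × ℝ | p.1 = x ∧ |p.2| ≤ t.H} := by
    intro x
    have : {p : ℝ × ℝ | p.1 = x ∧ |p.2| ≤ t.H} = {x} ×ˢ Set.Icc (-t.H) t.H := by
      ext ⟨a, b⟩; simp [abs_le]
    rw [this]
    exact isPreconnected_singleton.prod isPreconnected_Icc
  -- good words
  let G : Bool → Set (ℝ × ℝ) → FreeGroup (Fin n) → Prop := fun k S w =>
    ∀ p : PX t.c t.y, p.1 ∈ S → lab k (F (mkE t.hc k p w)) = w
  have hst : ∀ k S, IsPreconnected S → (∀ p ∈ S, ∀ i, p ≠ (t.c i, t.y i)) →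
      (∀ p : PX t.c t.y, p.1 ∈ S → p ∈ pch t.c t.y k) → (∀ p : PX t.c t.y, p.1 ∈ S → h p ∈ pch t.c t.y k) →
      ∀ w (p : PX t.c t.y), p.1 ∈ S → lab k (F (mkE t.hc k p w)) = w → G k S w := by
    intro k S a1 a2 a3 a4 w p hp hw q hq
    rw [← lab_F_const F Fc k S a1 a2 a3 (fun e he => by rw [Fpr]; exact a4 _ he) w p q hp hq]
    exact hw
  have gT : ∀ w (p : PX t.c t.y), p.1 ∈ ST → lab true (F (mkE t.hc true p w)) = w → G true ST w :=
    hst true ST cT (fun p hp i hpi => (hT p hp i).1.ne' (congrArg Prod.snd hpi)) chT chT'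
  have gB : ∀ w (p : PX t.c t.y), p.1 ∈ SB → lab false (F (mkE t.hc false p w)) = w → G false SB w :=
    hst false SB cB (fun p hp i hpi => (hB p hp i).1.ne (congrArg Prod.snd hpi)) chB chB'
  have gL : ∀ w (p : PX t.c t.y), p.1 ∈ SL → lab true (F (mkE t.hc true p w)) = w → G true SL w :=
    hst true SL (cside _) (fun p hp i hpi => by
      have h5 : p.1 = t.c i := congrArg Prod.fst hpi
      have := (t.hL i).1
      rw [hp.1] at h5; linarith) (fun p hp => chl _ (pl p hp.1) _) (fun p hp => chl _ (hl p hp.1 hp.2) _)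
  have gR : ∀ w (p : PX t.c t.y), p.1 ∈ SR → lab true (F (mkE t.hc true p w)) = w → G true SR w :=
    hst true SR (cside _) (fun p hp i hpi => by
      have h5 : p.1 = t.c i := congrArg Prod.fst hpi
      have := (t.hL i).2
      rw [hp.1] at h5; linarith) (fun p hp => chr _ (prr p hp.1) _) (fun p hp => chr _ (hr p hp.1 hp.2) _)
  -- corners
  have hHa : |t.H| ≤ t.H := by rw [abs_of_pos t.hH0]
  have hHb : |-t.H| ≤ t.H := by rw [abs_neg, abs_of_pos t.hH0]
  have cornl : ∀ x : ℝ, ∀ i, ((-t.L, x) : ℝ × ℝ) ≠ (t.c i, t.y i) := fun x i hx => by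
    have h5 : -t.L = t.c i := congrArg Prod.fst hx
    linarith [(t.hL i).1]
  have cornr : ∀ x : ℝ, ∀ i, ((t.L, x) : ℝ × ℝ) ≠ (t.c i, t.y i) := fun x i hx => by
    have h5 : t.L = t.c i := congrArg Prod.fst hx
    linarith [(t.hL i).2]
  let pTL : PX t.c t.y := ⟨(-t.L, t.H), cornl _⟩
  let pBL : PX t.c t.y := ⟨(-t.L, -t.H), cornl _⟩
  let pTR : PX t.c t.y := ⟨(t.L, t.H), cornr _⟩
  let pBR : PX t.c t.y := ⟨(t.L, -t.H), cornr _⟩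
  have mTL : pTL.1 ∈ ST := hM
  have mTL' : pTL.1 ∈ SL := ⟨rfl, hHa⟩
  have mTR : pTR.1 ∈ ST := hM
  have mTR' : pTR.1 ∈ SR := ⟨rfl, hHa⟩
  have mBL : pBL.1 ∈ SB := show -t.H < -M by linarith
  have mBL' : pBL.1 ∈ SL := ⟨rfl, hHb⟩
  have mBR : pBR.1 ∈ SB := show -t.H < -M by linarith
  have mBR' : pBR.1 ∈ SR := ⟨rfl, hHb⟩
  have TL : ∀ w, G true ST w ↔ G true SL w := fun w =>
    ⟨fun g => gL w pTL mTL' (g pTL mTL), fun g => gT w pTL mTL (g pTL mTL')⟩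
  have TR : ∀ w, G true ST w ↔ G true SR w := fun w =>
    ⟨fun g => gR w pTR mTR' (g pTR mTR), fun g => gT w pTR mTR (g pTR mTR')⟩
  have eBL : ∀ w, mkE t.hc true pBL w = mkE t.hc false pBL w := by
    intro w
    have a1 := chl pBL (pl pBL rfl)
    refine lab_ext false _ _ (a1 false) rfl ?_
    rw [lab_mkE _ _ _ (a1 false), lab_change _ (a1 true) (a1 false), lab_mkE _ _ _ (a1 true), pr_mkE,
      twl _ (pl pBL rfl)]
    simp
  have eBR : ∀ w, mkE t.hc true pBR (w * sw (Fin.last n)) = mkE t.hc false pBR w := by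
    intro w
    have a1 := chr pBR (prr pBR rfl)
    refine lab_ext false _ _ (a1 false) rfl ?_
    rw [lab_mkE _ _ _ (a1 false), lab_change _ (a1 true) (a1 false), lab_mkE _ _ _ (a1 true), pr_mkE,
      twr _ (prr pBR rfl)]
    simp
  have BL : ∀ w, G false SB w ↔ G true SL w := by
    intro w
    have a2 : ∀ k, pr (F (mkE t.hc false pBL w)) ∈ pch t.c t.y k := by
      intro k; rw [Fpr]; exact chl _ (hl pBL rfl hHb) k
    have a3 : lab false (F (mkE t.hc false pBL w)) = lab true (F (mkE t.hc false pBL w)) := by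
      rw [lab_change _ (a2 true) (a2 false), Fpr, pr_mkE, twl _ (hl pBL rfl hHb)]; simp
    refine ⟨fun g => gL w pBL mBL' ?_, fun g => gB w pBL mBL ?_⟩
    · rw [eBL, ← a3]; exact g pBL mBL
    · rw [a3, ← eBL]; exact g pBL mBL'
  have BR : ∀ w, G false SB w ↔ G true SR (w * sw (Fin.last n)) := by
    intro w
    have a2 : ∀ k, pr (F (mkE t.hc false pBR w)) ∈ pch t.c t.y k := by
      intro k; rw [Fpr]; exact chr _ (hr pBR rfl hHb) k
    have a3 : lab false (F (mkE t.hc false pBR w)) * sw (Fin.last n) = lab true (F (mkE t.hc false pBR w)) := by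
      rw [lab_change _ (a2 true) (a2 false), Fpr, pr_mkE, twr _ (hr pBR rfl hHb)]; simp
    refine ⟨fun g => gR _ pBR mBR' ?_, fun g => gB w pBR mBR ?_⟩
    · rw [eBR, ← a3, g pBR mBR]
    · have := g pBR mBR'
      rw [eBR, ← a3] at this
      exact mul_right_cancel this
  -- final contradiction from a good word at the top
  have final : ∀ w, G true ST w → False := by
    intro w g
    have g2 : G true ST (w * sw (Fin.last n)) := (TR _).mpr ((BR w).mp ((BL w).mpr ((TL w).mp g)))
    have a1 := g pTL mTL
    have a2 := g2 pTL mTL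
    have a3 : w * sw (Fin.last n) = (w * sw (Fin.last n) * w⁻¹) * w := by group
    rw [a3, mkE_dk _ _ _ (chT _ mTL), Fdk, lab_dk, a1] at a2
    have a4 := hψ _ (mul_right_cancel a2)
    apply sw_last_ne hn
    have a5 : sw (Fin.last n) = w⁻¹ * (w * sw (Fin.last n) * w⁻¹) * w := by group
    rw [a5, a4]; group
  -- start from the fixed point
  have hz : h (pr e0) = pr e0 := by rw [← Fpr, Fe0]
  have hzK : (pr e0).1 ∈ t.K := by rw [← hz]; exact t.R_K _ (hX _ (pr e0).2)
  have triv : ∀ k, pr e0 ∈ pch t.c t.y k → lab k (F (mkE t.hc k (pr e0) (lab k e0))) = lab k e0 := by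
    intro k hk
    rw [mkE_lab _ _ _ hk, Fe0]
  by_cases hfz : h1 (pr e0).1 = (pr e0).1
  · obtain ⟨Q, Qc, Qx, Q0, Q1, Qe⟩ := hfix _ hfz
    have Qm : ∀ a b : unitInterval, ∀ i, Q (a.1, b.1) ≠ (t.c i, t.y i) := fun a b => Qx a.1 a.2 b.1 b.2
    let H : C(unitInterval × unitInterval, PX t.c t.y) :=
      ⟨fun x => ⟨Q (x.1.1, x.2.1), Qm x.1 x.2⟩, by
        refine Continuous.subtype_mk ?_ _
        refine Qc.comp_continuous (by fun_prop) ?_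
        intro x; exact ⟨x.1.2, x.2.2⟩⟩
    let f : C(unitInterval, t.E) := ContinuousMap.const _ e0
    have H0 : ∀ a, H (0, a) = pr (f a) := fun a => Subtype.ext (Q0 a.1 a.2)
    let Ht := pr_covering.liftHomotopy H f H0
    have Hp : ∀ x, pr (Ht x) = H x := fun x => congrFun (pr_covering.liftHomotopy_lifts H f H0) x
    have Hz : ∀ a, Ht (0, a) = e0 := fun a => pr_covering.liftHomotopy_zero H f H0 a
    have key : (fun a : unitInterval => t.Rt (Ht (a, 1))) = fun a => F (Ht (a, 0)) := by
      refine pr_covering.eq_of_comp_eq (f := pr) (t.Rt_cont.comp (Ht.continuous.comp (by fun_prop)))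
        (Fc.comp (Ht.continuous.comp (by fun_prop))) ?_ 0 ?_
      · ext1 a
        simp only [Function.comp]
        rw [t.pr_Rt, Fpr, Hp, Hp]
        simp only [h]
        congr 1
        exact Subtype.ext (Q1 a.1 a.2)
      · beta_reduce
        rw [Hz, Hz, Fe0, t.Rt_fix _ hzK]
    have key1 : t.Rt (Ht (1, 1)) = F (Ht (1, 0)) := congrFun key 1
    have labc : ∀ k, (∀ b : unitInterval, H (1, b) ∈ pch t.c t.y k) →
        lab k (F (mkE t.hc k (H (1, 0)) (lab k (Ht (1, 0))))) = lab k (Ht (1, 0)) := by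
      intro k hk
      have e1 : mkE t.hc k (H (1, 0)) (lab k (Ht (1, 0))) = Ht (1, 0) := by
        rw [← Hp, mkE_lab _ _ _ (by rw [Hp]; exact hk 0)]
      rw [e1, ← key1, t.lab_Rt _ k (by rw [Hp]; exact hk 1)]
      have hcont : Continuous (fun b : unitInterval => lab k (Ht (1, b))) := by
        refine (lab_continuousOn k).comp_continuous (Ht.continuous.comp (by fun_prop)) ?_
        intro b
        simp only [Set.mem_preimage, Hp]; exact hk b
      exact (PreconnectedSpace.constant inferInstance hcont)
    rcases Qe with Qe | Qe
    · exact final _ (gT _ (H (1, 0)) (Qe 0 (by simp)) (labc true (fun b => chT _ (Qe b.1 b.2))))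
    · exact final _ ((TL _).mpr ((BL _).mp (gB _ (H (1, 0)) (Qe 0 (by simp))
        (labc false (fun b => chB _ (Qe b.1 b.2))))))
  · have hRz : t.R (h1 (pr e0).1) = (pr e0).1 := congrArg Subtype.val hz
    rcases t.R_bdry _ (hX _ (pr e0).2) (by rw [hRz]; exact fun h => hfz h.symm) with ⟨i, a1, a2⟩ | a1 | a1
    · rw [hRz] at a2
      exact absurd (hdiam i _ a2) (not_le.mpr a1)
    · rw [hRz] at a1
      have a2 := hzK.2.1
      rcases (abs_eq t.hL0.le).mp a1 with a3 | a3
      · exact final _ ((TR _).mpr (gR _ (pr e0) ⟨a3, a2⟩ (triv true (chr _ (prr _ a3) _))))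
      · exact final _ ((TL _).mpr (gL _ (pr e0) ⟨a3, a2⟩ (triv true (chl _ (pl _ a3) _))))
    · rw [hRz] at a1
      rcases (abs_eq t.hH0.le).mp a1 with a3 | a3
      · have a4 : (pr e0).1 ∈ ST := by show M < _; rw [a3]; exact hM
        exact final _ (gT _ (pr e0) a4 (triv true (chT _ a4)))
      · have a4 : (pr e0).1 ∈ SB := by show _ < -M; rw [a3]; linarith
        exact final _ ((TL _).mpr ((BL _).mp (gB _ (pr e0) a4 (triv false (chB _ a4)))))

theorem theoremD_sorted {n : ℕ} (hn : 0 < n) (c y : Fin n → ℝ) (hc : StrictMono c)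
    (h1 : ℝ × ℝ → ℝ × ℝ) (h1c : Continuous h1)
    (hX : ∀ p, (∀ i, p ≠ (c i, y i)) → ∀ i, h1 p ≠ (c i, y i))
    (hO : ∀ i, ∃ j, j ≠ i ∧ h1 (c i, y i) = (c j, y j))
    (M : ℝ)
    (hT : ∀ p : ℝ × ℝ, M < p.2 → ∀ i, y i < p.2 ∧ y i < (h1 p).2)
    (hB : ∀ p : ℝ × ℝ, p.2 < -M → ∀ i, p.2 < y i ∧ (h1 p).2 < y i)
    (hdisp : ∀ Y : ℝ, ∃ B : ℝ, ∀ p : ℝ × ℝ, |p.2| ≤ Y → |(h1 p).1 - p.1| ≤ B)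
    (hfix : ∀ z, h1 z = z → ∃ Q : ℝ × ℝ → ℝ × ℝ,
      ContinuousOn Q (Set.Icc 0 1 ×ˢ Set.Icc 0 1) ∧
      (∀ a ∈ Set.Icc (0:ℝ) 1, ∀ b ∈ Set.Icc (0:ℝ) 1, ∀ i, Q (a, b) ≠ (c i, y i)) ∧
      (∀ b ∈ Set.Icc (0:ℝ) 1, Q (0, b) = z) ∧
      (∀ a ∈ Set.Icc (0:ℝ) 1, Q (a, 1) = h1 (Q (a, 0))) ∧
      ((∀ b ∈ Set.Icc (0:ℝ) 1, M < (Q (1, b)).2) ∨ (∀ b ∈ Set.Icc (0:ℝ) 1, (Q (1, b)).2 < -M))) :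
    False := by
  have near : ∀ i, ∃ δ > 0, ∀ p : ℝ × ℝ, |p.1 - c i| < δ → |p.2 - y i| < δ →
      δ < |(h1 p).1 - c i| := by
    intro i
    obtain ⟨j, hj, hji⟩ := hO i
    have hpos : 0 < |c j - c i| := abs_pos.2 (sub_ne_zero.2 (hc.injective.ne hj))
    have h2 := Metric.continuousAt_iff.1 (h1c.continuousAt (x := (c i, y i))) (|c j - c i| / 2) (by linarith)
    obtain ⟨d, hd, hd2⟩ := h2
    refine ⟨min d (|c j - c i| / 2), by positivity, fun p h3 h4 => ?_⟩
    have h5 : dist p (c i, y i) < d := by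
      rw [Prod.dist_eq, Real.dist_eq, Real.dist_eq]
      exact max_lt (lt_of_lt_of_le h3 (min_le_left _ _)) (lt_of_lt_of_le h4 (min_le_left _ _))
    have h6 := hd2 h5
    rw [hji, Prod.dist_eq, Real.dist_eq] at h6
    have h7 : |(h1 p).1 - c j| < |c j - c i| / 2 := lt_of_le_of_lt (le_max_left _ _) h6
    have h8 : |c j - c i| ≤ |(h1 p).1 - c j| + |(h1 p).1 - c i| := by
      rw [abs_sub_comm (h1 p).1 (c j)]
      have := abs_add_le (c j - (h1 p).1) ((h1 p).1 - c i)
      simpa using this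
    refine lt_of_le_of_lt (min_le_right _ _) (by linarith)
  choose δ hδ hδ2 using near
  have ev : ∀ᶠ ε in nhdsWithin (0:ℝ) (Set.Ioi 0), 0 < ε ∧ (∀ i, ε < δ i) ∧
      ∀ i i', i < i' → c i + 2 * ε < c i' := by
    refine Filter.Eventually.and self_mem_nhdsWithin (Filter.Eventually.and ?_ ?_)
    · rw [Filter.eventually_all]
      intro i
      exact nhdsWithin_le_nhds (eventually_lt_nhds (hδ i))
    · rw [Filter.eventually_all]
      intro i
      rw [Filter.eventually_all]
      intro i'
      by_cases h : i < i'
      · have h2 : ∀ᶠ ε in nhds (0:ℝ), ε < (c i' - c i) / 2 :=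
          eventually_lt_nhds (by have := hc h; linarith)
        filter_upwards [nhdsWithin_le_nhds h2] with ε he _
        linarith
      · exact Filter.Eventually.of_forall fun ε h3 => absurd h3 h
  obtain ⟨ε, hε, hε1, hε2⟩ := ev.exists
  have evH : ∀ᶠ H in Filter.atTop, (0:ℝ) < H ∧ M < H ∧ ∀ i, -H < y i - ε ∧ y i + ε < H := by
    refine Filter.Eventually.and (Filter.eventually_gt_atTop 0)
      (Filter.Eventually.and (Filter.eventually_gt_atTop M) ?_)
    rw [Filter.eventually_all]
    intro i
    filter_upwards [Filter.eventually_gt_atTop (ε - y i), Filter.eventually_gt_atTop (y i + ε)] with H h1 h2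
    exact ⟨by linarith, h2⟩
  obtain ⟨H, hH, hMH, hH2⟩ := evH.exists
  obtain ⟨B, hBd⟩ := hdisp H
  have evL : ∀ᶠ L in Filter.atTop, (0:ℝ) < L ∧ ∀ i, (-L < c i - ε ∧ c i + ε < L) ∧
      (-L + B < c i ∧ c i < L - B) := by
    refine Filter.Eventually.and (Filter.eventually_gt_atTop 0) ?_
    rw [Filter.eventually_all]
    intro i
    filter_upwards [Filter.eventually_gt_atTop (ε - c i), Filter.eventually_gt_atTop (c i + ε),
      Filter.eventually_gt_atTop (B - c i), Filter.eventually_gt_atTop (c i + B)] with L h1 h2 h3 h4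
    exact ⟨⟨by linarith, h2⟩, by linarith, by linarith⟩
  obtain ⟨L, hL, hL2⟩ := evL.exists
  let t : TD n := { c := c, y := y, hc := hc, ε := ε, L := L, H := H, hε := hε, hL0 := hL, hH0 := hH,
                    hgap := hε2, hL := fun i => (hL2 i).1, hH := hH2 }
  refine TD.theoremD hn t h1 h1c hX ?_ ?_ M hMH hT hB ?_ ?_ hfix
  · intro i p hp
    change |p.1 - c i| + |p.2 - y i| = ε at hp
    change ε ≤ |(h1 p).1 - c i| + |(h1 p).2 - y i|
    have ha := abs_nonneg (p.1 - c i)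
    have hb := abs_nonneg (p.2 - y i)
    have h3 := hδ2 i p (by linarith [hε1 i]) (by linarith [hε1 i])
    have := abs_nonneg ((h1 p).2 - y i)
    linarith [hε1 i]
  · intro i
    refine ⟨δ i, hδ i, fun p ha hb h3 => ?_⟩
    have h4 := hδ2 i p ha hb
    change (h1 p).1 = c i at h3
    rw [h3, sub_self, abs_zero] at h4
    linarith [hδ i]
  · intro p hp hp2 i
    change p.1 = -L at hp
    have h3 := abs_le.1 (hBd p hp2)
    change (h1 p).1 < c i
    linarith [(hL2 i).2.1, h3.2]
  · intro p hp hp2 i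
    change p.1 = L at hp
    have h3 := abs_le.1 (hBd p hp2)
    change c i < (h1 p).1
    linarith [(hL2 i).2.2, h3.1]

/-- shear -/
def shr (κ : ℝ) (p : ℝ × ℝ) : ℝ × ℝ := (p.1 + κ * p.2, p.2)

theorem shr_cont (κ : ℝ) : Continuous (shr κ) := by unfold shr; fun_prop

theorem shr_inv (κ : ℝ) (p : ℝ × ℝ) : shr (-κ) (shr κ p) = p := by
  unfold shr; ext <;> simp

theorem shr_inv' (κ : ℝ) (p : ℝ × ℝ) : shr κ (shr (-κ) p) = p := by
  unfold shr; ext <;> simp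

theorem exists_shear (O : Finset (ℝ × ℝ)) :
    ∃ κ : ℝ, ∀ o ∈ O, ∀ o' ∈ O, (shr κ o).1 = (shr κ o').1 → o = o' := by
  classical
  obtain ⟨κ, hκ⟩ := Infinite.exists_notMem_finset
    ((O ×ˢ O).image fun q => (q.1.1 - q.2.1) / (q.2.2 - q.1.2))
  refine ⟨κ, fun o ho o' ho' h => ?_⟩
  simp only [shr] at h
  by_cases h2 : o.2 = o'.2
  · rw [h2] at h
    exact Prod.ext (by linarith) h2
  · exfalso
    apply hκ
    rw [Finset.mem_image]
    refine ⟨(o, o'), Finset.mem_product.2 ⟨ho, ho'⟩, ?_⟩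
    have : o'.2 - o.2 ≠ 0 := fun h3 => h2 (by linarith)
    rw [div_eq_iff this]
    dsimp only
    linarith

theorem theoremD_gen (O : Finset (ℝ × ℝ)) (hOne : O.Nonempty)
    (h1 : ℝ × ℝ → ℝ × ℝ) (h1c : Continuous h1)
    (hX : ∀ p, p ∉ O → h1 p ∉ O)
    (hO : ∀ p ∈ O, h1 p ∈ O ∧ h1 p ≠ p)
    (M : ℝ)
    (hT : ∀ p : ℝ × ℝ, M < p.2 → ∀ o ∈ O, o.2 < p.2 ∧ o.2 < (h1 p).2)
    (hB : ∀ p : ℝ × ℝ, p.2 < -M → ∀ o ∈ O, p.2 < o.2 ∧ (h1 p).2 < o.2)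
    (hdisp : ∀ Y : ℝ, ∃ B : ℝ, ∀ p : ℝ × ℝ, |p.2| ≤ Y →
      |(h1 p).1 - p.1| ≤ B ∧ |(h1 p).2 - p.2| ≤ B)
    (hfix : ∀ z, h1 z = z → ∃ Q : ℝ × ℝ → ℝ × ℝ,
      ContinuousOn Q (Set.Icc 0 1 ×ˢ Set.Icc 0 1) ∧
      (∀ a ∈ Set.Icc (0:ℝ) 1, ∀ b ∈ Set.Icc (0:ℝ) 1, Q (a, b) ∉ O) ∧
      (∀ b ∈ Set.Icc (0:ℝ) 1, Q (0, b) = z) ∧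
      (∀ a ∈ Set.Icc (0:ℝ) 1, Q (a, 1) = h1 (Q (a, 0))) ∧
      ((∀ b ∈ Set.Icc (0:ℝ) 1, M < (Q (1, b)).2) ∨ (∀ b ∈ Set.Icc (0:ℝ) 1, (Q (1, b)).2 < -M))) :
    False := by
  classical
  obtain ⟨κ, hκ⟩ := exists_shear O
  let X : Finset ℝ := O.image fun o => (shr κ o).1
  have hXne : X.Nonempty := hOne.image _
  let c : Fin X.card → ℝ := fun i => X.orderEmbOfFin rfl i
  have hc : StrictMono c := (X.orderEmbOfFin rfl).strictMono
  have hcO : ∀ i, ∃ o ∈ O, (shr κ o).1 = c i := by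
    intro i
    exact Finset.mem_image.1 (X.orderEmbOfFin_mem rfl i)
  choose o hoO hoc using hcO
  have hso : ∀ i, shr κ (o i) = (c i, (o i).2) := fun i => Prod.ext (hoc i) rfl
  have hall : ∀ p ∈ O, ∃ i, p = o i := by
    intro p hp
    have : (shr κ p).1 ∈ Set.range c := by
      have h2 : Set.range (X.orderEmbOfFin rfl) = X := X.range_orderEmbOfFin rfl
      change _ ∈ Set.range (X.orderEmbOfFin rfl)
      rw [h2]
      exact Finset.mem_coe.2 (Finset.mem_image_of_mem _ hp)
    obtain ⟨i, hi⟩ := this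
    exact ⟨i, hκ _ hp _ (hoO i) (by rw [hoc, hi])⟩
  have hmem : ∀ p : ℝ × ℝ, shr (-κ) p ∉ O ↔ ∀ i, p ≠ (c i, (o i).2) := by
    intro p
    constructor
    · intro h i hi
      apply h
      rw [hi, ← hso, shr_inv]
      exact hoO i
    · intro h hp
      obtain ⟨i, hi⟩ := hall _ hp
      apply h i
      rw [← hso, ← hi, shr_inv']
  have hmem' : ∀ p : ℝ × ℝ, p ∉ O ↔ ∀ i, shr κ p ≠ (c i, (o i).2) := by
    intro p
    rw [← hmem, shr_inv]
  refine theoremD_sorted (Finset.card_pos.2 hXne) c (fun i => (o i).2) hc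
    (fun p => shr κ (h1 (shr (-κ) p)))
    ((shr_cont _).comp (h1c.comp (shr_cont _))) ?_ ?_ M ?_ ?_ ?_ ?_
  · intro p hp
    exact (hmem' _).1 (hX _ ((hmem p).2 hp))
  · intro i
    beta_reduce
    rw [← hso, shr_inv]
    obtain ⟨h2, h3⟩ := hO _ (hoO i)
    obtain ⟨j, hj⟩ := hall _ h2
    refine ⟨j, ?_, ?_⟩
    · rintro rfl
      exact h3 hj
    · rw [hj, hso]
  · intro p hp i
    exact hT (shr (-κ) p) hp _ (hoO i)
  · intro p hp i
    exact hB (shr (-κ) p) hp _ (hoO i)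
  · intro Y
    obtain ⟨B, hB2⟩ := hdisp Y
    refine ⟨B + |κ| * B, fun p hp => ?_⟩
    obtain ⟨h2, h3⟩ := hB2 (shr (-κ) p) hp
    set q := h1 (shr (-κ) p) with hq
    have h4 : (shr κ q).1 - p.1 = (q.1 - (shr (-κ) p).1) + κ * (q.2 - (shr (-κ) p).2) := by
      simp only [shr]; ring
    beta_reduce
    rw [h4]
    refine (abs_add_le _ _).trans (add_le_add h2 ?_)
    rw [abs_mul]
    exact mul_le_mul_of_nonneg_left h3 (abs_nonneg _)
  · intro z hz
    beta_reduce at hz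
    have hz' : h1 (shr (-κ) z) = shr (-κ) z := by
      conv_rhs => rw [← hz]
      rw [shr_inv]
    obtain ⟨Q, Qc, QO, Q0, Q1, Qe⟩ := hfix _ hz'
    refine ⟨fun x => shr κ (Q x), (shr_cont κ).comp_continuousOn Qc, ?_, ?_, ?_, Qe⟩
    · intro a ha b hb
      exact (hmem' _).1 (QO a ha b hb)
    · intro b hb
      beta_reduce
      rw [Q0 b hb, shr_inv']
    · intro a ha
      beta_reduce
      rw [Q1 a ha, shr_inv]

theorem comm_int (f : ℝ × ℝ → ℝ × ℝ)
    (hcomm : ∀ p : ℝ × ℝ, f (p.1 + 1, p.2) = ((f p).1 + 1, (f p).2)) (n : ℤ) (p : ℝ × ℝ) :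
    f (p.1 + n, p.2) = ((f p).1 + n, (f p).2) := by
  induction n using Int.induction_on generalizing p with
  | zero => simp
  | succ i ih =>
    have h1 := hcomm (p.1 + (i:ℤ), p.2)
    rw [ih p] at h1
    push_cast at h1 ⊢
    rw [← add_assoc, ← add_assoc]
    exact h1
  | pred i ih =>
    have h1 := hcomm (p.1 + ((-(i:ℤ) - 1 : ℤ) : ℝ), p.2)
    have h2 : (p.1 + ((-(i:ℤ) - 1 : ℤ) : ℝ) + 1, p.2) = (p.1 + ((-(i:ℤ) : ℤ) : ℝ), p.2) := by
      push_cast; ext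
      · simp; try ring
      · rfl
    dsimp only at h1
    rw [h2, ih p] at h1
    have h3 := congrArg Prod.fst h1
    have h4 := congrArg Prod.snd h1
    dsimp only at h3 h4
    refine Prod.ext ?_ h4.symm
    push_cast at h3 ⊢
    linarith

theorem comm_symm (gt : (ℝ × ℝ) ≃ (ℝ × ℝ))
    (hcomm : ∀ p : ℝ × ℝ, gt (p.1 + 1, p.2) = ((gt p).1 + 1, (gt p).2)) (p : ℝ × ℝ) :
    gt.symm (p.1 + 1, p.2) = ((gt.symm p).1 + 1, (gt.symm p).2) := by
  rw [Equiv.symm_apply_eq, hcomm, Equiv.apply_symm_apply]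

theorem periodic_compact (P : ℝ → ℝ × ℝ → Prop) (S : Set (ℝ × ℝ)) (Y : ℝ)
    (mono : ∀ c c' z, c ≤ c' → P c' z → P c z)
    (transl : ∀ c z (n : ℤ), P c z → P c (z.1 + n, z.2))
    (Sper : ∀ z ∈ S, ∀ n : ℤ, ((z.1 + n, z.2) : ℝ × ℝ) ∈ S)
    (Scl : IsClosed S) (SY : ∀ z ∈ S, |z.2| ≤ Y)
    (loc : ∀ z ∈ S, ∃ c > 0, ∃ U ∈ nhds z, ∀ z' ∈ U, z' ∈ S → P c z') :
    ∃ c > 0, ∀ z ∈ S, P c z := by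
  have hcpt : IsCompact (S ∩ (Set.Icc (0:ℝ) 1 ×ˢ Set.Icc (-Y) Y)) :=
    (isCompact_Icc.prod isCompact_Icc).inter_left Scl
  have main : ∃ c > 0, ∀ z ∈ S ∩ (Set.Icc (0:ℝ) 1 ×ˢ Set.Icc (-Y) Y), P c z := by
    refine hcpt.induction_on (p := fun A => ∃ c > 0, ∀ z ∈ A, P c z) ⟨1, one_pos, by simp⟩ ?_ ?_ ?_
    · rintro s t hst ⟨c, hc, h⟩
      exact ⟨c, hc, fun z hz => h z (hst hz)⟩
    · rintro s t ⟨c, hc, h⟩ ⟨c', hc', h'⟩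
      refine ⟨min c c', lt_min hc hc', fun z hz => ?_⟩
      rcases hz with hz | hz
      · exact mono _ _ _ (min_le_left _ _) (h z hz)
      · exact mono _ _ _ (min_le_right _ _) (h' z hz)
    · intro z hz
      obtain ⟨c, hc, U, hU, h⟩ := loc z hz.1
      exact ⟨U ∩ (S ∩ (Set.Icc (0:ℝ) 1 ×ˢ Set.Icc (-Y) Y)),
        Filter.inter_mem (mem_nhdsWithin_of_mem_nhds hU) self_mem_nhdsWithin,
        c, hc, fun z' hz' => h z' hz'.1 hz'.2.1⟩
  obtain ⟨c, hc, h⟩ := main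
  refine ⟨c, hc, fun z hz => ?_⟩
  have h2 : ((Int.fract z.1, z.2) : ℝ × ℝ) ∈ S := by
    have := Sper z hz (-⌊z.1⌋)
    have e : Int.fract z.1 = z.1 + ((-⌊z.1⌋ : ℤ) : ℝ) := by rw [Int.fract]; push_cast; ring
    rw [e]; exact this
  have h3 := h _ ⟨h2, ⟨Int.fract_nonneg _, (Int.fract_lt_one _).le⟩, abs_le.1 (SY z hz)⟩
  have h4 := transl _ _ ⌊z.1⌋ h3
  dsimp only at h4
  rw [Int.fract_add_floor] at h4
  exact h4

theorem disp_bdd (f : ℝ × ℝ → ℝ × ℝ) (hf : Continuous f)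
    (hcomm : ∀ p : ℝ × ℝ, f (p.1 + 1, p.2) = ((f p).1 + 1, (f p).2)) (Y : ℝ) :
    ∃ B : ℝ, ∀ p : ℝ × ℝ, |p.2| ≤ Y → |(f p).1 - p.1| ≤ B ∧ |(f p).2 - p.2| ≤ B := by
  have hcpt : IsCompact (Set.Icc (0:ℝ) 1 ×ˢ Set.Icc (-Y) Y) := isCompact_Icc.prod isCompact_Icc
  obtain ⟨B, hB⟩ := hcpt.exists_bound_of_continuousOn (f := fun p => f p - p) (by fun_prop)
  refine ⟨B, fun p hp => ?_⟩
  have h3 := hB (Int.fract p.1, p.2) ⟨⟨Int.fract_nonneg _, (Int.fract_lt_one _).le⟩, abs_le.1 hp⟩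
  have h4 := comm_int f hcomm ⌊p.1⌋ (Int.fract p.1, p.2)
  dsimp only at h4
  rw [Int.fract_add_floor] at h4
  have h5 : f p - p = f (Int.fract p.1, p.2) - (Int.fract p.1, p.2) := by
    have : f p = f (p.1, p.2) := rfl
    rw [this, h4]
    have h6 := Int.fract_add_floor p.1
    ext
    · simp only [Prod.fst_sub]; linarith
    · simp
  beta_reduce at h3
  rw [← h5, Prod.norm_def, max_le_iff] at h3
  exact h3

theorem unif_top (gt : (ℝ × ℝ) ≃ (ℝ × ℝ)) (hg : Continuous gt) (hg' : Continuous gt.symm)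
    (hcomm : ∀ p : ℝ × ℝ, gt (p.1 + 1, p.2) = ((gt p).1 + 1, (gt p).2))
    (htop : Filter.Tendsto (fun y : ℝ => (gt (0, y)).2) Filter.atTop Filter.atTop)
    (hbot : Filter.Tendsto (fun y : ℝ => (gt (0, y)).2) Filter.atBot Filter.atBot)
    (Y : ℝ) (hY : 0 ≤ Y) : ∃ M : ℝ, Y ≤ M ∧ (∀ p : ℝ × ℝ, M < p.2 → Y < (gt p).2) ∧
      (∀ p : ℝ × ℝ, p.2 < -M → (gt p).2 < -Y) := by
  obtain ⟨B, hB⟩ := disp_bdd gt.symm hg' (comm_symm gt hcomm) Y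
  have key : ∀ p : ℝ × ℝ, |(gt p).2| ≤ Y → |p.2| ≤ Y + B := by
    intro p hp
    have h := (hB (gt p) hp).2
    rw [Equiv.symm_apply_apply] at h
    have := abs_sub_abs_le_abs_sub p.2 (gt p).2
    linarith
  have hB0 : 0 ≤ B := (abs_nonneg _).trans (hB (0,0) (by simpa using hY)).1
  have hc : Continuous fun p : ℝ × ℝ => (gt p).2 := by fun_prop
  refine ⟨Y + B, by linarith, fun p hp => ?_, fun p hp => ?_⟩
  · by_contra hcon
    push Not at hcon
    obtain ⟨y, hy1, hy2⟩ := ((htop.eventually_gt_atTop Y).and (Filter.eventually_gt_atTop (Y+B))).exists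
    have hconn : IsPreconnected {p : ℝ × ℝ | Y + B < p.2} :=
      (convex_halfSpace_gt (IsLinearMap.mk (fun _ _ => rfl) (fun _ _ => rfl)) _).isPreconnected
    have hmem : (Y : ℝ) ∈ Set.Icc ((gt p).2) ((gt (0, y)).2) := ⟨hcon, hy1.le⟩
    obtain ⟨q, hq, hq2⟩ := hconn.intermediate_value (a := p) (b := (0, y)) hp hy2 hc.continuousOn hmem
    have h3 := key q (by beta_reduce at hq2; rw [hq2, abs_of_nonneg hY])
    have h4 : Y + B < q.2 := hq
    exact absurd (le_abs_self q.2) (by linarith)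
  · by_contra hcon
    push Not at hcon
    obtain ⟨y, hy1, hy2⟩ := ((hbot.eventually_lt_atBot (-Y)).and (Filter.eventually_lt_atBot (-(Y+B)))).exists
    have hconn : IsPreconnected {p : ℝ × ℝ | p.2 < -(Y + B)} :=
      (convex_halfSpace_lt (IsLinearMap.mk (fun _ _ => rfl) (fun _ _ => rfl)) _).isPreconnected
    have hmem : (-Y : ℝ) ∈ Set.Icc ((gt (0, y)).2) ((gt p).2) := ⟨hy1.le, hcon⟩
    obtain ⟨q, hq, hq2⟩ := hconn.intermediate_value (a := (0, y)) (b := p) hy2 hp hc.continuousOn hmem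
    have h3 := key q (by beta_reduce at hq2; rw [hq2, abs_neg, abs_of_nonneg hY])
    have h4 : q.2 < -(Y + B) := hq
    exact absurd (neg_abs_le q.2) (by linarith)

/-- the perturbation used in the closing argument -/
noncomputable def bumpMap (c : ℝ) (a b : ℝ × ℝ) (x : ℝ × ℝ) : ℝ × ℝ :=
  x + (max 0 (1 - dist x a / c)) • (b - a)

theorem bumpMap_far (c : ℝ) (hc : 0 < c) (a b x : ℝ × ℝ) (h : c ≤ dist x a) : bumpMap c a b x = x := by
  unfold bumpMap
  have : 1 - dist x a / c ≤ 0 := by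
    rw [sub_nonpos, le_div_iff₀ hc]; linarith
  rw [max_eq_left this, zero_smul, add_zero]

theorem bumpMap_center (c : ℝ) (a b : ℝ × ℝ) : bumpMap c a b a = b := by
  unfold bumpMap
  simp

theorem bumpMap_cont (c : ℝ) (a b : ℝ × ℝ) : Continuous (bumpMap c a b) := by
  unfold bumpMap
  fun_prop

theorem bumpMap_dist (c : ℝ) (hc : 0 < c) (a b : ℝ × ℝ) (hab : dist b a < c) (x : ℝ × ℝ) :
    dist (bumpMap c a b x) x < c := by
  unfold bumpMap
  rw [dist_eq_norm, add_sub_cancel_left, norm_smul, ← dist_eq_norm, Real.norm_eq_abs,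
    abs_of_nonneg (le_max_left _ _)]
  have h1 : max 0 (1 - dist x a / c) ≤ 1 := by
    apply max_le zero_le_one
    have : 0 ≤ dist x a / c := by positivity
    linarith
  calc _ ≤ 1 * dist b a := mul_le_mul_of_nonneg_right h1 dist_nonneg
    _ < c := by linarith

theorem bumpMap_inj (c : ℝ) (hc : 0 < c) (a b : ℝ × ℝ) (hab : dist b a < c) :
    Function.Injective (bumpMap c a b) := by
  intro x x' h
  by_contra hne
  have hd : 0 < dist x x' := dist_pos.2 hne
  unfold bumpMap at h
  have h1 : x - x' = (max 0 (1 - dist x' a / c) - max 0 (1 - dist x a / c)) • (b - a) := by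
    rw [sub_smul, sub_eq_sub_iff_add_eq_add, h, add_comm]
  have h2 : |max 0 (1 - dist x' a / c) - max 0 (1 - dist x a / c)| ≤ dist x x' / c := by
    rw [max_comm 0, max_comm 0]
    refine (abs_max_sub_max_le_abs _ _ _).trans ?_
    have e : (1 - dist x' a / c) - (1 - dist x a / c) = (dist x a - dist x' a) / c := by ring
    rw [e, abs_div, abs_of_pos hc]
    exact div_le_div_of_nonneg_right (abs_dist_sub_le _ _ _) hc.le
  have h3 : dist x x' ≤ dist x x' / c * dist b a := by
    conv_lhs => rw [dist_eq_norm, h1, norm_smul, Real.norm_eq_abs]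
    rw [← dist_eq_norm]
    exact mul_le_mul_of_nonneg_right h2 dist_nonneg
  have h4 : dist x x' / c * dist b a < dist x x' / c * c :=
    mul_lt_mul_of_pos_left hab (div_pos hd hc)
  rw [div_mul_cancel₀ _ hc.ne'] at h4
  linarith

theorem closing (f : ℝ × ℝ → ℝ × ℝ) (fc : Continuous f) (finj : Function.Injective f)
    (Kt : Set (ℝ × ℝ)) (hinv : ∀ p ∈ Kt, f p ∈ Kt) (Y : ℝ) (hY : ∀ p ∈ Kt, |p.2| ≤ Y)
    (hdisp : ∀ Y : ℝ, ∃ B : ℝ, ∀ p : ℝ × ℝ, |p.2| ≤ Y →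
      |(f p).1 - p.1| ≤ B ∧ |(f p).2 - p.2| ≤ B)
    (M : ℝ) (hYM : Y ≤ M) (hT : ∀ p : ℝ × ℝ, M < p.2 → Y + 1 < (f p).2)
    (hB : ∀ p : ℝ × ℝ, p.2 < -M → (f p).2 < -(Y + 1))
    (c : ℝ) (hc : 0 < c) (hc1 : c ≤ 1)
    (hnear : ∀ k ∈ Kt, ∀ p, dist p k < 2 * c → c ≤ dist (f p) p)
    (hrec : ∃ q ∈ Kt, ∃ N ≥ 1, dist (f^[N] q) q < c)
    (hfix : ∀ z, f z = z → ∃ Q : ℝ × ℝ → ℝ × ℝ,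
      ContinuousOn Q (Set.Icc 0 1 ×ˢ Set.Icc 0 1) ∧
      (∀ a ∈ Set.Icc (0:ℝ) 1, ∀ b ∈ Set.Icc (0:ℝ) 1, ∀ k ∈ Kt, c ≤ dist (Q (a, b)) k) ∧
      (∀ b ∈ Set.Icc (0:ℝ) 1, Q (0, b) = z) ∧
      (∀ a ∈ Set.Icc (0:ℝ) 1, Q (a, 1) = f (Q (a, 0))) ∧
      ((∀ b ∈ Set.Icc (0:ℝ) 1, M < (Q (1, b)).2) ∨ (∀ b ∈ Set.Icc (0:ℝ) 1, (Q (1, b)).2 < -M))) :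
    False := by
  classical
  obtain ⟨q, hq, N, hN, hrec⟩ := hrec
  have hKt : ∀ j, f^[j] q ∈ Kt := by
    intro j
    induction j with
    | zero => exact hq
    | succ j ih => rw [Function.iterate_succ_apply']; exact hinv _ ih
  -- last close return
  let S : Finset ℕ := (Finset.range N).filter fun j => dist (f^[j] q) (f^[N] q) < c
  have hS : S.Nonempty := ⟨0, by
    rw [Finset.mem_filter, Finset.mem_range]
    exact ⟨hN, by rw [dist_comm]; exact hrec⟩⟩
  obtain ⟨i, hiS, himax⟩ := S.exists_max_image id hS
  rw [Finset.mem_filter, Finset.mem_range] at hiS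
  obtain ⟨hiN, hid⟩ := hiS
  have hfar : ∀ j, i < j → j < N → c ≤ dist (f^[j] q) (f^[N] q) := by
    intro j hj1 hj2
    by_contra hcon
    push Not at hcon
    have := himax j (Finset.mem_filter.2 ⟨Finset.mem_range.2 hj2, hcon⟩)
    simp only [id] at this
    omega
  set xN := f^[N] q with hxN
  set xi := f^[i] q with hxi
  have hxNK : xN ∈ Kt := hKt N
  let O : Finset (ℝ × ℝ) := (Finset.Ico i N).image fun j => f^[j] q
  have hOK : ∀ o ∈ O, o ∈ Kt := by
    intro o ho
    obtain ⟨j, _, rfl⟩ := Finset.mem_image.1 ho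
    exact hKt j
  let h1 : ℝ × ℝ → ℝ × ℝ := fun p => bumpMap c xN xi (f p)
  have h1inj : Function.Injective h1 := (bumpMap_inj c hc xN xi hid).comp finj
  have h1d : ∀ p, dist (h1 p) (f p) < c := fun p => bumpMap_dist c hc xN xi hid _
  have h1O : ∀ p ∈ O, h1 p ∈ O := by
    intro o ho
    obtain ⟨j, hj, rfl⟩ := Finset.mem_image.1 ho
    rw [Finset.mem_Ico] at hj
    change bumpMap c xN xi (f (f^[j] q)) ∈ O
    rw [← Function.iterate_succ_apply' f]
    rcases Nat.lt_or_ge (j+1) N with h | h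
    · rw [bumpMap_far c hc _ _ _ (hfar (j+1) (by omega) h)]
      exact Finset.mem_image.2 ⟨j+1, Finset.mem_Ico.2 ⟨by omega, h⟩, rfl⟩
    · have : j.succ = N := by omega
      rw [this, ← hxN, bumpMap_center]
      exact Finset.mem_image.2 ⟨i, Finset.mem_Ico.2 ⟨le_refl _, hiN⟩, rfl⟩
  have h1fix : ∀ p, h1 p = p → f p = p := by
    intro p hp
    by_contra hne
    rcases le_or_gt c (dist (f p) xN) with h | h
    · apply hne
      have : h1 p = f p := bumpMap_far c hc _ _ _ h
      rw [← this, hp]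
    · have h2 := h1d p
      rw [hp, dist_comm] at h2
      have h3 : dist p xN < 2 * c := by
        have := dist_triangle p (f p) xN
        rw [dist_comm p (f p)] at this
        linarith
      linarith [hnear _ hxNK p h3]
  have hKfix : ∀ k ∈ Kt, f k ≠ k := by
    intro k hk h
    have := hnear k hk k (by rw [dist_self]; linarith)
    rw [h, dist_self] at this
    linarith
  have h1d2 : ∀ p, |(h1 p).1 - (f p).1| ≤ 1 ∧ |(h1 p).2 - (f p).2| < 1 := by
    intro p
    have h2 := h1d p
    rw [Prod.dist_eq, max_lt_iff, Real.dist_eq, Real.dist_eq] at h2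
    exact ⟨by linarith [h2.1], by linarith [h2.2]⟩
  refine theoremD_gen O ⟨xi, Finset.mem_image.2 ⟨i, Finset.mem_Ico.2 ⟨le_refl _, hiN⟩, rfl⟩⟩
    h1 ((bumpMap_cont _ _ _).comp fc) ?_ ?_ M ?_ ?_ ?_ ?_
  · intro p hp hcon
    have hsurj := Finset.surjOn_of_injOn_of_card_le (s := O) (t := O) h1 (fun x hx => h1O x hx)
      h1inj.injOn (le_refl _)
    obtain ⟨o, ho, ho2⟩ := hsurj hcon
    rw [h1inj ho2] at ho
    exact hp ho
  · intro p hp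
    exact ⟨h1O p hp, fun h => hKfix p (hOK p hp) (h1fix p h)⟩
  · intro p hp o ho
    have h2 := abs_le.1 (hY o (hOK o ho))
    have h3 := abs_lt.1 (h1d2 p).2
    have h4 := hT p hp
    exact ⟨by linarith [h2.2], by linarith [h2.2, h3.1]⟩
  · intro p hp o ho
    have h2 := abs_le.1 (hY o (hOK o ho))
    have h3 := abs_lt.1 (h1d2 p).2
    have h4 := hB p hp
    exact ⟨by linarith [h2.1], by linarith [h2.1, h3.2]⟩
  · intro Y'
    obtain ⟨B, hB⟩ := hdisp Y'
    refine ⟨B + 1, fun p hp => ?_⟩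
    obtain ⟨h2, h3⟩ := hB p hp
    obtain ⟨h4, h5⟩ := h1d2 p
    have a1 := abs_sub_le (h1 p).1 (f p).1 p.1
    have a2 := abs_sub_le (h1 p).2 (f p).2 p.2
    exact ⟨by linarith, by linarith⟩
  · intro z hz
    obtain ⟨Q, Qc, QK, Q0, Q1, Qe⟩ := hfix z (h1fix z hz)
    refine ⟨Q, Qc, ?_, Q0, ?_, Qe⟩
    · intro a ha b hb hO
      have := QK a ha b hb _ (hOK _ hO)
      rw [dist_self] at this
      linarith
    · intro a ha
      have h2 := QK a ha 1 (by simp) xN hxNK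
      change _ = bumpMap c xN xi (f (Q (a, 0)))
      rw [← Q1 a ha, bumpMap_far c hc _ _ _ h2]

/-- Square witness for a fixed point with margin `c`. -/
def SqW (f : ℝ × ℝ → ℝ × ℝ) (Kt : Set (ℝ × ℝ)) (M c : ℝ) (z : ℝ × ℝ) : Prop :=
  ∃ Q : ℝ × ℝ → ℝ × ℝ,
      ContinuousOn Q (Set.Icc 0 1 ×ˢ Set.Icc 0 1) ∧
      (∀ a ∈ Set.Icc (0:ℝ) 1, ∀ b ∈ Set.Icc (0:ℝ) 1, ∀ k ∈ Kt, c ≤ dist (Q (a, b)) k) ∧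
      (∀ b ∈ Set.Icc (0:ℝ) 1, Q (0, b) = z) ∧
      (∀ a ∈ Set.Icc (0:ℝ) 1, Q (a, 1) = f (Q (a, 0))) ∧
      ((∀ b ∈ Set.Icc (0:ℝ) 1, M < (Q (1, b)).2) ∨ (∀ b ∈ Set.Icc (0:ℝ) 1, (Q (1, b)).2 < -M))

theorem SqW.mono {f : ℝ × ℝ → ℝ × ℝ} {Kt : Set (ℝ × ℝ)} {M c c' : ℝ} {z : ℝ × ℝ} (h : c ≤ c')
    (hz : SqW f Kt M c' z) : SqW f Kt M c z := by
  obtain ⟨Q, Qc, QK, Q0, Q1, Qe⟩ := hz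
  exact ⟨Q, Qc, fun a ha b hb k hk => h.trans (QK a ha b hb k hk), Q0, Q1, Qe⟩

theorem SqW.transl {f : ℝ × ℝ → ℝ × ℝ} {Kt : Set (ℝ × ℝ)} {M c : ℝ} {z : ℝ × ℝ}
    (hcomm : ∀ p : ℝ × ℝ, f (p.1 + 1, p.2) = ((f p).1 + 1, (f p).2))
    (Kper : ∀ z ∈ Kt, ∀ n : ℤ, ((z.1 + n, z.2) : ℝ × ℝ) ∈ Kt)
    (hz : SqW f Kt M c z) (n : ℤ) : SqW f Kt M c (z.1 + n, z.2) := by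
  obtain ⟨Q, Qc, QK, Q0, Q1, Qe⟩ := hz
  refine ⟨fun x => ((Q x).1 + n, (Q x).2), ?_, ?_, ?_, ?_, Qe⟩
  · exact (Continuous.comp_continuousOn (g := fun p : ℝ × ℝ => ((p.1 + n, p.2) : ℝ × ℝ)) (by fun_prop) Qc)
  · intro a ha b hb k hk
    have h1 := QK a ha b hb _ (Kper k hk (-n))
    refine h1.trans (le_of_eq ?_)
    rw [Prod.dist_eq, Prod.dist_eq, Real.dist_eq, Real.dist_eq]
    dsimp only
    push_cast
    congr 2; ring
  · intro b hb
    beta_reduce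
    rw [Q0 b hb]
  · intro a ha
    have h1 := comm_int f hcomm n (Q (a, 0))
    beta_reduce
    rw [h1, Q1 a ha]

theorem SqW.high {f : ℝ × ℝ → ℝ × ℝ} {Kt : Set (ℝ × ℝ)} {M Y : ℝ} {z : ℝ × ℝ} (hz : f z = z)
    (hY : ∀ k ∈ Kt, |k.2| ≤ Y) (hM : Y + 1 ≤ M) (h : M < |z.2|) : SqW f Kt M 1 z := by
  refine ⟨fun _ => z, continuousOn_const, ?_, fun _ _ => rfl, fun _ _ => hz.symm, ?_⟩
  · intro a ha b hb k hk
    rw [Prod.dist_eq, Real.dist_eq, Real.dist_eq]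
    refine le_trans ?_ (le_max_right _ _)
    have := abs_sub_abs_le_abs_sub z.2 k.2
    linarith [hY k hk]
  · rcases lt_abs.1 h with h | h
    · exact Or.inl fun _ _ => h
    · exact Or.inr fun _ _ => by linarith

theorem SqW.loc {f : ℝ × ℝ → ℝ × ℝ} (fc : Continuous f) {Kt : Set (ℝ × ℝ)} {M c : ℝ} {z : ℝ × ℝ}
    (hc : 0 < c) (hfz : f z = z) (hz : SqW f Kt M c z) :
    ∃ U ∈ nhds z, ∀ z' ∈ U, f z' = z' → SqW f Kt M (c / 2) z' := by
  obtain ⟨Q, Qc, QK, Q0, Q1, Qe⟩ := hz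
  have hzK : ∀ k ∈ Kt, c ≤ dist z k := by
    intro k hk
    have := QK 0 (by simp) 0 (by simp) k hk
    rwa [Q0 0 (by simp)] at this
  obtain ⟨d, hd, hd2⟩ := Metric.continuousAt_iff.1 (fc.continuousAt (x := z)) (c/2) (by linarith)
  rw [hfz] at hd2
  refine ⟨Metric.ball z (min d (c/2)), Metric.ball_mem_nhds _ (by positivity), ?_⟩
  intro z' hz' hfz'
  -- first half
  let p : ℝ → ℝ × ℝ := fun a => (1 - a) • z' + a • z
  let Q₁ : ℝ × ℝ → ℝ × ℝ := fun x => (1 - x.2) • p x.1 + x.2 • f (p x.1)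
  have pc : Continuous p := by fun_prop
  have Q₁c : Continuous Q₁ := by fun_prop
  have hp : ∀ a ∈ Set.Icc (0:ℝ) 1, p a ∈ Metric.ball z (min d (c/2)) := by
    intro a ha
    exact (convex_ball z _) hz' (Metric.mem_ball_self (by positivity)) (by linarith [ha.2]) ha.1 (by ring)
  have hQ₁ : ∀ a ∈ Set.Icc (0:ℝ) 1, ∀ b ∈ Set.Icc (0:ℝ) 1, Q₁ (a, b) ∈ Metric.ball z (c/2) := by
    intro a ha b hb
    have h1 := hp a ha
    rw [Metric.mem_ball, lt_min_iff] at h1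
    exact (convex_ball z _) (Metric.mem_ball.2 h1.2) (Metric.mem_ball.2 (hd2 h1.1))
      (by linarith [hb.2]) hb.1 (by ring)
  have p1 : p 1 = z := by simp [p]
  have p0 : p 0 = z' := by simp [p]
  have Q₁1 : ∀ b, Q₁ (1, b) = z := by
    intro b
    simp only [Q₁]
    rw [p1, hfz, ← add_smul]; simp
  have Q₁0 : ∀ b, Q₁ (0, b) = z' := by
    intro b
    simp only [Q₁]
    rw [p0, hfz', ← add_smul]; simp
  let Q' : ℝ × ℝ → ℝ × ℝ := fun x => if x.1 ≤ 1/2 then Q₁ (2 * x.1, x.2) else Q (2 * x.1 - 1, x.2)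
  have Q'lo : ∀ a b : ℝ, a ≤ 1/2 → Q' (a, b) = Q₁ (2 * a, b) := fun a b h => if_pos h
  have Q'hi : ∀ a b : ℝ, 1/2 < a → Q' (a, b) = Q (2 * a - 1, b) := fun a b h => if_neg (not_le.2 h)
  refine ⟨Q', ?_, ?_, ?_, ?_, ?_⟩
  · refine ContinuousOn.if ?_ ?_ ?_
    · rintro ⟨a, b⟩ ⟨⟨ha, hb⟩, hfr⟩
      have h1 : {x : ℝ × ℝ | x.1 ≤ 1/2} = Prod.fst ⁻¹' (Set.Iic (1/2)) := rfl
      have h2 : a = 1/2 := by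
        have := frontier_le_subset_eq (f := fun x : ℝ × ℝ => x.1) (g := fun _ => (1/2:ℝ))
          continuous_fst continuous_const hfr
        exact this
      subst h2
      dsimp only
      have e1 : (2:ℝ) * (1/2) = 1 := by norm_num
      rw [e1, Q₁1, sub_self, Q0 b hb]
    · exact (Q₁c.comp (by fun_prop)).continuousOn
    · refine ContinuousOn.comp Qc (by fun_prop) ?_
      rintro ⟨a, b⟩ ⟨⟨ha, hb⟩, hcl⟩
      have h1 : a ∈ Set.Ici (1/2:ℝ) := by
        have hsub : closure {x : ℝ × ℝ | ¬ x.1 ≤ 1/2} ⊆ {x : ℝ × ℝ | 1/2 ≤ x.1} :=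
          closure_minimal (fun x hx => (not_le.1 hx).le) (isClosed_le continuous_const continuous_fst)
        exact hsub hcl
      have h2 : (1:ℝ)/2 ≤ a := h1
      exact ⟨⟨by dsimp only; linarith, by have := ha.2; dsimp only at this ⊢; linarith⟩, hb⟩
  · intro a ha b hb k hk
    rcases le_or_gt a (1/2) with h | h
    · rw [Q'lo a b h]
      have h1 := hQ₁ (2*a) ⟨by linarith [ha.1], by linarith⟩ b hb
      rw [Metric.mem_ball, dist_comm] at h1
      have := dist_triangle z (Q₁ (2*a, b)) k
      linarith [hzK k hk]
    · rw [Q'hi a b h]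
      have := QK (2*a-1) ⟨by linarith, by linarith [ha.2]⟩ b hb k hk
      linarith
  · intro b hb
    rw [Q'lo 0 b (by norm_num), mul_zero, Q₁0]
  · intro a ha
    rcases le_or_gt a (1/2) with h | h
    · rw [Q'lo a _ h, Q'lo a _ h]
      simp [Q₁]
    · rw [Q'hi a _ h, Q'hi a _ h]
      exact Q1 (2*a-1) ⟨by linarith, by linarith [ha.2]⟩
  · have : ∀ b, Q' (1, b) = Q (1, b) := by
      intro b
      rw [Q'hi 1 b (by norm_num)]; norm_num
    simp only [this]
    exact Qe

/-- lifting a square in the annulus -/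
theorem lift_square (f : ℝ × ℝ → ℝ × ℝ) (fc : Continuous f)
    (g : AddCircle (1 : ℝ) × ℝ → AddCircle (1 : ℝ) × ℝ)
    (hsemi : ∀ p : ℝ × ℝ, annulusProj (f p) = g (annulusProj p))
    (z : ℝ × ℝ) (hz : f z = z)
    (R : ℝ × ℝ → AddCircle (1 : ℝ) × ℝ) (Rc : ContinuousOn R (Set.Icc 0 1 ×ˢ Set.Icc 0 1))
    (R0 : ∀ b ∈ Set.Icc (0:ℝ) 1, R (0, b) = annulusProj z)
    (R1 : ∀ a ∈ Set.Icc (0:ℝ) 1, R (a, 1) = g (R (a, 0))) :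
    ∃ Q : ℝ × ℝ → ℝ × ℝ, ContinuousOn Q (Set.Icc 0 1 ×ˢ Set.Icc 0 1) ∧
      (∀ a ∈ Set.Icc (0:ℝ) 1, ∀ b ∈ Set.Icc (0:ℝ) 1, annulusProj (Q (a, b)) = R (a, b)) ∧
      (∀ b ∈ Set.Icc (0:ℝ) 1, Q (0, b) = z) ∧
      (∀ a ∈ Set.Icc (0:ℝ) 1, Q (a, 1) = f (Q (a, 0))) := by
  have cov := AddCircle.isCoveringMap_coe (1:ℝ)
  let H : C(unitInterval × unitInterval, AddCircle (1:ℝ)) :=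
    ⟨fun x => (R (x.1.1, x.2.1)).1, by
      refine continuous_fst.comp (Rc.comp_continuous (by fun_prop) ?_)
      intro x
      exact ⟨x.1.2, x.2.2⟩⟩
  have H0 : ∀ b, H (0, b) = ((ContinuousMap.const unitInterval z.1 b : ℝ) : AddCircle (1:ℝ)) := by
    intro b
    change (R (0, b.1)).1 = _
    rw [R0 b.1 b.2]; rfl
  let G := cov.liftHomotopy H (ContinuousMap.const unitInterval z.1) H0
  have Gl : ∀ x, ((G x : ℝ) : AddCircle (1:ℝ)) = H x := fun x =>
    congr_fun (cov.liftHomotopy_lifts H (ContinuousMap.const unitInterval z.1) H0) x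
  have G0 : ∀ b, G (0, b) = z.1 := fun b =>
    cov.liftHomotopy_zero H (ContinuousMap.const unitInterval z.1) H0 b
  let pI : ℝ → unitInterval := Set.projIcc 0 1 zero_le_one
  have pIc : Continuous pI := continuous_projIcc
  have pIe : ∀ a (ha : a ∈ Set.Icc (0:ℝ) 1), pI a = ⟨a, ha⟩ := fun a ha => Set.projIcc_of_mem _ ha
  let Q : ℝ × ℝ → ℝ × ℝ := fun x => (G (pI x.1, pI x.2), (R x).2)
  have QR : ∀ a ∈ Set.Icc (0:ℝ) 1, ∀ b ∈ Set.Icc (0:ℝ) 1, annulusProj (Q (a, b)) = R (a, b) := by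
    intro a ha b hb
    refine Prod.ext ?_ rfl
    change ((G (pI a, pI b) : ℝ) : AddCircle (1:ℝ)) = _
    rw [Gl, pIe a ha, pIe b hb]; rfl
  have Qc : ContinuousOn Q (Set.Icc 0 1 ×ˢ Set.Icc 0 1) := by
    refine ContinuousOn.prodMk ?_ (continuous_snd.comp_continuousOn Rc)
    exact (G.continuous.comp (by fun_prop)).continuousOn
  have Q0 : ∀ b ∈ Set.Icc (0:ℝ) 1, Q (0, b) = z := by
    intro b hb
    refine Prod.ext ?_ ?_
    · change G (pI 0, pI b) = _
      rw [pIe 0 (by simp)]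
      exact G0 _
    · change (R (0, b)).2 = _
      rw [R0 b hb]; rfl
  refine ⟨Q, Qc, QR, Q0, ?_⟩
  have hpr : ∀ a ∈ Set.Icc (0:ℝ) 1, annulusProj (Q (a, 1)) = annulusProj (f (Q (a, 0))) := by
    intro a ha
    rw [QR a ha 1 (by simp), R1 a ha, hsemi, QR a ha 0 (by simp)]
  have h1 : Set.EqOn (fun a => (Q (a, 1)).1) (fun a => (f (Q (a, 0))).1) (Set.Icc 0 1) := by
    refine cov.eqOn_of_comp_eqOn isPreconnected_Icc ?_ ?_ ?_ (a := 0) (by simp) ?_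
    · refine continuous_fst.comp_continuousOn (Qc.comp (by fun_prop) ?_)
      intro a ha; exact ⟨ha, by simp⟩
    · refine continuous_fst.comp_continuousOn (fc.comp_continuousOn (Qc.comp (by fun_prop) ?_))
      intro a ha; exact ⟨ha, by simp⟩
    · intro a ha
      exact congrArg Prod.fst (hpr a ha)
    · beta_reduce
      rw [Q0 1 (by simp), Q0 0 (by simp), hz]
  intro a ha
  exact Prod.ext (h1 ha) (by have h2 := congrArg Prod.snd (hpr a ha); exact h2)

theorem annulusProj_cont : Continuous annulusProj := by
  unfold annulusProj
  exact ((AddCircle.isCoveringMap_coe (1:ℝ)).continuous.comp continuous_fst).prodMk continuous_snd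

theorem annulusProj_per (z : ℝ × ℝ) (n : ℤ) : annulusProj (z.1 + n, z.2) = annulusProj z := by
  unfold annulusProj
  refine Prod.ext ?_ rfl
  dsimp only
  have h : ((n : ℝ) : AddCircle (1:ℝ)) = 0 := by
    have h2 : (n : ℝ) = n • (1:ℝ) := by simp
    rw [h2, AddCircle.coe_zsmul, AddCircle.coe_period, smul_zero]
  rw [AddCircle.coe_add, h, add_zero]

theorem exists_trunc (K₀ : Set (AddCircle (1 : ℝ) × ℝ))
    (Ht : ℝ × ℝ → AddCircle (1 : ℝ) × ℝ) (m : ℝ) (hm : ∀ k ∈ K₀, k.2 ≠ m)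
    (hprop : ∀ C : Set (AddCircle (1 : ℝ) × ℝ), IsCompact C → C ⊆ K₀ᶜ →
      IsCompact {p ∈ Set.Ico (0:ℝ) 1 ×ˢ Set.Icc (0:ℝ) 1 | Ht p ∈ C})
    (E : ℝ → Prop) (hE : ∀ᶠ t in nhdsWithin 1 (Set.Ico (0:ℝ) 1), E t) :
    ∃ t ∈ Set.Ico (0:ℝ) 1, E t ∧ ∀ s ∈ Set.Icc (0:ℝ) 1, (Ht (t, s)).2 ≠ m := by
  have hC : IsCompact ((Set.univ : Set (AddCircle (1:ℝ))) ×ˢ ({m} : Set ℝ)) :=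
    isCompact_univ.prod isCompact_singleton
  have h1 := hprop _ hC (by
    rintro k hk hk2
    exact hm k hk2 hk.2)
  have h2 := (h1.image continuous_fst).isClosed
  have h3 : (1:ℝ) ∉ Prod.fst '' {p ∈ Set.Ico (0:ℝ) 1 ×ˢ Set.Icc (0:ℝ) 1 | Ht p ∈
      (Set.univ : Set (AddCircle (1:ℝ))) ×ˢ ({m} : Set ℝ)} := by
    rintro ⟨p, hp, hp1⟩
    have := hp.1.1.2
    rw [hp1] at this
    exact lt_irrefl _ this
  have h4 := nhdsWithin_le_nhds (s := Set.Ico (0:ℝ) 1) (h2.isOpen_compl.mem_nhds h3)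
  have hne : (nhdsWithin (1:ℝ) (Set.Ico (0:ℝ) 1)).NeBot := by
    rw [nhdsWithin_Ico_eq_nhdsLT (zero_lt_one)]
    infer_instance
  obtain ⟨t, ht1, ht2, ht3⟩ := (hE.and (Filter.Eventually.and h4 self_mem_nhdsWithin)).exists
  refine ⟨t, ht3, ht1, fun s hs hcon => ht2 ⟨(t, s), ⟨⟨ht3, hs⟩, Set.mem_univ _, hcon⟩, rfl⟩⟩

theorem sq_of_periph (f : ℝ × ℝ → ℝ × ℝ) (fc : Continuous f)
    (g : AddCircle (1 : ℝ) × ℝ → AddCircle (1 : ℝ) × ℝ)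
    (hsemi : ∀ p : ℝ × ℝ, annulusProj (f p) = g (annulusProj p))
    (K₀ : Set (AddCircle (1 : ℝ) × ℝ)) (hK : IsClosed K₀) (Y M : ℝ) (hY : ∀ k ∈ K₀, |k.2| ≤ Y)
    (hM : Y < M) (z : ℝ × ℝ) (hz : f z = z)
    (hper : PeriphContainsEnd K₀ g (annulusProj z) atTop ∨
      PeriphContainsEnd K₀ g (annulusProj z) atBot) :
    ∃ c > 0, SqW f (annulusProj ⁻¹' K₀) M c z := by
  -- truncated square in the annulus
  have hR : ∃ R : ℝ × ℝ → AddCircle (1 : ℝ) × ℝ, ContinuousOn R (Set.Icc 0 1 ×ˢ Set.Icc 0 1) ∧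
      (∀ b ∈ Set.Icc (0:ℝ) 1, R (0, b) = annulusProj z) ∧
      (∀ a ∈ Set.Icc (0:ℝ) 1, R (a, 1) = g (R (a, 0))) ∧
      (∀ a ∈ Set.Icc (0:ℝ) 1, ∀ b ∈ Set.Icc (0:ℝ) 1, R (a, b) ∉ K₀) ∧
      ((∀ b ∈ Set.Icc (0:ℝ) 1, M < (R (1, b)).2) ∨ (∀ b ∈ Set.Icc (0:ℝ) 1, (R (1, b)).2 < -M)) := by
    have gen : ∀ (γ : ℝ → AddCircle (1 : ℝ) × ℝ) (Ht : ℝ × ℝ → AddCircle (1 : ℝ) × ℝ) (t : ℝ),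
        t ∈ Set.Ico (0:ℝ) 1 →
        ContinuousOn Ht (Set.Ico (0:ℝ) 1 ×ˢ Set.Icc (0:ℝ) 1) →
        (∀ p ∈ Set.Ico (0:ℝ) 1 ×ˢ Set.Icc (0:ℝ) 1, Ht p ∉ K₀) →
        (∀ t ∈ Set.Ico (0:ℝ) 1, Ht (t, 0) = γ t ∧ Ht (t, 1) = g (γ t)) →
        (∀ s ∈ Set.Icc (0:ℝ) 1, Ht (0, s) = annulusProj z) →
        ((∀ b ∈ Set.Icc (0:ℝ) 1, M < (Ht (t, b)).2) ∨ (∀ b ∈ Set.Icc (0:ℝ) 1, (Ht (t, b)).2 < -M)) →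
        ∃ R : ℝ × ℝ → AddCircle (1 : ℝ) × ℝ, ContinuousOn R (Set.Icc 0 1 ×ˢ Set.Icc 0 1) ∧
      (∀ b ∈ Set.Icc (0:ℝ) 1, R (0, b) = annulusProj z) ∧
      (∀ a ∈ Set.Icc (0:ℝ) 1, R (a, 1) = g (R (a, 0))) ∧
      (∀ a ∈ Set.Icc (0:ℝ) 1, ∀ b ∈ Set.Icc (0:ℝ) 1, R (a, b) ∉ K₀) ∧
      ((∀ b ∈ Set.Icc (0:ℝ) 1, M < (R (1, b)).2) ∨ (∀ b ∈ Set.Icc (0:ℝ) 1, (R (1, b)).2 < -M)) := by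
      intro γ Ht t ht Hc HK Hγ H0 He
      have hta : ∀ a ∈ Set.Icc (0:ℝ) 1, t * a ∈ Set.Ico (0:ℝ) 1 := fun a ha =>
        ⟨mul_nonneg ht.1 ha.1, lt_of_le_of_lt (mul_le_of_le_one_right ht.1 ha.2) ht.2⟩
      refine ⟨fun x => Ht (t * x.1, x.2), ?_, ?_, ?_, ?_, ?_⟩
      · refine Hc.comp (by fun_prop) ?_
        intro x hx
        exact ⟨hta _ hx.1, hx.2⟩
      · intro b hb
        beta_reduce
        simp only [mul_zero]
        exact H0 b hb
      · intro a ha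
        beta_reduce
        rw [(Hγ _ (hta a ha)).2, (Hγ _ (hta a ha)).1]
      · intro a ha b hb
        exact HK _ ⟨hta a ha, hb⟩
      · simpa only [mul_one] using He
    rcases hper with h | h
    · obtain ⟨γ, Ht, γc, γ0, γK, γt, Hc, HK, Hγ, H0, Hp⟩ := h
      obtain ⟨t, ht, ht1, ht2⟩ := exists_trunc K₀ Ht M
        (fun k hk h => by have := le_abs_self k.2; linarith [hY k hk]) Hp _ (γt.eventually_gt_atTop M)
      refine gen γ Ht t ht Hc HK Hγ H0 (Or.inl ?_)
      intro b hb
      by_contra hcon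
      push Not at hcon
      have hcc : ContinuousOn (fun s => (Ht (t, s)).2) (Set.Icc 0 1) :=
        continuous_snd.comp_continuousOn (Hc.comp (by fun_prop) (fun s hs => ⟨ht, hs⟩))
      obtain ⟨s, hs, hs2⟩ := isPreconnected_Icc.intermediate_value (a := b) (b := 0) hb (by simp) hcc
        (show M ∈ Set.Icc _ _ from ⟨hcon, by beta_reduce; rw [(Hγ t ht).1]; exact ht1.le⟩)
      exact ht2 s hs hs2
    · obtain ⟨γ, Ht, γc, γ0, γK, γt, Hc, HK, Hγ, H0, Hp⟩ := h
      obtain ⟨t, ht, ht1, ht2⟩ := exists_trunc K₀ Ht (-M)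
        (fun k hk h => by have := neg_abs_le k.2; linarith [hY k hk]) Hp _ (γt.eventually_lt_atBot (-M))
      refine gen γ Ht t ht Hc HK Hγ H0 (Or.inr ?_)
      intro b hb
      by_contra hcon
      push Not at hcon
      have hcc : ContinuousOn (fun s => (Ht (t, s)).2) (Set.Icc 0 1) :=
        continuous_snd.comp_continuousOn (Hc.comp (by fun_prop) (fun s hs => ⟨ht, hs⟩))
      obtain ⟨s, hs, hs2⟩ := isPreconnected_Icc.intermediate_value (a := 0) (b := b) (by simp) hb hcc
        (show -M ∈ Set.Icc _ _ from ⟨by beta_reduce; rw [(Hγ t ht).1]; exact ht1.le, hcon⟩)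
      exact ht2 s hs hs2
  obtain ⟨R, Rc, R0, R1, RK, Re⟩ := hR
  obtain ⟨Q, Qc, QR, Q0, Q1⟩ := lift_square f fc g hsemi z hz R Rc R0 R1
  have Qs : ∀ a ∈ Set.Icc (0:ℝ) 1, ∀ b ∈ Set.Icc (0:ℝ) 1, (Q (a, b)).2 = (R (a, b)).2 :=
    fun a ha b hb => congrArg Prod.snd (QR a ha b hb)
  have hcpt : IsCompact (Q '' (Set.Icc 0 1 ×ˢ Set.Icc 0 1)) :=
    (isCompact_Icc.prod isCompact_Icc).image_of_continuousOn Qc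
  have hcl : IsClosed (annulusProj ⁻¹' K₀) := hK.preimage annulusProj_cont
  have hdis : Disjoint (Q '' (Set.Icc 0 1 ×ˢ Set.Icc 0 1)) (annulusProj ⁻¹' K₀) := by
    rw [Set.disjoint_left]
    rintro _ ⟨x, hx, rfl⟩ h
    have h2 : annulusProj (Q (x.1, x.2)) ∈ K₀ := h
    rw [QR x.1 hx.1 x.2 hx.2] at h2
    exact RK _ hx.1 _ hx.2 h2
  obtain ⟨c, hc, hc2⟩ := hdis.exists_thickenings hcpt hcl
  refine ⟨c, hc, Q, Qc, ?_, Q0, Q1, ?_⟩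
  · intro a ha b hb k hk
    by_contra hcon
    push Not at hcon
    refine (Set.disjoint_left.1 hc2 : ∀ ⦃a⦄, _ → _) (?_ : k ∈ _) (Metric.self_subset_thickening hc _ hk)
    rw [Metric.mem_thickening_iff]
    exact ⟨Q (a, b), ⟨(a, b), ⟨ha, hb⟩, rfl⟩, by rw [dist_comm]; exact hcon⟩
  · rcases Re with Re | Re
    · exact Or.inl fun b hb => by rw [Qs 1 (by simp) b hb]; exact Re b hb
    · exact Or.inr fun b hb => by rw [Qs 1 (by simp) b hb]; exact Re b hb

theorem mean_ergodic_L1 {α : Type*} [MeasurableSpace α] (μ : Measure α) [IsProbabilityMeasure μ]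
    (g : α → α) (herg : Ergodic g μ) (φ : α → ℝ) (hφ : MemLp φ 2 μ) (h0 : ∫ x, φ x ∂μ = 0) :
    (∀ n, Integrable (birkhoffSum g φ n) μ) ∧
    Tendsto (fun n : ℕ => (n:ℝ)⁻¹ * ∫ x, |birkhoffSum g φ n x| ∂μ) atTop (nhds 0) := by
  have hmp := herg.toMeasurePreserving
  have hS : ∀ n, MemLp (birkhoffSum g φ n) 2 μ := by
    intro n
    induction n with
    | zero => rw [birkhoffSum_zero']; exact MemLp.zero
    | succ n ih =>
      have : birkhoffSum g φ (n+1) = birkhoffSum g φ n + φ ∘ g^[n] := by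
        funext x; rw [birkhoffSum_succ]; rfl
      rw [this]
      exact ih.add (hφ.comp_measurePreserving (hmp.iterate n))
  refine ⟨fun n => (hS n).integrable (by norm_num), ?_⟩
  let V := Lp.compMeasurePreservingₗᵢ (E := ℝ) (p := 2) ℝ g hmp
  let U : Lp ℝ 2 μ →L[ℝ] Lp ℝ 2 μ := V.toContinuousLinearMap
  let v : Lp ℝ 2 μ := hφ.toLp φ
  have hUv : ∀ k, U^[k] v = (hφ.comp_measurePreserving (hmp.iterate k)).toLp _ := by
    intro k
    have := congrFun (Lp.compMeasurePreserving_iterate (E := ℝ) (p := 2) hmp k) v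
    exact this.trans (Lp.toLp_compMeasurePreserving hφ (hmp.iterate k))
  have hsum : ∀ n, birkhoffSum U id n v = (hS n).toLp _ := by
    intro n
    induction n with
    | zero =>
      rw [birkhoffSum_zero]
      apply Lp.ext
      refine (Lp.coeFn_zero _ _ _).trans ?_
      refine EventuallyEq.trans ?_ (MemLp.coeFn_toLp _).symm
      rw [birkhoffSum_zero']
    | succ n ih =>
      rw [birkhoffSum_succ, ih, id, hUv, ← MemLp.toLp_add]
      congr 1
      funext x; rw [birkhoffSum_succ]; rfl
  have hproj : (U.eqLocus (1 : Lp ℝ 2 μ →L[ℝ] Lp ℝ 2 μ)).starProjection v = 0 := by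
    apply Submodule.eq_starProjection_of_mem_of_inner_eq_zero (Submodule.zero_mem _)
    intro w hw
    rw [sub_zero, L2.inner_def]
    have hw2 : U w = w := hw
    have hw3 : (w : α → ℝ) ∘ g =ᵐ[μ] w := by
      have h1 : (U w : α → ℝ) =ᵐ[μ] w ∘ g := Lp.coeFn_compMeasurePreserving w hmp
      rw [hw2] at h1
      exact h1.symm
    obtain ⟨c, hc⟩ := herg.ae_eq_const_of_ae_eq_comp_ae (Lp.aestronglyMeasurable w) hw3
    have h2 : ∫ a, inner ℝ ((v : α → ℝ) a) ((w : α → ℝ) a) ∂μ = ∫ a, c * φ a ∂μ := by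
      apply integral_congr_ae
      filter_upwards [hc, hφ.coeFn_toLp] with a h3 h4
      change inner ℝ ((hφ.toLp φ : α → ℝ) a) ((w : α → ℝ) a) = _
      rw [h3, h4]
      simp [mul_comm]
    rw [h2, integral_const_mul, h0, mul_zero]
  have hlim := U.tendsto_birkhoffAverage_orthogonalProjection
    V.norm_toContinuousLinearMap_le v
  have hlim2 : Tendsto (birkhoffAverage ℝ U id · v) atTop (nhds 0) := by
    convert hlim
    exact hproj.symm
  have hlim3 := hlim2.norm
  rw [norm_zero] at hlim3
  refine squeeze_zero (fun n => mul_nonneg (by positivity) (integral_nonneg fun x => abs_nonneg _)) ?_ hlim3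
  intro n
  rw [birkhoffAverage, norm_smul, hsum, Lp.norm_toLp, norm_inv, Real.norm_natCast]
  refine mul_le_mul_of_nonneg_left ?_ (by positivity)
  have h1 := integral_norm_eq_lintegral_enorm (hS n).1
  simp only [Real.norm_eq_abs] at h1
  rw [h1, ← eLpNorm_one_eq_lintegral_enorm]
  exact ENNReal.toReal_mono (hS n).2.ne (eLpNorm_le_eLpNorm_of_exponent_le (by norm_num) (hS n).1)

/-- packing estimate -/
theorem packing (x : ℕ → ℝ × ℝ) (N : ℕ) (η R Y : ℝ) (hη : 0 < η) (hR : 0 ≤ R) (hY : 0 ≤ Y)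
    (hsep : ∀ i j, i < j → η ≤ dist (x j) (x i))
    (hx : ∀ i ≤ N, |(x i).1 - (x 0).1| ≤ R) (hy : ∀ i, |(x i).2| ≤ Y) :
    (N:ℝ) + 1 ≤ (2 * R / η + 2) * (2 * Y / η + 2) := by
  classical
  have cardb : ∀ a b : ℝ, a ≤ b → ((Finset.Icc ⌊a / η⌋ ⌊b / η⌋).card : ℝ) ≤ (b - a) / η + 2 := by
    intro a b hab
    rw [Int.card_Icc]
    have hle : ⌊a / η⌋ ≤ ⌊b / η⌋ := Int.floor_le_floor (div_le_div_of_nonneg_right hab hη.le)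
    have h1 : (((⌊b / η⌋ + 1 - ⌊a / η⌋).toNat : ℤ) : ℝ) = ((⌊b / η⌋ + 1 - ⌊a / η⌋ : ℤ) : ℝ) := by
      rw [Int.toNat_of_nonneg (by omega)]
    have h2 : (((⌊b / η⌋ + 1 - ⌊a / η⌋).toNat : ℕ) : ℝ) = ((⌊b / η⌋ + 1 - ⌊a / η⌋ : ℤ) : ℝ) := by
      rw [← h1]; norm_cast
    rw [h2]
    push_cast
    have h3 := Int.floor_le (b / η)
    have h4 := Int.lt_floor_add_one (a / η)
    rw [sub_div]
    linarith
  let F : ℕ → ℤ × ℤ := fun i => (⌊(x i).1 / η⌋, ⌊(x i).2 / η⌋)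
  have fl : ∀ a b : ℝ, ⌊a / η⌋ = ⌊b / η⌋ → |a - b| < η := by
    intro a b h
    have h1 := Int.abs_sub_lt_one_of_floor_eq_floor h
    rw [← sub_div, abs_div, abs_of_pos hη, div_lt_one hη] at h1
    exact h1
  have hdist : ∀ i j, F i = F j → dist (x j) (x i) < η := by
    intro i j h
    rw [Prod.dist_eq, Real.dist_eq, Real.dist_eq]
    exact max_lt (fl _ _ (congrArg Prod.fst h).symm) (fl _ _ (congrArg Prod.snd h).symm)
  have hinj : Function.Injective F := by
    intro i j h
    rcases lt_trichotomy i j with h1 | h1 | h1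
    · exact absurd (hdist i j h) (not_lt.2 (hsep i j h1))
    · exact h1
    · exact absurd (hdist j i h.symm) (not_lt.2 (hsep j i h1))
  let a1 := (x 0).1 - R
  let b1 := (x 0).1 + R
  have hcard := Finset.card_le_card_of_injOn (s := Finset.range (N+1))
    (t := Finset.Icc ⌊a1 / η⌋ ⌊b1 / η⌋ ×ˢ Finset.Icc ⌊(-Y) / η⌋ ⌊Y / η⌋) F (by
      intro i hi
      have hi2 : i < N + 1 := Finset.mem_range.1 hi
      have h1 := abs_le.1 (hx i (by omega))
      have h2 := abs_le.1 (hy i)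
      have mono : ∀ a b : ℝ, a ≤ b → ⌊a / η⌋ ≤ ⌊b / η⌋ := fun a b hab =>
        Int.floor_le_floor (div_le_div_of_nonneg_right hab hη.le)
      refine Finset.mem_coe.2 (Finset.mem_product.2 ⟨Finset.mem_Icc.2 ⟨mono _ _ ?_, mono _ _ ?_⟩,
        Finset.mem_Icc.2 ⟨mono _ _ h2.1, mono _ _ h2.2⟩⟩)
      · change (x 0).1 - R ≤ _; linarith
      · change _ ≤ (x 0).1 + R; linarith) hinj.injOn
  rw [Finset.card_range, Finset.card_product] at hcard
  have hcard2 : ((N + 1 : ℕ) : ℝ) ≤ (((Finset.Icc ⌊a1 / η⌋ ⌊b1 / η⌋).card *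
    (Finset.Icc ⌊(-Y) / η⌋ ⌊Y / η⌋).card : ℕ) : ℝ) := Nat.cast_le.2 hcard
  push_cast at hcard2
  refine hcard2.trans ?_
  have e1 := cardb a1 b1 (by change (x 0).1 - R ≤ (x 0).1 + R; linarith)
  have e2 := cardb (-Y) Y (by linarith)
  have e3 : b1 - a1 = 2 * R := by change (x 0).1 + R - ((x 0).1 - R) = _; ring
  rw [e3] at e1
  have e4 : Y - -Y = 2 * Y := by ring
  rw [e4] at e2
  exact mul_le_mul e1 e2 (by positivity) (by positivity)

/-- Uniformly large partial sums contradict zero mean. -/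
theorem no_linear_growth {α : Type*} [MeasurableSpace α] (μ : Measure α) [IsProbabilityMeasure μ]
    (g : α → α) (herg : Ergodic g μ) (φ : α → ℝ) (hφ : MemLp φ 2 μ) (h0 : ∫ x, φ x ∂μ = 0)
    (K : Set α) (hK : ∀ᵐ x ∂μ, x ∈ K) (hinv : ∀ x ∈ K, g x ∈ K) (Φ : ℝ) (hΦ0 : 0 ≤ Φ)
    (hΦ : ∀ x ∈ K, |φ x| ≤ Φ) (c : ℝ) (hc : 0 < c) (N₀ : ℕ)
    (hgrow : ∀ x ∈ K, ∀ N : ℕ, N₀ ≤ N → ∃ i ≤ N, c * N < |birkhoffSum g φ i x|) : False := by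
  obtain ⟨hintg, hlim⟩ := mean_ergodic_L1 μ g herg φ hφ h0
  obtain ⟨m0, hm0⟩ := exists_nat_ge (2 * Φ / c)
  set m := m0 + 1 with hm
  have hmΦ : Φ ≤ c * m / 2 := by
    have : 2 * Φ / c ≤ m := hm0.trans (by rw [hm]; push_cast; linarith)
    rw [div_le_iff₀ hc] at this
    linarith
  have hiter : ∀ (k : ℕ), ∀ x ∈ K, g^[k] x ∈ K := by
    intro k
    induction k with
    | zero => intro x hx; exact hx
    | succ k ih => intro x hx; rw [Function.iterate_succ_apply]; exact ih _ (hinv x hx)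
  have hbs : ∀ (n : ℕ), ∀ x ∈ K, |birkhoffSum g φ n x| ≤ n * Φ := by
    intro n x hx
    rw [birkhoffSum]
    refine (Finset.abs_sum_le_sum_abs _ _).trans ?_
    refine (Finset.sum_le_card_nsmul _ _ Φ (fun i _ => hΦ _ (hiter i x hx))).trans ?_
    rw [Finset.card_range, nsmul_eq_mul]
  -- pointwise
  have hpt : ∀ n : ℕ, N₀ ≤ n → 1 ≤ n → ∀ x ∈ K,
      c * m * n / 2 ≤ ∑ k ∈ Finset.range (m+1), |birkhoffSum g φ (k * n) x| := by
    intro n hn hn1 x hx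
    obtain ⟨i, hi, hlt⟩ := hgrow x hx (m * n) (hn.trans (by rw [hm]; nlinarith))
    have hk : i / n < m + 1 := by
      have : i / n ≤ m := by
        calc i / n ≤ (m * n) / n := Nat.div_le_div_right hi
          _ = m := Nat.mul_div_cancel _ hn1
      omega
    have hsum : i = (i / n) * n + i % n := by rw [mul_comm]; exact (Nat.div_add_mod i n).symm
    have hsplit : birkhoffSum g φ i x = birkhoffSum g φ ((i/n)*n) x +
        birkhoffSum g φ (i % n) (g^[(i/n)*n] x) := by
      conv_lhs => rw [hsum]
      rw [birkhoffSum_add]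
    have hrem := hbs (i % n) _ (hiter ((i/n)*n) x hx)
    have hmod : ((i % n : ℕ) : ℝ) ≤ n := by exact_mod_cast (Nat.mod_lt i hn1).le
    have h1 : |birkhoffSum g φ (i % n) (g^[(i/n)*n] x)| ≤ n * (c * m / 2) :=
      hrem.trans (mul_le_mul hmod hmΦ hΦ0 (by positivity))
    have h2 : c * m * n / 2 ≤ |birkhoffSum g φ ((i/n)*n) x| := by
      have := abs_add_le (birkhoffSum g φ ((i/n)*n) x) (birkhoffSum g φ (i % n) (g^[(i/n)*n] x))
      rw [← hsplit] at this
      push_cast at hlt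
      nlinarith
    exact h2.trans (Finset.single_le_sum (f := fun k => |birkhoffSum g φ (k * n) x|)
      (fun k _ => abs_nonneg _) (Finset.mem_range.2 hk))
  -- integrate
  have hI : ∀ n : ℕ, N₀ ≤ n → 1 ≤ n →
      c * m * n / 2 ≤ ∑ k ∈ Finset.range (m+1), ∫ x, |birkhoffSum g φ (k * n) x| ∂μ := by
    intro n hn hn1
    rw [← integral_finset_sum _ (fun k _ => (hintg (k*n)).abs)]
    have : c * m * n / 2 = ∫ _, c * m * n / 2 ∂μ := by simp
    rw [this]
    refine integral_mono_ae (integrable_const _)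
      (integrable_finset_sum _ (fun k _ => (hintg (k*n)).abs)) ?_
    filter_upwards [hK] with x hx
    exact hpt n hn hn1 x hx
  have hl : Tendsto (fun n : ℕ => ∑ k ∈ Finset.range (m+1),
      (n:ℝ)⁻¹ * ∫ x, |birkhoffSum g φ (k * n) x| ∂μ) atTop (nhds 0) := by
    rw [show (0:ℝ) = ∑ k ∈ Finset.range (m+1), (0:ℝ) by simp]
    refine tendsto_finset_sum _ (fun k _ => ?_)
    rcases Nat.eq_zero_or_pos k with hk | hk
    · subst hk
      simp
    · have ht : Tendsto (fun n : ℕ => k * n) atTop atTop :=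
        tendsto_id.const_mul_atTop' hk
      have := (hlim.comp ht).const_mul (k:ℝ)
      rw [mul_zero] at this
      refine this.congr (fun n => ?_)
      simp only [Function.comp]
      push_cast
      have hk' : (k:ℝ) ≠ 0 := by exact_mod_cast hk.ne'
      rw [mul_inv, ← mul_assoc, ← mul_assoc, mul_inv_cancel₀ hk', one_mul]
  have hge : ∀ᶠ n : ℕ in atTop, c * m / 2 ≤ ∑ k ∈ Finset.range (m+1),
      (n:ℝ)⁻¹ * ∫ x, |birkhoffSum g φ (k * n) x| ∂μ := by
    filter_upwards [eventually_ge_atTop N₀, eventually_ge_atTop 1] with n h1 h2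
    have h3 := hI n h1 h2
    have hn : (0:ℝ) < n := by exact_mod_cast h2
    rw [← Finset.mul_sum, inv_mul_eq_div, le_div_iff₀ hn]
    linarith
  have := ge_of_tendsto hl hge
  have h5 : (0:ℝ) < m := by rw [hm]; push_cast; positivity
  have : 0 < c * m / 2 := by positivity
  linarith

theorem recurrence (gt : ℝ × ℝ → ℝ × ℝ)
    (g : AddCircle (1 : ℝ) × ℝ → AddCircle (1 : ℝ) × ℝ) (hgc : Continuous g)
    (hsemi : ∀ p : ℝ × ℝ, annulusProj (gt p) = g (annulusProj p))
    (μ : Measure (AddCircle (1 : ℝ) × ℝ)) [IsProbabilityMeasure μ]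
    (herg : Ergodic g μ)
    (K₀ : Set (AddCircle (1 : ℝ) × ℝ))
    (hK₀supp : K₀ = {x | ∀ U : Set (AddCircle (1 : ℝ) × ℝ), IsOpen U → x ∈ U → 0 < μ U})
    (hK₀cpt : IsCompact K₀)
    (φ : AddCircle (1 : ℝ) × ℝ → ℝ) (hφc : Continuous φ)
    (hφ : ∀ p : ℝ × ℝ, φ (annulusProj p) = (gt p).1 - p.1)
    (hrot : ∫ x, φ x ∂μ = 0) (Y : ℝ) (hY0 : 0 ≤ Y) (hY : ∀ k ∈ K₀, |k.2| ≤ Y) :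
    (∀ x ∈ K₀, g x ∈ K₀) ∧
    ∀ η > 0, ∃ q, annulusProj q ∈ K₀ ∧ ∃ N ≥ 1, dist (gt^[N] q) q < η := by
  have hinv : ∀ x ∈ K₀, g x ∈ K₀ := by
    intro x hx
    rw [hK₀supp] at hx ⊢
    intro U hU hxU
    rw [← herg.toMeasurePreserving.measure_preimage hU.measurableSet.nullMeasurableSet]
    exact hx _ (hU.preimage hgc) hxU
  refine ⟨hinv, ?_⟩
  have hae : ∀ᵐ x ∂μ, x ∈ K₀ := by
    refine measure_null_of_locally_null _ (fun x hx => ?_)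
    have hx2 : x ∉ K₀ := hx
    rw [hK₀supp] at hx2
    simp only [Set.mem_setOf_eq] at hx2
    push Not at hx2
    obtain ⟨U, hU, hxU, h0⟩ := hx2
    exact ⟨U, mem_nhdsWithin_of_mem_nhds (hU.mem_nhds hxU), le_antisymm h0 bot_le⟩
  obtain ⟨Φ0, hΦ0⟩ := hK₀cpt.exists_bound_of_continuousOn hφc.continuousOn
  have hΦ : ∀ x ∈ K₀, |φ x| ≤ max Φ0 0 := fun x hx => (hΦ0 x hx).trans (le_max_left _ _)
  have hmem : MemLp φ 2 μ := by
    refine MemLp.of_bound hφc.aestronglyMeasurable (max Φ0 0) ?_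
    filter_upwards [hae] with x hx using hΦ x hx
  intro η hη
  by_contra hno
  push Not at hno
  have hproj : ∀ (i : ℕ) q, annulusProj (gt^[i] q) = g^[i] (annulusProj q) := by
    intro i q
    induction i with
    | zero => rfl
    | succ i ih => rw [Function.iterate_succ_apply', hsemi, ih, Function.iterate_succ_apply']
  have hbirk : ∀ (i : ℕ) q, birkhoffSum g φ i (annulusProj q) = (gt^[i] q).1 - q.1 := by
    intro i q
    induction i with
    | zero => simp
    | succ i ih =>
      rw [birkhoffSum_succ, ih, ← hproj, hφ, Function.iterate_succ_apply']
      ring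
  have hiter : ∀ (k : ℕ), ∀ x ∈ K₀, g^[k] x ∈ K₀ := by
    intro k
    induction k with
    | zero => intro x hx; exact hx
    | succ k ih => intro x hx; rw [Function.iterate_succ_apply]; exact ih _ (hinv x hx)
  set D := 2 * Y / η + 2 with hD
  have hDpos : 0 < D := by positivity
  obtain ⟨N₀, hN₀⟩ := exists_nat_ge (4 * D)
  refine no_linear_growth μ g herg φ hmem hrot K₀ hae hinv (max Φ0 0) (le_max_right _ _) hΦ
    (η / (4 * D)) (by positivity) N₀ ?_
  intro x hx N hN
  by_contra hcon
  push Not at hcon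
  obtain ⟨q, rfl⟩ : ∃ q, annulusProj q = x := by
    obtain ⟨a, b⟩ := x
    obtain ⟨r, rfl⟩ := QuotientAddGroup.mk_surjective a
    exact ⟨(r, b), rfl⟩
  have hp := packing (fun i => gt^[i] q) N η (η / (4 * D) * N) Y hη (by positivity) hY0
    (by
      intro i j hij
      have h1 : gt^[j] q = gt^[j - i] (gt^[i] q) := by
        rw [← Function.iterate_add_apply, Nat.sub_add_cancel hij.le]
      rw [h1]
      exact hno _ (by rw [hproj]; exact hiter _ _ hx) (j - i) (by omega))
    (by
      intro i hi
      have := hcon i hi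
      rw [hbirk] at this
      exact this)
    (by
      intro i
      have h1 := hY _ (hiter i _ hx)
      rw [← hproj] at h1
      exact h1)
  rw [← hD] at hp
  have h4 : 4 * D ≤ N := hN₀.trans (by exact_mod_cast hN)
  have h5 : (2 * (η / (4 * D) * N) / η + 2) * D = N / 2 + 2 * D := by
    field_simp
    ring
  rw [h5] at hp
  linarith

/-- Let `g̃` be an orientation-preserving `C¹` diffeomorphism
of the plane commuting with the translation `T(x,y) = (x+1,y)` and fixing both
ends of the induced annulus `A = (ℝ/ℤ) × ℝ`, and let `g : A → A` be the induced
diffeomorphism. Let `μ` be a `g`-invariant ergodic Borel probability measure on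
`A` with compact support `K₀`, let `φ` be the displacement cocycle of `g̃`, and
assume the rotation number `ρ_μ(g̃) = ∫ φ dμ` vanishes and
`Fix(g̃) ∩ π⁻¹(K₀) = ∅`. Then some point of `π(Fix(g̃))` peripherally contains
neither end of `A` rel `K₀`. -/
theorem stmt9 (gt : (ℝ × ℝ) ≃ (ℝ × ℝ))
    (hC1 : ContDiff ℝ 1 (⇑gt : ℝ × ℝ → ℝ × ℝ))
    (hC1' : ContDiff ℝ 1 (⇑gt.symm : ℝ × ℝ → ℝ × ℝ))
    (hjac : ∀ p : ℝ × ℝ, 0 < (fderiv ℝ (⇑gt : ℝ × ℝ → ℝ × ℝ) p).det)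
    (hcomm : ∀ p : ℝ × ℝ, gt (p.1 + 1, p.2) = ((gt p).1 + 1, (gt p).2))
    (htop : ∀ x : ℝ, Tendsto (fun y : ℝ => (gt (x, y)).2) atTop atTop)
    (hbot : ∀ x : ℝ, Tendsto (fun y : ℝ => (gt (x, y)).2) atBot atBot)
    (g : AddCircle (1 : ℝ) × ℝ → AddCircle (1 : ℝ) × ℝ) (hgc : Continuous g)
    (hsemi : ∀ p : ℝ × ℝ, annulusProj (gt p) = g (annulusProj p))
    (μ : Measure (AddCircle (1 : ℝ) × ℝ)) [IsProbabilityMeasure μ]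
    (herg : Ergodic g μ)
    (K₀ : Set (AddCircle (1 : ℝ) × ℝ))
    (hK₀supp : K₀ = {x | ∀ U : Set (AddCircle (1 : ℝ) × ℝ), IsOpen U → x ∈ U → 0 < μ U})
    (hK₀cpt : IsCompact K₀)
    (φ : AddCircle (1 : ℝ) × ℝ → ℝ) (hφc : Continuous φ)
    (hφ : ∀ p : ℝ × ℝ, φ (annulusProj p) = (gt p).1 - p.1)
    (hrot : ∫ x, φ x ∂μ = 0)
    (hdisj : {p : ℝ × ℝ | gt p = p} ∩ annulusProj ⁻¹' K₀ = ∅) :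
    ∃ p : ℝ × ℝ, gt p = p ∧
      ¬ PeriphContainsEnd K₀ g (annulusProj p) atTop ∧
      ¬ PeriphContainsEnd K₀ g (annulusProj p) atBot := by
  by_contra hneg
  have hper : ∀ z, gt z = z → PeriphContainsEnd K₀ g (annulusProj z) atTop ∨
      PeriphContainsEnd K₀ g (annulusProj z) atBot := by
    intro z hz
    by_contra h
    rw [not_or] at h
    exact hneg ⟨z, hz, h.1, h.2⟩
  have fc : Continuous gt := hC1.continuous
  have fc' : Continuous gt.symm := hC1'.continuous
  have hcl : IsClosed K₀ := hK₀cpt.isClosed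
  obtain ⟨Y0, hY0⟩ := hK₀cpt.exists_bound_of_continuousOn
    (f := fun k : AddCircle (1:ℝ) × ℝ => k.2) continuous_snd.continuousOn
  obtain ⟨Y, hYpos, hY⟩ : ∃ Y : ℝ, 0 ≤ Y ∧ ∀ k ∈ K₀, |k.2| ≤ Y :=
    ⟨max Y0 0, le_max_right _ _, fun k hk => (hY0 k hk).trans (le_max_left _ _)⟩
  obtain ⟨hinv, hrec⟩ := recurrence gt g hgc hsemi μ herg K₀ hK₀supp hK₀cpt φ hφc hφ hrot Y hYpos hY
  have hYt : ∀ k ∈ annulusProj ⁻¹' K₀, |k.2| ≤ Y := fun k hk => hY _ hk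
  have hKtcl : IsClosed (annulusProj ⁻¹' K₀) := hcl.preimage annulusProj_cont
  have Kper : ∀ z ∈ annulusProj ⁻¹' K₀, ∀ n : ℤ, (z.1 + (n:ℝ), z.2) ∈ annulusProj ⁻¹' K₀ := by
    intro z hz n
    change annulusProj (z.1 + (n:ℝ), z.2) ∈ K₀
    rw [annulusProj_per]
    exact hz
  obtain ⟨M, hYM, hT, hB⟩ := unif_top gt fc fc' hcomm (htop 0) (hbot 0) (Y + 1) (by linarith)
  -- uniform margin for the squares
  obtain ⟨c₁, hc₁, hsq⟩ := periodic_compact (SqW gt (annulusProj ⁻¹' K₀) M)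
    {z | gt z = z ∧ |z.2| ≤ M} M
    (fun c c' z h hz => SqW.mono h hz)
    (fun c z n hz => SqW.transl hcomm Kper hz n)
    (by
      intro z hz n
      refine ⟨?_, hz.2⟩
      rw [comm_int gt hcomm n z, hz.1])
    (IsClosed.inter (isClosed_eq fc continuous_id)
      (isClosed_le (continuous_abs.comp continuous_snd) continuous_const))
    (fun z hz => hz.2)
    (by
      intro z hz
      obtain ⟨c, hc, hs⟩ := sq_of_periph gt fc g hsemi K₀ hcl Y M hY (by linarith) z hz.1 (hper z hz.1)
      obtain ⟨U, hU, hUs⟩ := SqW.loc fc hc hz.1 hs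
      exact ⟨c / 2, by linarith, U, hU, fun z' hz' hS => hUs z' hz' hS.1⟩)
  -- uniform displacement near the support
  obtain ⟨c₂, hc₂, hnear⟩ := periodic_compact
    (fun c k => ∀ p : ℝ × ℝ, dist p k < 2 * c → c ≤ dist (gt p) p)
    (annulusProj ⁻¹' K₀) Y
    (fun c c' z h hz p hp => h.trans (hz p (by linarith)))
    (by
      intro c z n hz p hp
      have e := comm_int gt hcomm (-n) p
      have h1 := hz (p.1 + ((-n : ℤ) : ℝ), p.2) (by
        rw [Prod.dist_eq, Real.dist_eq, Real.dist_eq] at hp ⊢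
        have : p.1 + ((-n : ℤ) : ℝ) - z.1 = p.1 - (z.1 + (n:ℝ)) := by push_cast; ring
        beta_reduce at hp ⊢
        rw [this]
        exact hp)
      rw [e, Prod.dist_eq, Real.dist_eq, Real.dist_eq] at h1
      rw [Prod.dist_eq, Real.dist_eq, Real.dist_eq]
      simpa using h1)
    Kper hKtcl hYt
    (by
      intro k hk
      have hne : gt k ≠ k := by
        intro h
        have : k ∈ {p : ℝ × ℝ | gt p = p} ∩ annulusProj ⁻¹' K₀ := ⟨h, hk⟩
        rw [hdisj] at this
        exact this
      have hd : 0 < dist (gt k) k := dist_pos.2 hne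
      have hcd : Continuous (fun p => dist (gt p) p) := fc.dist continuous_id
      have hev : ∀ᶠ p in nhds k, dist (gt k) k / 2 < dist (gt p) p :=
        hcd.continuousAt.eventually (lt_mem_nhds (by linarith))
      obtain ⟨r, hr, hball⟩ := Metric.eventually_nhds_iff.1 hev
      refine ⟨min (dist (gt k) k / 2) (r / 4), by positivity, Metric.ball k (r / 2),
        Metric.ball_mem_nhds _ (by linarith), ?_⟩
      intro k' hk' _ p hp
      have h1 := min_le_right (dist (gt k) k / 2) (r / 4)
      have h2 : dist p k < r := by
        have := dist_triangle p k' k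
        have := Metric.mem_ball.1 hk'
        linarith
      exact (min_le_left _ _).trans (hball h2).le)
  have hcpos : 0 < min (min c₁ c₂) 1 := by positivity
  have hle1 : min (min c₁ c₂) 1 ≤ c₁ := (min_le_left _ _).trans (min_le_left _ _)
  have hle2 : min (min c₁ c₂) 1 ≤ c₂ := (min_le_left _ _).trans (min_le_right _ _)
  have hle3 : min (min c₁ c₂) 1 ≤ 1 := min_le_right _ _
  refine closing gt fc gt.injective (annulusProj ⁻¹' K₀) ?_ Y hYt (disp_bdd gt fc hcomm) M
    (by linarith) hT hB (min (min c₁ c₂) 1) hcpos hle3 ?_ ?_ ?_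
  · intro p hp
    change annulusProj (gt p) ∈ K₀
    rw [hsemi]
    exact hinv _ hp
  · intro k hk p hp
    exact hle2.trans (hnear k hk p (by linarith))
  · obtain ⟨q, hq, N, hN, hd⟩ := hrec _ hcpos
    exact ⟨q, hq, N, hN, hd⟩
  · intro z hz
    rcases le_or_gt |z.2| M with h | h
    · exact SqW.mono hle1 (hsq z ⟨hz, h⟩)
    · exact SqW.mono hle3 (SqW.high hz hYt hYM h)
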